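/- arXiv:math/0406163 — 2 statements merged into one kernel-verified Lean document; each statement's English description precedes it below -/
import Mathlib

section
/- Let d be a fixed positive integer and R > 0 a fixed real number, and set γ = (√(R(R+1)) − R)^2 / (4R^2). Then for every ε > 0 there exists N such that for all integers n ≥ N and r ≥ N and every finite abelian group A = C_{x_1} × C_{x_2} × ⋯ × C_{x_t} in which each value among the orders x_1, …, x_t of the cyclic factors occurs at most d times, if r·|A|^R ≤ n then log s_r(A) ≤ (γ + ε)·(log n)^2 / log log n. -/
/-- `s_r(A)`: the number of subgroups of `A` of index at most `r`. -/
noncomputable def subCount (r : ℕ) (X : Type) [Group X] : ℕ :=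
  Nat.card {H : Subgroup X // H.index ≤ r}

/-- The standard finite abelian group attached to a tuple of moduli. -/
abbrev CycProd {k : ℕ} (m : Fin k → ℕ) : Type := ∀ j, Multiplicative (ZMod (m j))

lemma card_hom_cyc (a b : ℕ) (hb : 0 < b) :
    Nat.card (Multiplicative (ZMod a) →* Multiplicative (ZMod b)) = Nat.gcd a b := by
  have : NeZero b := ⟨hb.ne'⟩
  have e1 : (Multiplicative (ZMod a) →* Multiplicative (ZMod b)) ≃
      {f : ℤ →+ ZMod b // f (a : ℤ) = 0} :=
    (AddMonoidHom.toMultiplicative.symm).trans (ZMod.lift a).symm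
  have e2 : {f : ℤ →+ ZMod b // f (a : ℤ) = 0} ≃ (nsmulAddMonoidHom a : ZMod b →+ ZMod b).ker := by
    refine ((zmultiplesHom (ZMod b)).symm.subtypeEquiv ?_)
    intro f
    rw [AddMonoidHom.mem_ker]
    simp only [nsmulAddMonoidHom_apply, zmultiplesHom_symm_apply]
    rw [← map_nsmul]
    simp
  rw [Nat.card_congr (e1.trans e2), IsAddCyclic.card_nsmulAddMonoidHom_ker, Nat.card_zmod, Nat.gcd_comm]

lemma card_hom_pi {k : ℕ} (m : Fin k → ℕ) (G : Type) [Group G] :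
    Nat.card (G →* CycProd m) = ∏ j, Nat.card (G →* Multiplicative (ZMod (m j))) := by
  rw [← Nat.card_pi]
  refine Nat.card_congr ⟨fun f j => (Pi.evalMonoidHom _ j).comp f, fun g => MonoidHom.pi g, ?_, ?_⟩
  · intro f; rfl
  · intro g; rfl

lemma card_pi_hom {t : ℕ} (x : Fin t → ℕ) (G : Type) [CommGroup G] :
    Nat.card (CycProd x →* G) = ∏ i, Nat.card (Multiplicative (ZMod (x i)) →* G) := by
  rw [← Nat.card_pi]
  exact (Nat.card_congr (Pi.monoidHomMulEquiv (fun i => Multiplicative (ZMod (x i))) G).toEquiv.symm).symm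

lemma card_hom_cycProd {t k : ℕ} (x : Fin t → ℕ) (m : Fin k → ℕ) (hm : ∀ j, 0 < m j) :
    Nat.card (CycProd x →* CycProd m) = ∏ i, ∏ j, Nat.gcd (x i) (m j) := by
  rw [card_pi_hom]
  refine Finset.prod_congr rfl fun i _ => ?_
  rw [card_hom_pi]
  exact Finset.prod_congr rfl fun j _ => card_hom_cyc _ _ (hm j)

/-- Block triangular automorphisms of a product. -/
def blockAut {B C : Type} [CommGroup B] [CommGroup C] (f : B →* C) (g : C →* B) (a : B ≃* B) :
    (B × C) ≃* (B × C) where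
  toFun z := (a (z.1 * g z.2), z.2 * f (a (z.1 * g z.2)))
  invFun z := (a.symm z.1 / g (z.2 / f z.1), z.2 / f z.1)
  left_inv z := by simp
  right_inv z := by simp
  map_mul' z w := by
    ext
    · simp [mul_mul_mul_comm]
    · simp only [Prod.fst_mul, Prod.snd_mul, map_mul]
      simp only [mul_comm, mul_left_comm, mul_assoc]

lemma card_aut_prod (B C : Type) [CommGroup B] [CommGroup C] [Finite B] [Finite C] :
    Nat.card (B →* C) * Nat.card (C →* B) * Nat.card (B ≃* B) ≤
      Nat.card ((B × C) ≃* (B × C)) := by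
  rw [← Nat.card_prod, ← Nat.card_prod]
  have : Finite ((B × C) ≃* (B × C)) := Finite.of_injective (fun e => (e : B × C → B × C))
    DFunLike.coe_injective
  refine Nat.card_le_card_of_injective (fun z => blockAut z.1.1 z.1.2 z.2) ?_
  rintro ⟨⟨f, g⟩, a⟩ ⟨⟨f', g'⟩, a'⟩ h
  have h' : ∀ z : B × C, (a (z.1 * g z.2), z.2 * f (a (z.1 * g z.2))) =
      (a' (z.1 * g' z.2), z.2 * f' (a' (z.1 * g' z.2))) := fun z => DFunLike.congr_fun h z
  have ha : a = a' := by
    ext b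
    have := congrArg Prod.fst (h' (b, 1))
    simpa using this
  subst ha
  have hg : g = g' := by
    ext c
    have := congrArg Prod.fst (h' (1, c))
    simpa using this
  subst hg
  have hf : f = f' := by
    ext b
    have := congrArg Prod.snd (h' (a.symm b, 1))
    simpa using this
  subst hf
  rfl

lemma finite_cycProd {k : ℕ} (m : Fin k → ℕ) (hm : ∀ j, 0 < m j) : Finite (CycProd m) := by
  have : ∀ j, NeZero (m j) := fun j => ⟨(hm j).ne'⟩
  infer_instance

lemma card_cycProd {k : ℕ} (m : Fin k → ℕ) : Nat.card (CycProd m) = ∏ j, m j := by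
  rw [Nat.card_pi]
  exact Finset.prod_congr rfl fun j _ => 
    (Nat.card_congr Multiplicative.toAdd).trans (Nat.card_zmod (m j))

/-- Splitting off the first factor. -/
def consMul {k : ℕ} (m : Fin (k + 1) → ℕ) :
    CycProd m ≃* CycProd (fun j : Fin k => m j.succ) × Multiplicative (ZMod (m 0)) where
  toFun z := (fun j => z j.succ, z 0)
  invFun z := Fin.cons z.2 z.1
  left_inv z := by
    funext j
    refine Fin.cases ?_ (fun j => ?_) j <;> simp
  right_inv z := by simp
  map_mul' z w := rfl

lemma card_aut_cycProd {k : ℕ} (m : Fin k → ℕ) (hm : ∀ j, 0 < m j) :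
    ∏ i, ∏ j, Nat.gcd (m i) (m j) ≤ Nat.card (CycProd m ≃* CycProd m) * ∏ j, m j := by
  induction k with
  | zero =>
    have := finite_cycProd m hm
    have : Finite (CycProd m ≃* CycProd m) := Finite.of_injective (fun e => (e : CycProd m → CycProd m))
      DFunLike.coe_injective
    have : 0 < Nat.card (CycProd m ≃* CycProd m) := Nat.card_pos
    simpa using this
  | succ k ih =>
    set m' : Fin k → ℕ := fun j => m j.succ with hm'
    have hm'0 : ∀ j, 0 < m' j := fun j => hm _
    have := finite_cycProd m' hm'0
    have : NeZero (m 0) := ⟨(hm 0).ne'⟩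
    have h1 := card_aut_prod (CycProd m') (Multiplicative (ZMod (m 0)))
    have h2 : Nat.card (CycProd m ≃* CycProd m) =
        Nat.card ((CycProd m' × Multiplicative (ZMod (m 0))) ≃*
          (CycProd m' × Multiplicative (ZMod (m 0)))) :=
      Nat.card_congr (MulAut.congr (consMul m)).toEquiv
    have h3 := ih m' hm'0
    rw [card_pi_hom, card_hom_pi] at h1
    simp only [card_hom_cyc _ _ (hm 0), card_hom_cyc _ _ (hm'0 _)] at h1
    simp only [Fin.prod_univ_succ, Finset.prod_mul_distrib, Nat.gcd_self]
    rw [h2]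
    calc _ = m 0 * (∏ i, (m' i).gcd (m 0)) * (∏ i, (m 0).gcd (m' i)) *
          (∏ i, ∏ j, (m' i).gcd (m' j)) := by simp only [hm']; ring
      _ ≤ m 0 * (∏ i, (m' i).gcd (m 0)) * (∏ i, (m 0).gcd (m' i)) *
          (Nat.card (CycProd m' ≃* CycProd m') * ∏ j, m' j) := by gcongr
      _ = (∏ i, (m' i).gcd (m 0)) * (∏ i, (m 0).gcd (m' i)) *
          (Nat.card (CycProd m' ≃* CycProd m')) * (m 0 * ∏ j, m' j) := by ring
      _ ≤ _ := by gcongr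

lemma card_quot_type (A M : Type) [CommGroup A] [Group M] [Finite A] [Finite M] :
    Nat.card {H : Subgroup A // Nonempty ((A ⧸ H) ≃* M)} * Nat.card (M ≃* M) ≤
      Nat.card (A →* M) := by
  rw [← Nat.card_prod]
  have : Finite (A →* M) := Finite.of_injective (fun e => (e : A → M)) DFunLike.coe_injective
  refine Nat.card_le_card_of_injective
    (fun z => ((z.1.2.some.trans z.2 : (A ⧸ z.1.1) ≃* M) : (A ⧸ z.1.1) →* M).comp
      (QuotientGroup.mk' z.1.1)) ?_
  rintro ⟨⟨H, hH⟩, a⟩ ⟨⟨K, hK⟩, b⟩ h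
  have hk := congrArg MonoidHom.ker h
  have key : ∀ (H : Subgroup A) (e : (A ⧸ H) ≃* M),
      ((e : (A ⧸ H) →* M).comp (QuotientGroup.mk' H)).ker = H := by
    intro H e
    ext y
    simp
  simp only [key] at hk
  subst hk
  simp only [Prod.mk.injEq, true_and]
  ext y
  obtain ⟨q, rfl⟩ := hH.some.surjective y
  obtain ⟨q, rfl⟩ := QuotientGroup.mk_surjective q
  have := DFunLike.congr_fun h q
  simpa using this

lemma sum_inv_sq_le (N : ℕ) : ∑ m ∈ Finset.Icc 2 N, ((m : ℝ) ^ 2)⁻¹ ≤ 1 := by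
  have h : ∀ N : ℕ, 1 ≤ N → ∑ m ∈ Finset.Icc 2 N, ((m : ℝ) ^ 2)⁻¹ ≤ 1 - 1 / N := by
    intro N hN
    induction N, hN using Nat.le_induction with
    | base => simp
    | succ n hn ih =>
      rw [Finset.sum_Icc_succ_top (by omega)]
      have hn' : (0 : ℝ) < n := by exact_mod_cast hn
      have : (((n + 1 : ℕ) : ℝ) ^ 2)⁻¹ ≤ 1 / n - 1 / ((n + 1 : ℕ) : ℝ) := by
        push_cast
        rw [div_sub_div _ _ hn'.ne' (by positivity), inv_eq_one_div, div_le_div_iff₀ (by positivity) (by positivity)]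
        nlinarith
      linarith
  rcases Nat.eq_zero_or_pos N with rfl | hN
  · simp
  · have := h N hN
    have h2 : (0 : ℝ) ≤ 1 / N := by positivity
    linarith

/-- Ordered factorizations with `k` factors and product at most `N`. -/
noncomputable def factTuples (k N : ℕ) : Finset (Fin k → ℕ) :=
  (Fintype.piFinset (fun _ : Fin k => Finset.Icc 2 N)).filter (fun m => ∏ j, m j ≤ N)

lemma card_factTuples (k N : ℕ) (hN : 0 < N) : ((factTuples k N).card : ℝ) ≤ (N : ℝ) ^ 2 := by
  have hN' : (0 : ℝ) < (N : ℝ) ^ 2 := by positivity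
  have h1 : ((factTuples k N).card : ℝ) * ((N : ℝ) ^ 2)⁻¹ ≤
      ∑ m ∈ factTuples k N, ∏ j, ((m j : ℝ) ^ 2)⁻¹ := by
    rw [← nsmul_eq_mul]
    refine Finset.card_nsmul_le_sum _ _ _ fun m hm => ?_
    simp only [factTuples, Finset.mem_filter, Fintype.mem_piFinset, Finset.mem_Icc] at hm
    rw [Finset.prod_inv_distrib, Finset.prod_pow]
    have hp : 0 < ∏ j, m j := Finset.prod_pos fun j _ => by have := (hm.1 j).1; omega
    have h2 : (0 : ℝ) < ∏ j, (m j : ℝ) := by exact_mod_cast hp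
    have h3 : (∏ j, (m j : ℝ)) ≤ N := by exact_mod_cast hm.2
    gcongr
  have h2 : ∑ m ∈ factTuples k N, ∏ j, ((m j : ℝ) ^ 2)⁻¹ ≤
      ∑ m ∈ Fintype.piFinset (fun _ : Fin k => Finset.Icc 2 N), ∏ j, ((m j : ℝ) ^ 2)⁻¹ :=
    Finset.sum_le_sum_of_subset_of_nonneg (Finset.filter_subset _ _) fun m _ _ => by positivity
  rw [← Finset.prod_univ_sum (fun _ : Fin k => Finset.Icc 2 N) (fun _ m => ((m : ℝ) ^ 2)⁻¹)] at h2
  have h3 : ∏ _j : Fin k, ∑ m ∈ Finset.Icc 2 N, ((m : ℝ) ^ 2)⁻¹ ≤ 1 :=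
    Finset.prod_le_one (fun _ _ => by positivity) fun _ _ => sum_inv_sq_le N
  have h4 := h1.trans (h2.trans h3)
  rwa [← div_eq_mul_inv, div_le_one hN'] at h4

lemma subCount_le {t : ℕ} (x : Fin t → ℕ) (hx : ∀ i, 0 < x i) (r : ℕ) (B : ℝ) (hB : 0 ≤ B)
    (h : ∀ (k : ℕ) (m : Fin k → ℕ), (∀ j, 1 < m j) → ∏ j, m j ≤ r → ∏ j, m j ≤ ∏ i, x i →
      ((∏ i, ∏ j, Nat.gcd (x i) (m j) : ℕ) : ℝ) * ((∏ j, m j : ℕ) : ℝ) ≤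
        B * ((∏ i, ∏ j, Nat.gcd (m i) (m j) : ℕ) : ℝ)) :
    (subCount r (CycProd x) : ℝ) ≤
      ((Nat.log 2 (∏ i, x i) : ℝ) + 1) * ((∏ i, x i : ℕ) : ℝ) ^ 2 * B := by
  classical
  have := finite_cycProd x hx
  set N := ∏ i, x i with hN
  have hN0 : 0 < N := Finset.prod_pos fun i _ => hx i
  let _ : Fintype (Subgroup (CycProd x)) := Fintype.ofFinite _
  let S : (k : ℕ) → (Fin k → ℕ) → Finset (Subgroup (CycProd x)) := fun k m =>
    Finset.univ.filter fun H => H.index ≤ r ∧ Nonempty ((CycProd x ⧸ H) ≃* CycProd m)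
  have hS : ∀ k, ∀ m ∈ factTuples k N, ((S k m).card : ℝ) ≤ B := by
    intro k m hm
    simp only [factTuples, Finset.mem_filter, Fintype.mem_piFinset, Finset.mem_Icc] at hm
    have hm1 : ∀ j, 1 < m j := fun j => (hm.1 j).1
    have hm0 : ∀ j, 0 < m j := fun j => (hm1 j).le
    by_cases hr : ∏ j, m j ≤ r
    · have h1 := h k m hm1 hr hm.2
      have := finite_cycProd m hm0
      have h2 := card_quot_type (CycProd x) (CycProd m)
      rw [card_hom_cycProd x m hm0] at h2
      have h3 := card_aut_cycProd m hm0
      have h4 : (S k m).card ≤ Nat.card {H : Subgroup (CycProd x) // Nonempty ((CycProd x ⧸ H) ≃* CycProd m)} := by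
        rw [Nat.card_eq_fintype_card, Fintype.card_subtype]
        refine Finset.card_le_card ?_
        intro H hH
        simp only [S, Finset.mem_filter, Finset.mem_univ, true_and] at hH ⊢
        exact hH.2
      have hE : (0 : ℝ) < ((∏ i, ∏ j, Nat.gcd (m i) (m j) : ℕ) : ℝ) := by
        exact_mod_cast Finset.prod_pos fun i _ => Finset.prod_pos fun j _ =>
          Nat.gcd_pos_of_pos_left _ (hm0 i)
      have h5 : (S k m).card * (∏ i, ∏ j, Nat.gcd (m i) (m j)) ≤
          (∏ i, ∏ j, Nat.gcd (x i) (m j)) * ∏ j, m j := by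
        calc _ ≤ (S k m).card * (Nat.card (CycProd m ≃* CycProd m) * ∏ j, m j) := by gcongr
          _ = (S k m).card * (Nat.card (CycProd m ≃* CycProd m)) * ∏ j, m j := by ring
          _ ≤ (Nat.card {H : Subgroup (CycProd x) // Nonempty ((CycProd x ⧸ H) ≃* CycProd m)}
              * (Nat.card (CycProd m ≃* CycProd m))) * ∏ j, m j := by gcongr
          _ ≤ _ := by gcongr
      have h6 : ((S k m).card : ℝ) * ((∏ i, ∏ j, Nat.gcd (m i) (m j) : ℕ) : ℝ) ≤
          ((∏ i, ∏ j, Nat.gcd (x i) (m j) : ℕ) : ℝ) * ((∏ j, m j : ℕ) : ℝ) := by exact_mod_cast h5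
      exact le_of_mul_le_mul_right (h6.trans h1) hE
    · have : S k m = ∅ := by
        refine Finset.filter_eq_empty_iff.2 ?_
        rintro H _ ⟨h1, ⟨e⟩⟩
        apply hr
        rw [← card_cycProd m, ← Nat.card_congr e.toEquiv, ← Subgroup.index_eq_card]
        exact h1
      rw [this]; simpa using hB
  have hcov : (Finset.univ.filter fun H : Subgroup (CycProd x) => H.index ≤ r) ⊆
      (Finset.range (Nat.log 2 N + 1)).biUnion fun k => (factTuples k N).biUnion fun m => S k m := by
    intro H hH
    simp only [Finset.mem_filter, Finset.mem_univ, true_and] at hH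
    obtain ⟨ι, _, n, hn1, ⟨e⟩⟩ := CommGroup.equiv_prod_multiplicative_zmod_of_finite (CycProd x ⧸ H)
    set k := Fintype.card ι
    let f : Fin k ≃ ι := (Fintype.equivFin ι).symm
    let m : Fin k → ℕ := fun j => n (f j)
    have e2 : (∀ i : ι, Multiplicative (ZMod (n i))) ≃* CycProd m :=
      { toFun := fun z j => z (f j)
        invFun := (Equiv.piCongrLeft (fun i => Multiplicative (ZMod (n i))) f)
        left_inv := (Equiv.piCongrLeft (fun i => Multiplicative (ZMod (n i))) f).right_inv
        right_inv := (Equiv.piCongrLeft (fun i => Multiplicative (ZMod (n i))) f).left_inv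
        map_mul' := fun _ _ => rfl }
    have e3 := e.trans e2
    have hm1 : ∀ j, 2 ≤ m j := fun j => hn1 _
    have hcard : ∏ j, m j = H.index := by
      rw [← card_cycProd m, ← Nat.card_congr e3.toEquiv, ← Subgroup.index_eq_card]
    have hle : ∏ j, m j ≤ N := by
      rw [hcard, hN, ← card_cycProd x]
      exact Nat.le_of_dvd Nat.card_pos H.index_dvd_card
    have hk : 2 ^ k ≤ N := by
      calc 2 ^ k = ∏ _j : Fin k, 2 := by simp
        _ ≤ ∏ j, m j := Finset.prod_le_prod' fun j _ => hm1 j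
        _ ≤ N := hle
    simp only [Finset.mem_biUnion, Finset.mem_range]
    refine ⟨k, Nat.lt_succ_of_le (Nat.le_log_of_pow_le (by norm_num) hk), m, ?_, ?_⟩
    · simp only [factTuples, Finset.mem_filter, Fintype.mem_piFinset, Finset.mem_Icc]
      refine ⟨fun j => ⟨hm1 j, ?_⟩, hle⟩
      refine le_trans ?_ hle
      exact Finset.single_le_prod' (f := m) (fun i _ => (by have := hm1 i; omega)) (Finset.mem_univ j)
    · simp only [S, Finset.mem_filter, Finset.mem_univ, true_and]
      exact ⟨hH, ⟨e3⟩⟩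
  have hc : subCount r (CycProd x) =
      (Finset.univ.filter fun H : Subgroup (CycProd x) => H.index ≤ r).card := by
    rw [subCount, Nat.card_eq_fintype_card, Fintype.card_subtype]
  rw [hc]
  calc (((Finset.univ.filter fun H : Subgroup (CycProd x) => H.index ≤ r).card : ℕ) : ℝ)
      ≤ ((∑ k ∈ Finset.range (Nat.log 2 N + 1), ∑ m ∈ factTuples k N, (S k m).card : ℕ) : ℝ) := by
        exact_mod_cast (Finset.card_le_card hcov).trans (Finset.card_biUnion_le.trans
          (Finset.sum_le_sum fun k _ => Finset.card_biUnion_le))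
    _ ≤ ∑ k ∈ Finset.range (Nat.log 2 N + 1), (N : ℝ) ^ 2 * B := by
        push_cast
        refine Finset.sum_le_sum fun k _ => ?_
        calc ∑ m ∈ factTuples k N, ((S k m).card : ℝ) ≤ ∑ m ∈ factTuples k N, B :=
              Finset.sum_le_sum fun m hm => hS k m hm
          _ = (factTuples k N).card * B := by simp
          _ ≤ _ := by gcongr; exact card_factTuples k N hN0
    _ = _ := by simp; ring

open ArithmeticFunction in
lemma log_gcd_eq (Q a b : ℕ) (ha : 0 < a) (hQ : a ≤ Q) :
    Real.log (Nat.gcd a b) = ∑ q ∈ Finset.Icc 1 Q, vonMangoldt q *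
      ((if q ∣ a then (1 : ℝ) else 0) * (if q ∣ b then (1 : ℝ) else 0)) := by
  rw [← vonMangoldt_sum]
  have h : (Nat.gcd a b).divisors = (Finset.Icc 1 Q).filter (fun q => q ∣ a ∧ q ∣ b) := by
    ext q
    simp only [Nat.mem_divisors, Nat.dvd_gcd_iff, Finset.mem_filter, Finset.mem_Icc]
    constructor
    · rintro ⟨⟨h1, h2⟩, _⟩
      exact ⟨⟨Nat.pos_of_dvd_of_pos h1 ha, (Nat.le_of_dvd ha h1).trans hQ⟩, h1, h2⟩
    · rintro ⟨_, h1, h2⟩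
      exact ⟨⟨h1, h2⟩, (Nat.gcd_pos_of_pos_left _ ha).ne'⟩
  rw [h, Finset.sum_filter]
  refine Finset.sum_congr rfl fun q _ => ?_
  by_cases h1 : q ∣ a <;> by_cases h2 : q ∣ b <;> simp [h1, h2]

open ArithmeticFunction in
lemma sum_log_gcd {s t : ℕ} (Q : ℕ) (x : Fin s → ℕ) (y : Fin t → ℕ) (hx : ∀ i, 0 < x i)
    (hQ : ∀ i, x i ≤ Q) :
    ∑ i, ∑ j, Real.log (Nat.gcd (x i) (y j)) = ∑ q ∈ Finset.Icc 1 Q, vonMangoldt q *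
      ((∑ i, if q ∣ x i then (1 : ℝ) else 0) * (∑ j, if q ∣ y j then (1 : ℝ) else 0)) := by
  simp_rw [log_gcd_eq Q _ _ (hx _) (hQ _), Finset.sum_mul_sum, Finset.mul_sum]
  rw [Finset.sum_comm]
  simp_rw [Finset.sum_comm (s := (Finset.univ : Finset (Fin s))) (t := Finset.Icc 1 Q)]
  rw [Finset.sum_comm]
  refine Finset.sum_congr rfl fun q _ => ?_
  rw [Finset.sum_comm]

open ArithmeticFunction in
lemma gcd_psd {t k : ℕ} (x : Fin t → ℕ) (m : Fin k → ℕ) (hx : ∀ i, 0 < x i) (hm : ∀ j, 0 < m j)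
    (c : ℝ) :
    2 * c * ∑ i, ∑ j, Real.log (Nat.gcd (x i) (m j)) ≤
      ∑ i, ∑ j, Real.log (Nat.gcd (m i) (m j)) + c ^ 2 * ∑ i, ∑ j, Real.log (Nat.gcd (x i) (x j)) := by
  set Q := ∑ i, x i + ∑ j, m j
  have hxQ : ∀ i, x i ≤ Q := fun i =>
    (Finset.single_le_sum (f := x) (fun _ _ => Nat.zero_le _) (Finset.mem_univ i)).trans
      (Nat.le_add_right _ _)
  have hmQ : ∀ i, m i ≤ Q := fun i =>
    (Finset.single_le_sum (f := m) (fun _ _ => Nat.zero_le _) (Finset.mem_univ i)).trans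
      (Nat.le_add_left _ _)
  rw [sum_log_gcd Q x m hx hxQ, sum_log_gcd Q m m hm hmQ, sum_log_gcd Q x x hx hxQ,
    Finset.mul_sum, Finset.mul_sum, ← Finset.sum_add_distrib]
  refine Finset.sum_le_sum fun q _ => ?_
  have h := vonMangoldt_nonneg (n := q)
  set u := (∑ i, if q ∣ x i then (1 : ℝ) else 0)
  set v := (∑ i, if q ∣ m i then (1 : ℝ) else 0)
  nlinarith [mul_nonneg h (sq_nonneg (v - c * u))]

lemma log_subCount_le {t : ℕ} (x : Fin t → ℕ) (hx : ∀ i, 0 < x i) (r : ℕ) (hr : 0 < r)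
    (c : ℝ) (hc2 : 2 * c ≤ 1) :
    Real.log (subCount r (CycProd x)) ≤ 5 * ∑ i, Real.log (x i) + (1 - 2 * c) * (t * Real.log r) +
      c ^ 2 * ∑ i, ∑ j, Real.log (Nat.gcd (x i) (x j)) := by
  set N := ∏ i, x i with hN
  have hN0 : 0 < N := Finset.prod_pos fun i _ => hx i
  have hNR : (0 : ℝ) < N := by exact_mod_cast hN0
  have hlogN : Real.log N = ∑ i, Real.log (x i) := by
    rw [hN]; push_cast
    exact Real.log_prod fun i _ => by exact_mod_cast (hx i).ne'
  set G := ∑ i, ∑ j, Real.log (Nat.gcd (x i) (x j)) with hG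
  have hG0 : 0 ≤ G := Finset.sum_nonneg fun i _ => Finset.sum_nonneg fun j _ =>
    Real.log_natCast_nonneg _
  set W := (1 - 2 * c) * (t * Real.log r) + c ^ 2 * G with hW
  have hlr : 0 ≤ Real.log r := Real.log_natCast_nonneg _
  have hlN : 0 ≤ Real.log N := Real.log_natCast_nonneg _
  have hc' : 0 ≤ 1 - 2 * c := by linarith
  have hW0 : 0 ≤ W := by positivity
  have key := subCount_le x hx r (Real.exp (W + Real.log N)) (Real.exp_pos _).le (by
    intro k m hm1 hmr hmN
    have hm0 : ∀ j, 0 < m j := fun j => (hm1 j).le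
    have hP : 0 < ∏ j, m j := Finset.prod_pos fun j _ => hm0 j
    have hPR : (0 : ℝ) < ((∏ j, m j : ℕ) : ℝ) := by exact_mod_cast hP
    have hX : (0 : ℝ) < ((∏ i, ∏ j, Nat.gcd (x i) (m j) : ℕ) : ℝ) := by
      exact_mod_cast Finset.prod_pos fun i _ => Finset.prod_pos fun j _ =>
        Nat.gcd_pos_of_pos_left _ (hx i)
    have hM : (0 : ℝ) < ((∏ i, ∏ j, Nat.gcd (m i) (m j) : ℕ) : ℝ) := by
      exact_mod_cast Finset.prod_pos fun i _ => Finset.prod_pos fun j _ =>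
        Nat.gcd_pos_of_pos_left _ (hm0 i)
    have lX : Real.log ((∏ i, ∏ j, Nat.gcd (x i) (m j) : ℕ) : ℝ) =
        ∑ i, ∑ j, Real.log (Nat.gcd (x i) (m j)) := by
      push_cast
      rw [Real.log_prod fun i _ => Finset.prod_ne_zero_iff.2 fun j _ => by
        exact_mod_cast (Nat.gcd_pos_of_pos_left _ (hx i)).ne']
      refine Finset.sum_congr rfl fun i _ => Real.log_prod fun j _ => by
        exact_mod_cast (Nat.gcd_pos_of_pos_left _ (hx i)).ne'
    have lM : Real.log ((∏ i, ∏ j, Nat.gcd (m i) (m j) : ℕ) : ℝ) =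
        ∑ i, ∑ j, Real.log (Nat.gcd (m i) (m j)) := by
      push_cast
      rw [Real.log_prod fun i _ => Finset.prod_ne_zero_iff.2 fun j _ => by
        exact_mod_cast (Nat.gcd_pos_of_pos_left _ (hm0 i)).ne']
      refine Finset.sum_congr rfl fun i _ => Real.log_prod fun j _ => by
        exact_mod_cast (Nat.gcd_pos_of_pos_left _ (hm0 i)).ne'
    have lP : Real.log ((∏ j, m j : ℕ) : ℝ) = ∑ j, Real.log (m j) := by
      push_cast
      exact Real.log_prod fun j _ => by exact_mod_cast (hm0 j).ne'
    have lP1 : Real.log ((∏ j, m j : ℕ) : ℝ) ≤ Real.log r :=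
      Real.log_le_log hPR (by exact_mod_cast hmr)
    have lP2 : Real.log ((∏ j, m j : ℕ) : ℝ) ≤ Real.log N :=
      Real.log_le_log hPR (by exact_mod_cast hmN)
    have h1 := gcd_psd x m hx hm0 c
    have h2 : ∑ i, ∑ j, Real.log (Nat.gcd (x i) (m j)) ≤ t * Real.log r := by
      calc ∑ i, ∑ j, Real.log (Nat.gcd (x i) (m j)) ≤ ∑ i : Fin t, Real.log r := by
            refine Finset.sum_le_sum fun i _ => ?_
            rw [lP] at lP1
            refine le_trans (Finset.sum_le_sum fun j _ => ?_) lP1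
            refine Real.log_le_log ?_ ?_
            · exact_mod_cast Nat.gcd_pos_of_pos_left _ (hx i)
            · exact_mod_cast Nat.gcd_le_right _ (hm0 j)
        _ = _ := by simp
    rw [← Real.log_le_log_iff (by positivity) (by positivity), Real.log_mul hX.ne' hPR.ne',
      Real.log_mul (Real.exp_pos _).ne' hM.ne', Real.log_exp, lX, lM]
    have h3 := mul_le_mul_of_nonneg_left h2 hc'
    rw [hW]
    linarith)
  rw [← hN] at key
  rcases Nat.eq_zero_or_pos (subCount r (CycProd x)) with h0 | h0
  · rw [h0]
    simp only [Nat.cast_zero, Real.log_zero]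
    rw [← hlogN]
    linarith
  · have h0' : (0 : ℝ) < subCount r (CycProd x) := by exact_mod_cast h0
    have h1 := Real.log_le_log h0' key
    rw [Real.log_mul (by positivity) (Real.exp_pos _).ne', Real.log_mul (by positivity) (by positivity),
      Real.log_exp, Real.log_pow] at h1
    have h2 : Real.log ((Nat.log 2 N : ℝ) + 1) ≤ Nat.log 2 N := by
      have := Real.log_le_sub_one_of_pos (show (0 : ℝ) < (Nat.log 2 N : ℝ) + 1 by positivity)
      linarith
    have h3 : (Nat.log 2 N : ℝ) * Real.log 2 ≤ Real.log N := by
      rw [← Real.log_pow]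
      refine Real.log_le_log (by positivity) ?_
      exact_mod_cast Nat.pow_log_le_self 2 hN0.ne'
    have h4 : (1 : ℝ) / 2 ≤ Real.log 2 := by have := Real.log_two_gt_d9; linarith
    have h5 : (0 : ℝ) ≤ Nat.log 2 N := by positivity
    have h6 : (Nat.log 2 N : ℝ) ≤ 2 * Real.log N := by nlinarith
    rw [← hlogN]
    push_cast at h1
    linarith

lemma divisor_bound (η : ℝ) (hη : 0 < η) :
    ∃ C : ℝ, 1 ≤ C ∧ ∀ n : ℕ, 0 < n → (n.divisors.card : ℝ) ≤ C * (n : ℝ) ^ η := by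
  have hl2 : 0 < Real.log 2 := Real.log_pos (by norm_num)
  set M : ℝ := 1 + 1 / (η * Real.log 2) with hM
  have hM1 : 1 ≤ M := by
    have : 0 < 1 / (η * Real.log 2) := by positivity
    linarith
  obtain ⟨P, hP⟩ : ∃ P : ℕ, (2 : ℝ) ^ (1 / η) ≤ P := exists_nat_ge _
  refine ⟨M ^ P, one_le_pow₀ hM1, fun n hn => ?_⟩
  rw [Nat.card_divisors hn.ne']
  have hnη : (n : ℝ) ^ η = ∏ p ∈ n.primeFactors, ((p : ℝ) ^ η) ^ (n.factorization p) := by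
    conv_lhs => rw [← Nat.prod_factorization_pow_eq_self hn.ne']
    rw [Nat.prod_factorization_eq_prod_primeFactors]
    push_cast
    rw [← Real.finsetProd_rpow _ _ (fun i _ => by positivity)]
    refine Finset.prod_congr rfl fun p _ => ?_
    rw [← Real.rpow_natCast, ← Real.rpow_natCast, ← Real.rpow_mul (by positivity),
      ← Real.rpow_mul (by positivity), mul_comm]
  have hterm : ∀ p ∈ n.primeFactors, ((n.factorization p : ℝ) + 1) ≤
      (if p < P then M else 1) * ((p : ℝ) ^ η) ^ (n.factorization p) := by
    intro p hp
    have hp2 : (2 : ℝ) ≤ p := by exact_mod_cast (Nat.prime_of_mem_primeFactors hp).two_le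
    set v := n.factorization p
    split_ifs with h
    · have h1 : (2 : ℝ) ^ η ≤ (p : ℝ) ^ η := Real.rpow_le_rpow (by norm_num) hp2 hη.le
      have h2 : 1 + v * (η * Real.log 2) ≤ ((2 : ℝ) ^ η) ^ v := by
        rw [Real.rpow_def_of_pos (by norm_num), ← Real.exp_nat_mul]
        have := Real.add_one_le_exp (v * (Real.log 2 * η))
        linarith
      have h3 : ((2 : ℝ) ^ η) ^ v ≤ ((p : ℝ) ^ η) ^ v := by gcongr
      have h4 : (v : ℝ) + 1 ≤ M * (1 + v * (η * Real.log 2)) := by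
        have hz : 0 < η * Real.log 2 := by positivity
        have e : M * (1 + v * (η * Real.log 2)) = (v : ℝ) + 1 + 1 / (η * Real.log 2) + v * (η * Real.log 2) := by
          rw [hM]; field_simp; ring
        rw [e]
        have : 0 < 1 / (η * Real.log 2) := by positivity
        have : 0 ≤ v * (η * Real.log 2) := by positivity
        linarith
      exact h4.trans (mul_le_mul_of_nonneg_left (h2.trans h3) (by linarith))
    · have h1 : (2 : ℝ) ≤ (p : ℝ) ^ η := by
        have h2 : (2 : ℝ) ^ (1 / η) ≤ p := hP.trans (by exact_mod_cast not_lt.1 h)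
        have h3 := Real.rpow_le_rpow (by positivity) h2 hη.le
        rwa [← Real.rpow_mul (by norm_num), one_div_mul_cancel hη.ne', Real.rpow_one] at h3
      have h2 : ((v : ℝ) + 1) ≤ 2 ^ v := by exact_mod_cast Nat.succ_le_of_lt v.lt_two_pow_self
      rw [one_mul]
      exact h2.trans (by gcongr)
  push_cast
  calc ∏ p ∈ n.primeFactors, ((n.factorization p : ℝ) + 1)
      ≤ ∏ p ∈ n.primeFactors, ((if p < P then M else 1) * ((p : ℝ) ^ η) ^ (n.factorization p)) :=
        Finset.prod_le_prod (fun _ _ => by positivity) hterm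
    _ = (∏ p ∈ n.primeFactors, (if p < P then M else 1)) * (n : ℝ) ^ η := by
        rw [Finset.prod_mul_distrib, hnη]
    _ ≤ M ^ P * (n : ℝ) ^ η := by
        gcongr
        rw [← Finset.prod_filter, Finset.prod_const]
        refine pow_le_pow_right₀ hM1 ?_
        calc _ ≤ (Finset.range P).card := Finset.card_le_card fun p hp => by
              simp only [Finset.mem_filter] at hp
              exact Finset.mem_range.2 hp.2
          _ = P := Finset.card_range P

lemma card_bad {t : ℕ} (d : ℕ) (x : Fin t → ℕ) (hx : ∀ i, 0 < x i)
    (hd : ∀ m : ℕ, (Finset.univ.filter fun i => x i = m).card ≤ d) (y : ℕ) (hy : 0 < y) (z : ℝ)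
    (hz : 0 ≤ z) :
    ((Finset.univ.filter fun i => (x i : ℝ) ≤ z * (Nat.gcd (x i) y : ℝ)).card : ℝ) ≤
      d * (y.divisors.card * z) := by
  classical
  set S := Finset.univ.filter fun i => (x i : ℝ) ≤ z * (Nat.gcd (x i) y : ℝ)
  have h1 : S.card ≤ d * (S.image x).card := by
    refine Finset.card_le_mul_card_image S d fun m _ => ?_
    refine le_trans (Finset.card_le_card ?_) (hd m)
    intro i hi
    simp only [Finset.mem_filter, Finset.mem_univ, true_and] at hi ⊢
    exact hi.2
  have h2 : S.image x ⊆ (y.divisors ×ˢ Finset.Icc 1 ⌊z⌋₊).image (fun w => w.1 * w.2) := by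
    intro w hw
    simp only [S, Finset.mem_image, Finset.mem_filter, Finset.mem_univ, true_and] at hw
    obtain ⟨i, hi, rfl⟩ := hw
    simp only [Finset.mem_image, Finset.mem_product, Nat.mem_divisors, Finset.mem_Icc, Prod.exists]
    obtain ⟨q, hq⟩ := Nat.gcd_dvd_left (x i) y
    have hg := Nat.gcd_pos_of_pos_left y (hx i)
    refine ⟨Nat.gcd (x i) y, q, ⟨⟨Nat.gcd_dvd_right _ _, hy.ne'⟩, ?_, ?_⟩, hq.symm⟩
    · rcases Nat.eq_zero_or_pos q with h | h
      · have := hx i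
        rw [h] at hq; omega
      · exact h
    · refine Nat.le_floor ?_
      have hg' : (0 : ℝ) < (Nat.gcd (x i) y : ℝ) := by exact_mod_cast hg
      have hq' : (x i : ℝ) = (Nat.gcd (x i) y : ℝ) * q := by exact_mod_cast hq
      refine le_of_mul_le_mul_left (a := (Nat.gcd (x i) y : ℝ)) ?_ hg'
      rw [← hq']; linarith
  have h3 : (S.image x).card ≤ y.divisors.card * ⌊z⌋₊ := by
    refine (Finset.card_le_card h2).trans (Finset.card_image_le.trans ?_)
    simp
  calc (S.card : ℝ) ≤ d * (y.divisors.card * ⌊z⌋₊ : ℕ) := by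
        exact_mod_cast h1.trans (Nat.mul_le_mul_left _ h3)
    _ ≤ _ := by
        push_cast
        gcongr
        exact Nat.floor_le hz

lemma deficiency (d : ℕ) (δ C : ℝ) (hδ : 0 < δ) (hδ1 : δ < 1) (hC : 0 < C) :
    ∃ T : ℕ, ∀ t : ℕ, T ≤ t → ∀ x : Fin t → ℕ, (∀ i, 0 < x i) →
      (∀ m : ℕ, (Finset.univ.filter fun i => x i = m).card ≤ d) →
      ∑ i, Real.log (x i) ≤ C * (t * Real.log t) →
      (1 - δ) ^ 3 * ((t : ℝ) ^ 2 * Real.log t) ≤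
        ∑ i, ∑ j, (Real.log (x j) - Real.log (Nat.gcd (x j) (x i))) := by
  classical
  set η : ℝ := δ ^ 2 / (2 * C) with hη
  have hη0 : 0 < η := by positivity
  obtain ⟨D, hD1, hD⟩ := divisor_bound η hη0
  have hev : ∀ᶠ t : ℕ in Filter.atTop, d * D / δ ≤ (t : ℝ) ^ (δ / 2) :=
    ((tendsto_rpow_atTop (show 0 < δ / 2 by positivity)).comp
      tendsto_natCast_atTop_atTop).eventually_ge_atTop _
  obtain ⟨T, hT⟩ := Filter.eventually_atTop.1 hev
  refine ⟨max T 2, fun t ht x hx hmul hsum => ?_⟩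
  have htT := hT t (le_of_max_le_left ht)
  have ht2 : 2 ≤ t := le_of_max_le_right ht
  have ht1 : (1 : ℝ) < t := by exact_mod_cast ht2
  have ht0 : (0 : ℝ) < t := by linarith
  have hlt : 0 < Real.log t := Real.log_pos ht1
  have hterm : ∀ i j, 0 ≤ Real.log (x j) - Real.log (Nat.gcd (x j) (x i)) := by
    intro i j
    rw [sub_nonneg]
    refine Real.log_le_log ?_ ?_
    · exact_mod_cast Nat.gcd_pos_of_pos_left _ (hx j)
    · exact_mod_cast Nat.gcd_le_left _ (hx j)
  -- each index of moderate size has few bad partners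
  have hgood : ∀ i, Real.log (x i) ≤ C / δ * Real.log t →
      (1 - δ) ^ 2 * (t * Real.log t) ≤
        ∑ j, (Real.log (x j) - Real.log (Nat.gcd (x j) (x i))) := by
    intro i hi
    set z : ℝ := (t : ℝ) ^ (1 - δ) with hz
    have hz0 : 0 < z := by positivity
    set S := Finset.univ.filter fun j => (x j : ℝ) ≤ z * (Nat.gcd (x j) (x i) : ℝ) with hS
    have hbad := card_bad d x hx hmul (x i) (hx i) z hz0.le
    have hxi : (0 : ℝ) < x i := by exact_mod_cast hx i
    have h1 : (x i : ℝ) ^ η ≤ (t : ℝ) ^ (δ / 2) := by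
      rw [Real.rpow_def_of_pos hxi, Real.rpow_def_of_pos ht0]
      refine Real.exp_le_exp.2 ?_
      calc Real.log (x i) * η ≤ C / δ * Real.log t * η := by gcongr
        _ = Real.log t * (δ / 2) := by rw [hη]; field_simp
    have h2 : ((x i).divisors.card : ℝ) ≤ D * (t : ℝ) ^ (δ / 2) :=
      (hD (x i) (hx i)).trans (by gcongr)
    have h3 : (S.card : ℝ) ≤ δ * t := by
      calc (S.card : ℝ) ≤ d * ((x i).divisors.card * z) := hbad
        _ ≤ d * (D * (t : ℝ) ^ (δ / 2) * z) := by gcongr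
        _ = (d * D / δ) * (δ * ((t : ℝ) ^ (δ / 2) * z)) := by field_simp
        _ ≤ (t : ℝ) ^ (δ / 2) * (δ * ((t : ℝ) ^ (δ / 2) * z)) := by gcongr
        _ = δ * ((t : ℝ) ^ (δ / 2) * (t : ℝ) ^ (δ / 2) * z) := by ring
        _ = δ * t := by
          rw [hz, ← Real.rpow_add ht0, ← Real.rpow_add ht0]
          norm_num
    have hcompl : (1 - δ) * t ≤ (Sᶜ.card : ℝ) := by
      have : (S.card : ℝ) + Sᶜ.card = t := by
        have := Finset.card_add_card_compl S
        rw [Fintype.card_fin] at this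
        exact_mod_cast this
      linarith
    calc (1 - δ) ^ 2 * (t * Real.log t) = ((1 - δ) * t) * ((1 - δ) * Real.log t) := by ring
      _ ≤ (Sᶜ.card : ℝ) * ((1 - δ) * Real.log t) := by
        have : 0 ≤ 1 - δ := by linarith
        gcongr
      _ ≤ ∑ j ∈ Sᶜ, (Real.log (x j) - Real.log (Nat.gcd (x j) (x i))) := by
        rw [← nsmul_eq_mul]
        refine Finset.card_nsmul_le_sum _ _ _ fun j hj => ?_
        simp only [hS, Finset.mem_compl, Finset.mem_filter, Finset.mem_univ, true_and, not_le] at hj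
        have hg : (0 : ℝ) < (Nat.gcd (x j) (x i) : ℝ) := by
          exact_mod_cast Nat.gcd_pos_of_pos_left _ (hx j)
        have := Real.log_le_log (by positivity) hj.le
        rw [Real.log_mul hz0.ne' hg.ne', hz, Real.log_rpow ht0] at this
        linarith
      _ ≤ _ := Finset.sum_le_univ_sum_of_nonneg fun j => hterm i j
  set J := Finset.univ.filter fun i => ¬ (Real.log (x i) ≤ C / δ * Real.log t) with hJ
  have hJc : (J.card : ℝ) ≤ δ * t := by
    have h1 : (J.card : ℝ) * (C / δ * Real.log t) ≤ C * (t * Real.log t) := by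
      refine le_trans ?_ hsum
      refine le_trans ?_ (Finset.sum_le_univ_sum_of_nonneg (s := J)
        (f := fun i => Real.log (x i)) fun j => Real.log_natCast_nonneg _)
      rw [← nsmul_eq_mul]
      refine Finset.card_nsmul_le_sum _ _ _ fun j hj => ?_
      simp only [hJ, Finset.mem_filter, Finset.mem_univ, true_and, not_le] at hj
      exact hj.le
    have hp : 0 < C / δ * Real.log t := by positivity
    refine le_of_mul_le_mul_right ?_ hp
    calc _ ≤ _ := h1
      _ = _ := by field_simp
  have hJcompl : (1 - δ) * t ≤ (Jᶜ.card : ℝ) := by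
    have : (J.card : ℝ) + Jᶜ.card = t := by
      have := Finset.card_add_card_compl J
      rw [Fintype.card_fin] at this
      exact_mod_cast this
    linarith
  calc (1 - δ) ^ 3 * ((t : ℝ) ^ 2 * Real.log t)
      = ((1 - δ) * t) * ((1 - δ) ^ 2 * (t * Real.log t)) := by ring
    _ ≤ (Jᶜ.card : ℝ) * ((1 - δ) ^ 2 * (t * Real.log t)) := by gcongr
    _ ≤ ∑ i ∈ Jᶜ, ∑ j, (Real.log (x j) - Real.log (Nat.gcd (x j) (x i))) := by
        rw [← nsmul_eq_mul]
        refine Finset.card_nsmul_le_sum _ _ _ fun i hi => hgood i ?_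
        simpa [hJ] using hi
    _ ≤ _ := Finset.sum_le_univ_sum_of_nonneg fun i => Finset.sum_nonneg fun j _ => hterm i j

lemma exists_delta (g ε : ℝ) (hε : 0 < ε) : ∃ δ : ℝ, 0 < δ ∧ δ < 1 ∧ g / (1 - δ) ^ 4 ≤ g + ε := by
  have hc : ContinuousAt (fun δ : ℝ => g / (1 - δ) ^ 4) 0 := by
    refine ContinuousAt.div (by fun_prop) (by fun_prop) (by norm_num)
  have h1 : ∀ᶠ δ in nhds (0 : ℝ), g / (1 - δ) ^ 4 < g + ε :=
    hc.eventually_lt continuousAt_const (by simpa using hε)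
  have h2 : ∀ᶠ δ in nhdsWithin (0 : ℝ) (Set.Ioi 0), g / (1 - δ) ^ 4 < g + ε :=
    h1.filter_mono nhdsWithin_le_nhds
  have h3 : ∀ᶠ δ in nhdsWithin (0 : ℝ) (Set.Ioi 0), δ ∈ Set.Ioo (0 : ℝ) 1 :=
    Ioo_mem_nhdsGT one_pos
  obtain ⟨δ, h4, h5⟩ := (h2.and h3).exists
  exact ⟨δ, h5.1, h5.2, h4.le⟩

theorem abelian_extremal_upper_bound (d : ℕ) (hd : 0 < d) (R : ℝ) (hR : 0 < R) :
    ∀ ε > (0 : ℝ), ∃ N : ℕ, ∀ n r : ℕ, N ≤ n → N ≤ r →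
      ∀ (t : ℕ) (x : Fin t → ℕ), (∀ i, 0 < x i) →
        (∀ m : ℕ, (Finset.univ.filter fun i => x i = m).card ≤ d) →
        (r : ℝ) * (Nat.card (∀ i, Multiplicative (ZMod (x i))) : ℝ) ^ R ≤ (n : ℝ) →
        Real.log (subCount r (∀ i, Multiplicative (ZMod (x i)))) ≤
          ((Real.sqrt (R * (R + 1)) - R) ^ 2 / (4 * R ^ 2) + ε) *
            (Real.log n) ^ 2 / Real.log (Real.log n) := by
  intro ε hε
  set c := Real.sqrt (R * (R + 1)) - R with hc
  have hsq : Real.sqrt (R * (R + 1)) ^ 2 = R * (R + 1) := Real.sq_sqrt (by positivity)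
  have hsq0 : 0 ≤ Real.sqrt (R * (R + 1)) := Real.sqrt_nonneg _
  have hcc : c ^ 2 = (1 - 2 * c) * R := by rw [hc]; nlinarith
  have hc2 : 2 * c ≤ 1 := by
    by_contra h
    have h1 : (1 - 2 * c) * R < 0 := mul_neg_of_neg_of_pos (by linarith) hR
    nlinarith [sq_nonneg c]
  set κ := 1 - 2 * c with hκ
  have hκ0 : 0 ≤ κ := by linarith
  have hγ : c ^ 2 / (4 * R ^ 2) = κ / (4 * R) := by rw [hcc]; field_simp
  rw [hγ]
  obtain ⟨δ, hδ0, hδ1, hδ⟩ := exists_delta (κ / (4 * R)) (ε / 2) (by positivity)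
  have hδ' : 0 < 1 - δ := by linarith
  obtain ⟨T, hT⟩ := deficiency d δ (4 / (1 - δ)) hδ0 hδ1 (by positivity)
  have hlog : Filter.Tendsto (fun n : ℕ => Real.log n) Filter.atTop Filter.atTop :=
    Real.tendsto_log_atTop.comp tendsto_natCast_atTop_atTop
  -- asymptotic facts in terms of `L = log n`
  have hev : ∀ᶠ L : ℝ in Filter.atTop, 1 < L ∧ 0 < Real.log L ∧
      Real.log L ≤ ε * R / 10 * L ∧ 4 * R * Real.log L ≤ L ^ δ ∧ (T : ℝ) + 1 ≤ L ^ (1 - δ) := by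
    have h1 := Real.isLittleO_log_id_atTop.bound (show 0 < ε * R / 10 by positivity)
    have h2 := (isLittleO_log_rpow_atTop hδ0).bound (show 0 < 1 / (4 * R) by positivity)
    have h3 := (tendsto_rpow_atTop hδ').eventually_ge_atTop ((T : ℝ) + 1)
    filter_upwards [h1, h2, h3, Filter.eventually_gt_atTop 1] with L h1 h2 h3 h4
    have hl : 0 < Real.log L := Real.log_pos h4
    have hL0 : 0 < L := by linarith
    refine ⟨h4, hl, ?_, ?_, h3⟩
    · simpa [abs_of_pos hl, abs_of_pos hL0] using h1
    · rw [Real.norm_of_nonneg hl.le, Real.norm_of_nonneg (by positivity)] at h2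
      calc 4 * R * Real.log L ≤ 4 * R * (1 / (4 * R) * L ^ δ) := by gcongr
        _ = L ^ δ := by field_simp
  obtain ⟨N, hN⟩ := Filter.eventually_atTop.1 (hlog.eventually hev)
  refine ⟨max N 1, fun n r hn hr t x hx hmul hle => ?_⟩
  obtain ⟨hL1, hll, hE1, hE2, hE3⟩ := hN n (le_of_max_le_left hn)
  have hr1 : 0 < r := le_of_max_le_right hr
  set L := Real.log n with hL
  set l := Real.log L with hl
  have hL0 : 0 < L := by linarith
  have hmain := log_subCount_le x hx r hr1 c hc2
  rw [hcc] at hmain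
  set V := ∑ i, Real.log (x i) with hV
  have hV0 : 0 ≤ V := Finset.sum_nonneg fun i _ => Real.log_natCast_nonneg _
  set G := ∑ i, ∑ j, Real.log (Nat.gcd (x i) (x j)) with hG
  have hlr : 0 ≤ Real.log r := Real.log_natCast_nonneg _
  -- the constraint
  have hcon : Real.log r + R * V ≤ L := by
    have hr0 : (0 : ℝ) < r := by exact_mod_cast hr1
    have hp : (0 : ℝ) < ((∏ i, x i : ℕ) : ℝ) := by
      exact_mod_cast Finset.prod_pos fun i _ => hx i
    have e : Nat.card (∀ i, Multiplicative (ZMod (x i))) = ∏ i, x i := card_cycProd x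
    rw [e] at hle
    have h1 := Real.log_le_log (by positivity) hle
    rw [Real.log_mul hr0.ne' (by positivity), Real.log_rpow hp] at h1
    have h2 : Real.log ((∏ i, x i : ℕ) : ℝ) = V := by
      push_cast
      exact Real.log_prod fun i _ => by exact_mod_cast (hx i).ne'
    rwa [h2] at h1
  have hVL : V ≤ L / R := by
    rw [le_div_iff₀ hR]; linarith
  set Df := ∑ i, ∑ j, (Real.log (x j) - Real.log (Nat.gcd (x j) (x i))) with hDf
  have hGD : Df = t * V - G := by
    rw [hDf]
    simp only [Finset.sum_sub_distrib]
    rw [← hV]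
    simp only [Finset.sum_const, Finset.card_univ, Fintype.card_fin, nsmul_eq_mul]
    rw [hG, Finset.sum_comm]
  have hDf0 : 0 ≤ Df := Finset.sum_nonneg fun i _ => Finset.sum_nonneg fun j _ => by
    rw [sub_nonneg]
    refine Real.log_le_log ?_ ?_
    · exact_mod_cast Nat.gcd_pos_of_pos_left _ (hx j)
    · exact_mod_cast Nat.gcd_le_left _ (hx j)
  have ht0 : (0 : ℝ) ≤ t := Nat.cast_nonneg t
  have hmain2 : Real.log (subCount r (CycProd x)) ≤ 5 * (L / R) + κ * (t * L - R * Df) := by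
    have h1 : κ * (t * (Real.log r + R * V)) ≤ κ * (t * L) := by gcongr
    have h2 : κ * R * G = κ * (R * (t * V - Df)) := by rw [hGD]; ring
    rw [h2] at hmain
    linarith
  have herr : 5 * (L / R) ≤ ε / 2 * L ^ 2 / l := by
    rw [le_div_iff₀ hll]
    calc 5 * (L / R) * l ≤ 5 * (L / R) * (ε * R / 10 * L) := by gcongr
      _ = ε / 2 * L ^ 2 := by field_simp; ring
  suffices h : κ * (t * L - R * Df) ≤ (κ / (4 * R) + ε / 2) * L ^ 2 / l by
    calc _ ≤ _ := hmain2
      _ ≤ ε / 2 * L ^ 2 / l + (κ / (4 * R) + ε / 2) * L ^ 2 / l := add_le_add herr h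
      _ = _ := by ring
  have hLl : 0 ≤ L ^ 2 / l := by positivity
  rcases le_or_gt (t : ℝ) (L / (4 * R * l)) with ht | ht
  · calc κ * (t * L - R * Df) ≤ κ * (L / (4 * R * l) * L) := by
          gcongr
          have h1 : 0 ≤ R * Df := by positivity
          have h2 : t * L ≤ L / (4 * R * l) * L := by gcongr
          linarith
      _ = κ / (4 * R) * (L ^ 2 / l) := by field_simp
      _ ≤ (κ / (4 * R) + ε / 2) * (L ^ 2 / l) := by gcongr; linarith
      _ = _ := by ring
  · have h1 : L ^ (1 - δ) ≤ L / (4 * R * l) := by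
      rw [le_div_iff₀ (by positivity)]
      calc L ^ (1 - δ) * (4 * R * l) ≤ L ^ (1 - δ) * L ^ δ := by gcongr
        _ = L := by rw [← Real.rpow_add hL0]; norm_num
    have h2 : L ^ (1 - δ) ≤ t := h1.trans ht.le
    have htT : T ≤ t := by
      have : (T : ℝ) ≤ t := by linarith
      exact_mod_cast this
    have hlt : (1 - δ) * l ≤ Real.log t := by
      rw [hl, ← Real.log_rpow hL0]
      exact Real.log_le_log (by positivity) h2
    have h3 : V ≤ 4 / (1 - δ) * (t * Real.log t) := by
      calc V ≤ L / R := hVL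
        _ = 4 * (L / (4 * R * l) * l) := by field_simp
        _ ≤ 4 * (t * l) := by gcongr
        _ = 4 / (1 - δ) * (t * ((1 - δ) * l)) := by field_simp
        _ ≤ _ := by gcongr
    have h4 := hT t htT x hx hmul h3
    rw [← hDf] at h4
    set a := (1 - δ) ^ 4 with ha
    have ha0 : 0 < a := by positivity
    have h5 : a * (t ^ 2 * l) ≤ Df := by
      calc a * (t ^ 2 * l) = (1 - δ) ^ 3 * ((t : ℝ) ^ 2 * ((1 - δ) * l)) := by rw [ha]; ring
        _ ≤ (1 - δ) ^ 3 * ((t : ℝ) ^ 2 * Real.log t) := by gcongr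
        _ ≤ Df := h4
    have h6 : t * L - R * Df ≤ L ^ 2 / (4 * R * a * l) := by
      rw [le_div_iff₀ (by positivity)]
      have h7 : R * (a * (t ^ 2 * l)) ≤ R * Df := by gcongr
      have h8 : (t * L - R * Df) * (4 * R * a * l) ≤
          (t * L - R * (a * (t ^ 2 * l))) * (4 * R * a * l) := by gcongr
      have h9 : (t * L - R * (a * (t ^ 2 * l))) * (4 * R * a * l) =
          L ^ 2 - (L - 2 * R * a * t * l) ^ 2 := by ring
      have h10 := sq_nonneg (L - 2 * R * a * t * l)
      linarith only [h8, h9, h10]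
    calc κ * (t * L - R * Df) ≤ κ * (L ^ 2 / (4 * R * a * l)) := by gcongr
      _ = κ / (4 * R) / a * (L ^ 2 / l) := by field_simp
      _ ≤ (κ / (4 * R) + ε / 2) * (L ^ 2 / l) := by gcongr
      _ = _ := by ring
end

section
/- Fix an integer d ≥ 2 and set R = d/2. For every ε > 0 there exists Q such that for every finite field F with |F| > Q and characteristic p > 3, every subgroup H of SL_d(F), and every normal subgroup N of H such that H/N is abelian of order coprime to p and |H/N| > 1, one has log [SL_d(F) : H] ≥ (R − ε) · log |H/N|. -/
noncomputable def TT {K : Type} [Group K] {E : Type} [NormedAddCommGroup E] [InnerProductSpace ℂ E]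
    [FiniteDimensional ℂ E] (ρ : K →* Module.End ℂ E) : K →* (E →L[ℂ] E) :=
  ((Module.End.toContinuousLinearMap (𝕜 := ℂ) E) : Module.End ℂ E →* (E →L[ℂ] E)).comp ρ

section
variable {K : Type} [Group K] {E : Type} [NormedAddCommGroup E] [InnerProductSpace ℂ E]
    [FiniteDimensional ℂ E]

lemma TT_apply (ρ : K →* Module.End ℂ E) (k : K) (x : E) : TT ρ k x = ρ k x := rfl

lemma TT_norm_le (ρ : K →* Module.End ℂ E) (h : ∀ k x, ‖ρ k x‖ = ‖x‖) (k : K) :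
    ‖TT ρ k‖ ≤ 1 := by
  refine ContinuousLinearMap.opNorm_le_bound _ zero_le_one (fun x => ?_)
  rw [TT_apply, h, one_mul]

noncomputable def G0 (ρ : K →* Module.End ℂ E) : Subgroup K := Subgroup.closure {k | ‖TT ρ k - 1‖ < 1/2}

end

lemma G0_index (n : ℕ) : ∃ M : ℕ, ∀ (K : Type) [Group K] [Finite K] (E : Type)
    [NormedAddCommGroup E] [InnerProductSpace ℂ E] [FiniteDimensional ℂ E],
    Module.finrank ℂ E = n → ∀ ρ : K →* Module.End ℂ E, (∀ k x, ‖ρ k x‖ = ‖x‖) →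
    (G0 ρ).index ≤ M := by
  let X := EuclideanSpace ℂ (Fin n) →L[ℂ] EuclideanSpace ℂ (Fin n)
  have : ProperSpace X := FiniteDimensional.proper ℂ X
  have hc : TotallyBounded (Metric.closedBall (0 : X) 1) := (isCompact_closedBall (0:X) 1).totallyBounded
  obtain ⟨t, ht, hcov⟩ := Metric.totallyBounded_iff.1 hc (1/4) (by norm_num)
  refine ⟨t.ncard, ?_⟩
  intro K _ _ E _ _ _ hn ρ hρ
  let b : E ≃ₗᵢ[ℂ] EuclideanSpace ℂ (Fin n) :=
    ((stdOrthonormalBasis ℂ E).reindex (finCongr hn)).repr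
  let S : K → X := fun k => (b.toContinuousLinearEquiv : E →L[ℂ] EuclideanSpace ℂ (Fin n)).comp
    ((TT ρ k).comp (b.symm.toContinuousLinearEquiv : EuclideanSpace ℂ (Fin n) →L[ℂ] E))
  have hS : ∀ k x, S k x = b (ρ k (b.symm x)) := fun k x => rfl
  have hSn : ∀ k, S k ∈ Metric.closedBall (0:X) 1 := by
    intro k
    rw [mem_closedBall_zero_iff]
    refine ContinuousLinearMap.opNorm_le_bound _ zero_le_one (fun x => ?_)
    rw [hS, LinearIsometryEquiv.norm_map, hρ, LinearIsometryEquiv.norm_map, one_mul]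
  have hx : ∀ k, ∃ c ∈ t, S k ∈ Metric.ball c (1/4) := by
    intro k
    have := hcov (hSn k)
    simpa using this
  choose c hct hcb using hx
  have := ht.to_subtype
  rw [Subgroup.index, ← Nat.card_coe_set_eq]
  refine Nat.card_le_card_of_injective (fun x : K ⧸ G0 ρ => (⟨c x.out, hct _⟩ : t)) ?_
  intro x y hxy
  have hxy' : c x.out = c y.out := congrArg Subtype.val hxy
  have h1 := hcb x.out
  have h2 := hcb y.out
  rw [hxy'] at h1
  have h3 : dist (S x.out) (S y.out) < 1/2 := by
    have := dist_triangle_right (S x.out) (S y.out) (c y.out)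
    rw [Metric.mem_ball] at h1 h2
    linarith
  rw [← x.out_eq', ← y.out_eq']
  apply QuotientGroup.eq.2
  apply Subgroup.subset_closure
  show ‖TT ρ (x.out⁻¹ * y.out) - 1‖ < 1/2
  refine lt_of_le_of_lt ?_ h3
  refine ContinuousLinearMap.opNorm_le_bound _ dist_nonneg (fun v => ?_)
  have h4 : (TT ρ (x.out⁻¹ * y.out) - 1) v = ρ (x.out⁻¹) (ρ y.out v - ρ x.out v) := by
    rw [map_sub, ← Module.End.mul_apply, ← Module.End.mul_apply, ← map_mul, ← map_mul]
    simp [TT_apply]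
  rw [h4, hρ]
  have h5 : ρ y.out v - ρ x.out v = b.symm ((S y.out - S x.out) (b v)) := by
    simp [hS]
  rw [h5, LinearIsometryEquiv.norm_map, dist_comm, dist_eq_norm]
  refine (ContinuousLinearMap.le_opNorm _ _).trans ?_
  rw [LinearIsometryEquiv.norm_map]


noncomputable def restrictHom {K : Type*} [Group K] {k V : Type*} [Field k] [AddCommGroup V] [Module k V]
    (ρ : K →* Module.End k V) (W : Submodule k V) (h : ∀ g, ∀ w ∈ W, ρ g w ∈ W) :
    K →* Module.End k W where
  toFun g := (ρ g).restrict (h g)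
  map_one' := by ext; simp
  map_mul' a b := by ext; simp

lemma restrictHom_apply {K : Type*} [Group K] {k V : Type*} [Field k] [AddCommGroup V] [Module k V]
    (ρ : K →* Module.End k V) (W : Submodule k V) (h : ∀ g, ∀ w ∈ W, ρ g w ∈ W) (g : K) (w : W) :
    ((restrictHom ρ W h g w : W) : V) = ρ g w := rfl

lemma G0_index' (n : ℕ) : ∃ M : ℕ, ∀ (K : Type) [Group K] [Finite K] (E : Type)
    [NormedAddCommGroup E] [InnerProductSpace ℂ E] [FiniteDimensional ℂ E],
    Module.finrank ℂ E ≤ n → ∀ ρ : K →* Module.End ℂ E, (∀ k x, ‖ρ k x‖ = ‖x‖) →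
    (G0 ρ).index ≤ M := by
  choose M hM using G0_index
  refine ⟨∑ m ∈ Finset.range (n+1), M m, ?_⟩
  intro K _ _ E _ _ _ hn ρ hρ
  refine (hM _ K E rfl ρ hρ).trans ?_
  exact Finset.single_le_sum (f := M) (fun _ _ => Nat.zero_le _) (Finset.mem_range.2 (by omega))

section
variable {K : Type} [Group K] {E : Type} [NormedAddCommGroup E] [InnerProductSpace ℂ E]
    [FiniteDimensional ℂ E]

lemma trace_ne_zero_of_near [Nontrivial E] (ρ : K →* Module.End ℂ E) (h : K)
    (hh : ‖TT ρ h - 1‖ < 1/2) : LinearMap.trace ℂ E (ρ h) ≠ 0 := by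
  intro h0
  have h1 : LinearMap.trace ℂ E (ρ h - 1) = - (Module.finrank ℂ E : ℂ) := by
    rw [map_sub, h0, LinearMap.trace_one, zero_sub]
  let b := stdOrthonormalBasis ℂ E
  rw [LinearMap.trace_eq_sum_inner _ b] at h1
  have h2 : ‖∑ i, inner ℂ (b i) ((ρ h - 1) (b i))‖ ≤ ∑ i : Fin (Module.finrank ℂ E), (1/2 : ℝ) := by
    refine norm_sum_le_of_le _ (fun i _ => ?_)
    refine (norm_inner_le_norm _ _).trans ?_
    have : (ρ h - 1) (b i) = (TT ρ h - 1) (b i) := rfl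
    rw [this]
    have h3 := (TT ρ h - 1).le_opNorm (b i)
    rw [b.norm_eq_one i] at h3 ⊢
    linarith
  rw [h1] at h2
  simp at h2
  have : 0 < Module.finrank ℂ E := Module.finrank_pos
  have : (0:ℝ) < Module.finrank ℂ E := by exact_mod_cast this
  linarith

lemma comm_near (ρ : K →* Module.End ℂ E) (hρ : ∀ k x, ‖ρ k x‖ = ‖x‖) (g h : K)
    (hg : ‖TT ρ g - 1‖ < 1/2) (hh : 0 < ‖TT ρ h - 1‖) :
    ‖TT ρ (g * h * g⁻¹ * h⁻¹) - 1‖ < ‖TT ρ h - 1‖ := by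
  have e : TT ρ (g * h * g⁻¹ * h⁻¹) - 1 =
    ((TT ρ g - 1) * (TT ρ h - 1) - (TT ρ h - 1) * (TT ρ g - 1)) * TT ρ (g⁻¹ * h⁻¹) := by
    have e1 : (TT ρ g - 1) * (TT ρ h - 1) - (TT ρ h - 1) * (TT ρ g - 1)
      = TT ρ (g * h) - TT ρ (h * g) := by
      rw [map_mul, map_mul]; noncomm_ring
    rw [e1, sub_mul, ← map_mul, ← map_mul]
    congr 1
    · congr 1; group
    · rw [← map_one (TT ρ)]; congr 1; group
  rw [e]
  have n1 := norm_mul_le ((TT ρ g - 1) * (TT ρ h - 1) - (TT ρ h - 1) * (TT ρ g - 1)) (TT ρ (g⁻¹ * h⁻¹))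
  have n2 := norm_sub_le ((TT ρ g - 1) * (TT ρ h - 1)) ((TT ρ h - 1) * (TT ρ g - 1))
  have n3 := norm_mul_le (TT ρ g - 1) (TT ρ h - 1)
  have n4 := norm_mul_le (TT ρ h - 1) (TT ρ g - 1)
  have n5 := TT_norm_le ρ hρ (g⁻¹ * h⁻¹)
  have n6 : ‖TT ρ g - 1‖ * ‖TT ρ h - 1‖ < 1/2 * ‖TT ρ h - 1‖ := by gcongr
  have n7 := norm_nonneg ((TT ρ g - 1) * (TT ρ h - 1) - (TT ρ h - 1) * (TT ρ g - 1))
  nlinarith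

lemma central_of_min [Nontrivial E] (ρ : K →* Module.End ℂ E) (hρ : ∀ k x, ‖ρ k x‖ = ‖x‖) (h : K)
    (hh : ‖TT ρ h - 1‖ < 1/2) (hns : ¬ ∃ z : ℂ, ρ h = z • 1)
    (hmin : ∀ k : K, (¬ ∃ z : ℂ, ρ k = z • 1) → ‖TT ρ h - 1‖ ≤ ‖TT ρ k - 1‖) (g : K)
    (hg : g ∈ G0 ρ) : ρ g * ρ h = ρ h * ρ g := by
  have hpos : 0 < ‖TT ρ h - 1‖ := by
    rw [norm_pos_iff]
    intro h0
    apply hns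
    refine ⟨1, ?_⟩
    ext x
    have := congrArg (fun f : E →L[ℂ] E => f x) h0
    simp only [ContinuousLinearMap.sub_apply, TT_apply, ContinuousLinearMap.one_apply, ContinuousLinearMap.zero_apply] at this
    simpa [sub_eq_zero] using this
  have key : ∀ g : K, ‖TT ρ g - 1‖ < 1/2 → Commute (ρ g) (ρ h) := by
    intro g hg
    have h1 := comm_near ρ hρ g h hg hpos
    by_cases hs : ∃ z : ℂ, ρ (g * h * g⁻¹ * h⁻¹) = z • 1
    · obtain ⟨z, hz⟩ := hs
      have h2 : ρ (g * h * g⁻¹) = z • ρ h := by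
        have : ρ (g * h * g⁻¹) = ρ (g * h * g⁻¹ * h⁻¹) * ρ h := by
          rw [← map_mul]; congr 1; group
        rw [this, hz]; simp
      have h3 : LinearMap.trace ℂ E (ρ (g * h * g⁻¹)) = LinearMap.trace ℂ E (ρ h) := by
        rw [map_mul, LinearMap.trace_mul_comm, ← map_mul]; congr 2; group
      rw [h2, map_smul, smul_eq_mul] at h3
      have h4 := trace_ne_zero_of_near ρ h hh
      have hz1 : z = 1 := by
        field_simp at h3; exact h3
      rw [hz1, one_smul] at h2
      show ρ g * ρ h = ρ h * ρ g
      nth_rw 2 [← h2]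
      rw [← map_mul, ← map_mul]; congr 1; group
    · exact absurd (hmin _ hs) (not_le.2 h1)
  have : g ∈ Subgroup.closure {k | ‖TT ρ k - 1‖ < 1/2} := hg
  induction this using Subgroup.closure_induction with
  | mem x hx => exact key x hx
  | one => simp
  | mul x y _ _ hx hy =>
    rw [map_mul, mul_assoc, hy (by assumption), ← mul_assoc, hx (by assumption), mul_assoc]
  | inv x _ hx =>
    have hx := hx (by assumption)
    have a : ρ x⁻¹ * ρ x = 1 := by rw [← map_mul]; simp
    have b : ρ x * ρ x⁻¹ = 1 := by rw [← map_mul]; simp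
    calc ρ x⁻¹ * ρ h = ρ x⁻¹ * (ρ h * ρ x) * ρ x⁻¹ := by rw [mul_assoc, mul_assoc, b, mul_one]
      _ = (ρ x⁻¹ * ρ x) * ρ h * ρ x⁻¹ := by rw [← hx]; simp only [mul_assoc]
      _ = _ := by rw [a, one_mul]

end

theorem jordan_unitary (n : ℕ) : ∃ J : ℕ, ∀ (K : Type) [Group K] [Finite K] (E : Type)
    [NormedAddCommGroup E] [InnerProductSpace ℂ E] [FiniteDimensional ℂ E],
    Module.finrank ℂ E ≤ n → ∀ ρ : K →* Module.End ℂ E, (∀ k x, ‖ρ k x‖ = ‖x‖) →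
    ∃ A : Subgroup K, A.index ≤ J ∧ ∀ a ∈ A, ∀ b ∈ A, ρ a * ρ b = ρ b * ρ a := by
  induction n with
  | zero =>
    refine ⟨1, ?_⟩
    intro K _ _ E _ _ _ hn ρ hρ
    have : Subsingleton E := Module.finrank_zero_iff.1 (Nat.le_zero.1 hn)
    refine ⟨⊤, by simp, ?_⟩
    intro a _ b _
    ext x
    exact Subsingleton.elim _ _
  | succ n ih =>
    obtain ⟨J, hJ⟩ := ih
    obtain ⟨M, hM⟩ := G0_index' (n+1)
    refine ⟨J * J * M + M, ?_⟩
    intro K _ _ E _ _ _ hn ρ hρ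
    by_cases hall : ∀ g, ‖TT ρ g - 1‖ < 1/2 → ∃ z : ℂ, ρ g = z • 1
    · refine ⟨G0 ρ, (hM K E hn ρ hρ).trans (by omega), ?_⟩
      have : ∀ a ∈ G0 ρ, ∀ f : Module.End ℂ E, Commute (ρ a) f := by
        intro a ha f
        have : a ∈ Subgroup.closure {k | ‖TT ρ k - 1‖ < 1/2} := ha
        clear ha
        induction this using Subgroup.closure_induction with
        | mem x hx =>
          obtain ⟨z, hz⟩ := hall x hx
          rw [hz]
          exact (Commute.one_left f).smul_left z
        | one => simp
        | mul x y _ _ hx hy => rw [map_mul]; exact hx.mul_left hy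
        | inv x _ hx =>
          have a : ρ x⁻¹ * ρ x = 1 := by rw [← map_mul]; simp
          have b : ρ x * ρ x⁻¹ = 1 := by rw [← map_mul]; simp
          have hx : ρ x * f = f * ρ x := hx
          show ρ x⁻¹ * f = f * ρ x⁻¹
          calc ρ x⁻¹ * f = ρ x⁻¹ * (f * ρ x) * ρ x⁻¹ := by rw [mul_assoc, mul_assoc, b, mul_one]
            _ = (ρ x⁻¹ * ρ x) * f * ρ x⁻¹ := by rw [← hx]; simp only [mul_assoc]
            _ = _ := by rw [a, one_mul]
      intro a ha b _
      exact this a ha _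
    · push Not at hall
      obtain ⟨g0, hg0, hg0s⟩ := hall
      have hE : Nontrivial E := by
        by_contra hE
        rw [not_nontrivial_iff_subsingleton] at hE
        exact hg0s 1 (by ext; exact Subsingleton.elim _ _)
      obtain ⟨h, hhs, hmin⟩ := Set.exists_min_image {k : K | ¬ ∃ z : ℂ, ρ k = z • 1}
        (fun k => ‖TT ρ k - 1‖) (Set.toFinite _) ⟨g0, by simpa using hg0s⟩
      have hh : ‖TT ρ h - 1‖ < 1/2 := (hmin g0 (by simpa using hg0s)).trans_lt hg0
      have hcent := central_of_min ρ hρ h hh hhs hmin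
      obtain ⟨μ, hμ⟩ := Module.End.exists_eigenvalue (ρ h)
      let W := Module.End.eigenspace (ρ h) μ
      have hWbot : W ≠ ⊥ := hμ
      have hWtop : W ≠ ⊤ := by
        intro hW
        apply hhs
        refine ⟨μ, ?_⟩
        ext x
        have : x ∈ W := by rw [hW]; trivial
        simpa using Module.End.mem_eigenspace_iff.1 this
      let ρ0 : G0 ρ →* Module.End ℂ E := ρ.comp (G0 ρ).subtype
      have hinv : ∀ g : G0 ρ, ∀ w ∈ W, ρ0 g w ∈ W := by
        intro g w hw
        rw [Module.End.mem_eigenspace_iff] at hw ⊢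
        show ρ h (ρ g w) = μ • ρ g w
        rw [← Module.End.mul_apply, ← hcent g g.2, Module.End.mul_apply, hw, map_smul]
      have hinv' : ∀ g : G0 ρ, ∀ w ∈ Wᗮ, ρ0 g w ∈ Wᗮ := by
        intro g w hw
        rw [Submodule.mem_orthogonal] at hw ⊢
        intro u hu
        let L : E →ₗᵢ[ℂ] E := ⟨ρ0 g, fun x => hρ _ x⟩
        have h1 : ρ0 g (ρ0 g⁻¹ u) = u := by
          rw [← Module.End.mul_apply, ← map_mul]; simp
        have h2 := L.inner_map_map (ρ0 g⁻¹ u) w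
        change inner ℂ (ρ0 g (ρ0 g⁻¹ u)) (ρ0 g w) = _ at h2
        rw [h1] at h2
        rw [h2]
        exact hw _ (hinv g⁻¹ u hu)
      have hsum := Submodule.finrank_add_finrank_orthogonal W
      have hW1 : Module.finrank ℂ W < Module.finrank ℂ E := Submodule.finrank_lt hWtop
      have hW2 : 0 < Module.finrank ℂ W := by
        rw [Module.finrank_pos_iff]
        exact Submodule.nontrivial_iff_ne_bot.2 hWbot
      obtain ⟨A1, hA1, hc1⟩ := hJ (G0 ρ) W (by omega) (restrictHom ρ0 W hinv)
        (fun k x => hρ _ _)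
      obtain ⟨A2, hA2, hc2⟩ := hJ (G0 ρ) (Wᗮ : Submodule ℂ E) (by omega) (restrictHom ρ0 Wᗮ hinv')
        (fun k x => hρ _ _)
      refine ⟨(A1 ⊓ A2).map (G0 ρ).subtype, ?_, ?_⟩
      · rw [Subgroup.index_map_subtype]
        have h1 := Subgroup.index_inf_le (H := A1) (K := A2)
        have h2 := hM K E hn ρ hρ
        have h3 : (A1 ⊓ A2).index ≤ J * J := h1.trans (Nat.mul_le_mul hA1 hA2)
        have h4 := Nat.mul_le_mul h3 h2
        omega
      · rintro _ ⟨a, ha, rfl⟩ _ ⟨b, hb, rfl⟩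
        ext x
        have hx : x ∈ W ⊔ Wᗮ := by rw [Submodule.sup_orthogonal_of_hasOrthogonalProjection]; trivial
        obtain ⟨y, hy, z, hz, rfl⟩ := Submodule.mem_sup.1 hx
        have e1 := congrArg (fun f => ((f ⟨y, hy⟩ : W) : E)) (hc1 a ha.1 b hb.1)
        have e2 := congrArg (fun f => ((f ⟨z, hz⟩ : (Wᗮ : Submodule ℂ E)) : E)) (hc2 a ha.2 b hb.2)
        simp only [Module.End.mul_apply, restrictHom_apply] at e1 e2
        rw [map_add, map_add]
        exact congrArg₂ (· + ·) e1 e2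


open ComplexConjugate in
@[reducible] noncomputable def avgCore {K : Type} [Group K] [Fintype K] {n : ℕ}
    (ρ : K →* Module.End ℂ (Fin n → ℂ)) : InnerProductSpace.Core ℂ (Fin n → ℂ) where
  inner x y := ∑ k, ∑ i, conj (ρ k x i) * ρ k y i
  conj_inner_symm x y := by
    simp only [map_sum, map_mul, Complex.conj_conj]
    exact Finset.sum_congr rfl fun k _ => Finset.sum_congr rfl fun i _ => mul_comm _ _
  re_inner_nonneg x := by
    simp only [map_sum]
    refine Finset.sum_nonneg fun k _ => Finset.sum_nonneg fun i _ => ?_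
    rw [← Complex.normSq_eq_conj_mul_self]
    simp [Complex.normSq_nonneg]
  add_left x y z := by
    simp only [map_add, Pi.add_apply, add_mul, Finset.sum_add_distrib]
  smul_left x y r := by
    simp only [map_smul, Pi.smul_apply, smul_eq_mul, map_mul, mul_assoc, Finset.mul_sum]
  definite x h := by
    have h' : ∑ k, ∑ i, Complex.normSq (ρ k x i) = 0 := by
      have : ((∑ k, ∑ i, Complex.normSq (ρ k x i) : ℝ) : ℂ) = 0 := by
        rw [← h]; push_cast
        exact Finset.sum_congr rfl fun k _ => Finset.sum_congr rfl fun i _ =>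
          Complex.normSq_eq_conj_mul_self
      exact_mod_cast this
    have h1 := (Finset.sum_eq_zero_iff_of_nonneg
      (fun k _ => Finset.sum_nonneg fun i _ => Complex.normSq_nonneg _)).1 h' 1 (Finset.mem_univ _)
    ext i
    have h2 := (Finset.sum_eq_zero_iff_of_nonneg (fun i _ => Complex.normSq_nonneg _)).1 h1 i
      (Finset.mem_univ _)
    simpa using h2

theorem jordan_core (n : ℕ) : ∃ J : ℕ, ∀ (K : Type) [Group K] [Finite K]
    (V : Type) [AddCommGroup V] [Module ℂ V] [FiniteDimensional ℂ V], Module.finrank ℂ V ≤ n →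
    ∀ (ρ : K →* Module.End ℂ V) (c : InnerProductSpace.Core ℂ V),
    (∀ k x, c.inner (ρ k x) (ρ k x) = c.inner x x) →
    ∃ A : Subgroup K, A.index ≤ J ∧ ∀ a ∈ A, ∀ b ∈ A, ρ a * ρ b = ρ b * ρ a := by
  obtain ⟨J, hJ⟩ := jordan_unitary n
  refine ⟨J, ?_⟩
  intro K _ _ V _ _ _ hn ρ c hc
  let E1 : NormedAddCommGroup V := c.toNormedAddCommGroup
  let E2 : InnerProductSpace ℂ V := InnerProductSpace.ofCore c.toCore
  refine @hJ K _ _ V E1 E2 inferInstance hn ρ ?_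
  intro k x
  have key : inner ℂ (ρ k x) (ρ k x) = inner ℂ x x := hc k x
  rw [@norm_eq_sqrt_re_inner ℂ, @norm_eq_sqrt_re_inner ℂ, key]

theorem jordan_complex (n : ℕ) : ∃ J : ℕ, ∀ (K : Type) [Group K] [Finite K]
    (ρ : K →* Module.End ℂ (Fin n → ℂ)),
    ∃ A : Subgroup K, A.index ≤ J ∧ ∀ a ∈ A, ∀ b ∈ A, ρ a * ρ b = ρ b * ρ a := by
  obtain ⟨J, hJ⟩ := jordan_core n
  refine ⟨J, ?_⟩
  intro K _ _ ρ
  have := Fintype.ofFinite K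
  refine hJ K (Fin n → ℂ) (by simp) ρ (avgCore ρ) ?_
  intro k x
  show ∑ g, ∑ i, _ = ∑ g, ∑ i, _
  refine Fintype.sum_equiv (Equiv.mulRight k) _ _ (fun g => ?_)
  simp [map_mul]

theorem jordan_matrix (n : ℕ) : ∃ J : ℕ, ∀ (K : Type) [Group K] [Finite K]
    (ρ : K →* Matrix (Fin n) (Fin n) ℂ),
    ∃ A : Subgroup K, A.index ≤ J ∧ ∀ a ∈ A, ∀ b ∈ A, ρ a * ρ b = ρ b * ρ a := by
  obtain ⟨J, hJ⟩ := jordan_complex n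
  refine ⟨J, ?_⟩
  intro K _ _ ρ
  let e : Matrix (Fin n) (Fin n) ℂ ≃ₐ[ℂ] Module.End ℂ (Fin n → ℂ) := Matrix.toLinAlgEquiv'
  obtain ⟨A, h1, h2⟩ := hJ K ((e : Matrix (Fin n) (Fin n) ℂ →* Module.End ℂ (Fin n → ℂ)).comp ρ)
  refine ⟨A, h1, fun a ha b hb => e.injective ?_⟩
  have := h2 a ha b hb
  rw [map_mul, map_mul]
  exact this


lemma sz_section {G K : Type*} [Group G] [Group K] [Finite G] [Finite K] (f : G →* K)
    (hf : Function.Surjective f) (hc : (Nat.card f.ker).Coprime (Nat.card K)) :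
    ∃ σ : K →* G, ∀ k, f (σ k) = k := by
  have hi : f.ker.index = Nat.card K := by
    rw [Subgroup.index_ker, MonoidHom.range_eq_top.2 hf, Subgroup.card_top]
  obtain ⟨C, hC⟩ := Subgroup.exists_right_complement'_of_coprime (N := f.ker) (by rwa [hi])
  have hcard : Nat.card C = Nat.card K := by rw [← hi, hC.symm.index_eq_card]
  let g : C →* K := f.comp C.subtype
  have hg : Function.Injective g := by
    rw [injective_iff_map_eq_one]
    intro a ha
    have := Subgroup.disjoint_def.1 hC.disjoint (x := (a : G)) ha a.2
    exact Subtype.ext this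
  have hb : Function.Bijective g := (Nat.bijective_iff_injective_and_card g).2 ⟨hg, hcard⟩
  let e := MulEquiv.ofBijective g hb
  refine ⟨C.subtype.comp e.symm.toMonoidHom, fun k => ?_⟩
  exact e.apply_symm_apply k

lemma lift_ring {d : ℕ} {R F : Type} [CommRing R] [Finite R] [Field F] [Finite F] (p : ℕ)
    [Fact p.Prime] (hR : ∃ m, Nat.card R = p ^ m) (π : R →+* F) (hπ : Function.Surjective π)
    (hu : ∀ x, π x ≠ 0 → IsUnit x) (K : Subgroup (GL (Fin d) F))
    (hK : (Nat.card K).Coprime p) :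
    ∃ σ : K →* GL (Fin d) R, ∀ k, Matrix.GeneralLinearGroup.map π (σ k) = k := by
  let f : GL (Fin d) R →* GL (Fin d) F := Matrix.GeneralLinearGroup.map π
  have hfval : ∀ g : GL (Fin d) R, ((f g : GL (Fin d) F) : Matrix (Fin d) (Fin d) F) =
    π.mapMatrix (g : Matrix (Fin d) (Fin d) R) := fun g => rfl
  -- units
  have hunit : ∀ M : Matrix (Fin d) (Fin d) R, (π.mapMatrix M).det ≠ 0 → IsUnit M := by
    intro M hM
    rw [Matrix.isUnit_iff_isUnit_det]
    apply hu
    rwa [RingHom.map_det]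
  have hfs : Function.Surjective f := by
    intro g
    choose s hs using hπ
    let M : Matrix (Fin d) (Fin d) R := Matrix.of fun i j => s ((g : Matrix (Fin d) (Fin d) F) i j)
    have hM : π.mapMatrix M = g := by
      ext i j; simp [M, hs]
    have hd : IsUnit M := hunit M (by
      rw [hM]; exact ((Matrix.isUnit_iff_isUnit_det _).1 g.isUnit).ne_zero)
    refine ⟨hd.unit, ?_⟩
    apply Units.ext
    rw [hfval, IsUnit.unit_spec, hM]
  let I := RingHom.ker π
  have hker : ∃ m, Nat.card f.ker = p ^ m := by
    have e : f.ker ≃ (Fin d → Fin d → I) := by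
      refine Equiv.ofBijective (fun g i j => ⟨((g : GL (Fin d) R) : Matrix (Fin d) (Fin d) R) i j - (1 : Matrix (Fin d) (Fin d) R) i j, ?_⟩) ⟨?_, ?_⟩
      · have h1 : f g = 1 := g.2
        have h2 := congrArg (fun x : GL (Fin d) F => (x : Matrix (Fin d) (Fin d) F) i j) h1
        simp only [hfval] at h2
        rw [RingHom.mem_ker, map_sub]
        have h3 : π ((1 : Matrix (Fin d) (Fin d) R) i j) = (1 : Matrix (Fin d) (Fin d) F) i j := by
          rw [Matrix.one_apply, Matrix.one_apply]; split_ifs <;> simp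
        rw [h3, sub_eq_zero]
        exact h2
      · intro g g' h
        apply Subtype.ext
        apply Units.ext
        ext i j
        have := congrArg Subtype.val (congrFun (congrFun h i) j)
        simpa using this
      · intro X
        let M : Matrix (Fin d) (Fin d) R := 1 + Matrix.of fun i j => (X i j : R)
        have hM : π.mapMatrix M = 1 := by
          have : π.mapMatrix (Matrix.of fun i j => (X i j : R)) = 0 := by
            ext i j
            exact (X i j).2
          rw [map_add, map_one, this, add_zero]
        have hd : IsUnit M := hunit M (by rw [hM]; simp)
        refine ⟨⟨hd.unit, ?_⟩, ?_⟩
        · apply Units.ext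
          rw [hfval, IsUnit.unit_spec, hM]; rfl
        · funext i j
          apply Subtype.ext
          simp [M]
    obtain ⟨m, hm⟩ := hR
    have hI : Nat.card I ∣ p ^ m := hm ▸ AddSubgroup.card_addSubgroup_dvd_card I.toAddSubgroup
    obtain ⟨l, -, hl⟩ := (Nat.dvd_prime_pow (Fact.out : p.Prime)).1 hI
    refine ⟨l * d * d, ?_⟩
    rw [Nat.card_congr e]
    simp [Nat.card_pi, hl, pow_mul]
  obtain ⟨m, hm⟩ := hker
  let f' : K.comap f →* K := (f.comp (K.comap f).subtype).codRestrict K (fun x => x.2)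
  have hf' : Function.Surjective f' := by
    rintro ⟨k, hk⟩
    obtain ⟨g, rfl⟩ := hfs k
    exact ⟨⟨g, hk⟩, rfl⟩
  have hcard : Nat.card f'.ker = Nat.card f.ker := by
    refine Nat.card_congr (Equiv.ofBijective (fun x => ⟨(x : K.comap f), ?_⟩) ⟨?_, ?_⟩)
    · have : f' x = 1 := x.2
      exact congrArg Subtype.val this
    · intro x y h
      apply Subtype.ext; apply Subtype.ext
      exact congrArg (fun z : f.ker => (z : GL (Fin d) R)) h
    · rintro ⟨g, hg⟩
      have hg' : f g = 1 := hg
      exact ⟨⟨⟨g, by rw [Subgroup.mem_comap, hg']; exact K.one_mem⟩, Subtype.ext hg'⟩, rfl⟩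
  obtain ⟨σ, hσ⟩ := sz_section f' hf' (by
    rw [hcard, hm]; exact (Nat.Coprime.pow_right m hK).symm)
  refine ⟨(K.comap f).subtype.comp σ, fun k => ?_⟩
  exact congrArg Subtype.val (hσ k)

section
variable (p : ℕ) [Fact p.Prime] (F : Type) [Field F] [CharP F p]

noncomputable def twPi (n : ℕ) : TruncatedWittVector p (n+1) F →+* F :=
  RingHom.liftOfSurjective (WittVector.truncate (n+1)) (WittVector.truncate_surjective p (n+1) F)
    ⟨WittVector.constantCoeff, by
      intro x hx
      rw [WittVector.mem_ker_truncate] at hx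
      exact hx 0 (by omega)⟩

lemma twPi_truncate (n : ℕ) (x : WittVector p F) :
    twPi p F n (WittVector.truncate (n+1) x) = x.coeff 0 :=
  RingHom.liftOfRightInverse_comp_apply _ _ _ _ _

lemma twPi_surj (n : ℕ) : Function.Surjective (twPi p F n) := by
  intro a
  exact ⟨WittVector.truncate (n+1) (WittVector.teichmuller p a), by rw [twPi_truncate]; simp⟩

lemma twPi_unit (n : ℕ) (x) (hx : twPi p F n x ≠ 0) : IsUnit x := by
  obtain ⟨y, rfl⟩ := WittVector.truncate_surjective p (n+1) F x
  rw [twPi_truncate] at hx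
  exact (WittVector.isUnit_of_coeff_zero_ne_zero y hx).map (WittVector.truncate (n+1))

lemma tw_p_ne (n : ℕ) : (p : TruncatedWittVector p (n+1) F) ^ n ≠ 0 := by
  intro h
  have h1 : WittVector.truncate (n+1) ((p : WittVector p F) ^ n) = 0 := by
    rw [map_pow, map_natCast, h]
  have h2 : (p : WittVector p F) ^ n ∈ RingHom.ker (WittVector.truncate (p := p) (R := F) (n+1)) := h1
  rw [WittVector.mem_ker_truncate] at h2
  have := h2 n (by omega)
  rw [WittVector.coeff_p_pow] at this
  exact one_ne_zero this

lemma tw_card [Fintype F] (n : ℕ) : ∃ m, Nat.card (TruncatedWittVector p (n+1) F) = p ^ m := by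
  obtain ⟨k, -, hk⟩ := FiniteField.card F p
  refine ⟨k * (n+1), ?_⟩
  rw [Nat.card_eq_fintype_card, TruncatedWittVector.card, hk, pow_mul]

end

lemma embed_complex (L : Type) [Field L] [CharZero L] (hL : Cardinal.mk L ≤ Cardinal.continuum) :
    Nonempty (L →+* ℂ) := by
  let P := FractionRing (MvPolynomial ℝ L)
  let C := AlgebraicClosure P
  have h1 : Cardinal.mk P = Cardinal.continuum := by
    rw [Cardinal.mk_fractionRing, MvPolynomial.cardinalMk_eq_max, Cardinal.mk_real]
    rw [max_eq_right hL]
    exact max_eq_left Cardinal.aleph0_le_continuum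
  have h2 : Cardinal.mk C = Cardinal.continuum := by
    apply le_antisymm
    · refine (Algebra.IsAlgebraic.cardinalMk_le_max P C).trans ?_
      rw [h1]; exact (max_eq_left Cardinal.aleph0_le_continuum).le
    · rw [← h1]
      exact Cardinal.mk_le_of_injective (algebraMap P C).injective
  let φ : L →+* C := (algebraMap P C).comp ((algebraMap (MvPolynomial ℝ L) P).comp MvPolynomial.C)
  have : CharZero C := charZero_of_injective_ringHom φ.injective
  obtain ⟨e⟩ := IsAlgClosed.ringEquiv_of_equiv_of_charZero (K := C) (L := ℂ)
    (by rw [h2]; exact Cardinal.aleph0_lt_continuum)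
    (Cardinal.eq.1 (by rw [h2, Cardinal.mk_complex]))
  exact ⟨e.toRingHom.comp φ⟩

theorem lift_complex {d : ℕ} {F : Type} [Field F] [Fintype F] (p : ℕ)
    [Fact p.Prime] [CharP F p] (K : Subgroup (GL (Fin d) F)) (hK : (Nat.card K).Coprime p) :
    ∃ ρ : K →* Matrix (Fin d) (Fin d) ℂ, Function.Injective ρ := by
  let R : ℕ → Type := fun n => TruncatedWittVector p (n+1) F
  have hfin : ∀ n, Finite (R n) := fun n => inferInstanceAs (Finite (TruncatedWittVector p (n+1) F))
  let iR : ∀ n, CommRing (R n) := fun n => inferInstanceAs (CommRing (TruncatedWittVector p (n+1) F))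
  let π : ∀ n, R n →+* F := fun n => twPi p F n
  have hπu : ∀ n x, π n x ≠ 0 → IsUnit x := fun n => twPi_unit p F n
  choose σ hσ using fun n => lift_ring (R := R n) p (tw_card p F n) (π n) (twPi_surj p F n)
    (hπu n) K hK
  let S := ∀ n, R n
  have hSu : ∀ x : S, (∀ n, π n (x n) ≠ 0) → IsUnit x := fun x hx =>
    Pi.isUnit_iff.2 fun n => hπu n _ (hx n)
  have hnil : ¬ IsNilpotent (p : S) := by
    rintro ⟨n, hn⟩
    have := congrFun hn n
    exact tw_p_ne p F n this
  rw [nilpotent_iff_mem_prime] at hnil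
  push Not at hnil
  obtain ⟨P, hP, hpP⟩ := hnil
  let D := S ⧸ P
  have : IsDomain D := Ideal.Quotient.isDomain P
  have hD0 : ∀ m : ℕ, m ≠ 0 → ((m : ℕ) : D) ≠ 0 := by
    intro m hm h0
    obtain ⟨a, b, hb, rfl⟩ := Nat.exists_eq_pow_mul_and_not_dvd hm p (Fact.out : p.Prime).ne_one
    have hb' : IsUnit ((b : ℕ) : S) := by
      apply hSu
      intro n
      have : ((b : ℕ) : S) n = ((b : ℕ) : R n) := rfl
      rw [this, map_natCast]
      rwa [Ne, CharP.cast_eq_zero_iff F p]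
    have hb2 : IsUnit ((b : ℕ) : D) := by
      have := hb'.map (Ideal.Quotient.mk P)
      rwa [map_natCast] at this
    rw [Nat.cast_mul, Nat.cast_pow] at h0
    rcases mul_eq_zero.1 h0 with h | h
    · have h := eq_zero_of_pow_eq_zero h
      apply hpP
      rw [← Ideal.Quotient.eq_zero_iff_mem, map_natCast]
      exact h
    · exact hb2.ne_zero h
  have : CharZero D := charZero_of_inj_zero (fun n hn => by
    by_contra h; exact hD0 n h hn)
  let L := FractionRing D
  have : CharZero L := charZero_of_injective_algebraMap (IsFractionRing.injective D L)
  have hcard : Cardinal.mk L ≤ Cardinal.continuum := by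
    rw [Cardinal.mk_fractionRing]
    refine (Cardinal.mk_le_of_surjective Ideal.Quotient.mk_surjective).trans (?_ : Cardinal.mk S ≤ _)
    rw [Cardinal.mk_pi]
    refine (Cardinal.prod_le_prod _ (fun _ => Cardinal.aleph0) (fun n => ?_)).trans ?_
    · exact (Cardinal.lt_aleph0_of_finite (R n)).le
    · simp
  obtain ⟨φ0⟩ := embed_complex L hcard
  let φ : S →+* ℂ := φ0.comp ((algebraMap D L).comp (Ideal.Quotient.mk P))
  let τ : K →* Matrix (Fin d) (Fin d) S :=
    { toFun := fun k => Matrix.of fun i j n => ((σ n k : GL (Fin d) (R n)) : Matrix (Fin d) (Fin d) (R n)) i j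
      map_one' := by
        ext i j n
        simp only [map_one, Matrix.of_apply, Units.val_one, Matrix.one_apply]
        split_ifs <;> rfl
      map_mul' := by
        intro a b
        apply Matrix.ext
        intro i j
        funext n
        simp only [Matrix.mul_apply, Matrix.of_apply, map_mul, Units.val_mul]
        exact (map_sum (Pi.evalRingHom R n) (fun l : Fin d =>
          ((fun n => ((σ n a : GL (Fin d) (R n)) : Matrix (Fin d) (Fin d) (R n)) i l : S) *
          (fun n => ((σ n b : GL (Fin d) (R n)) : Matrix (Fin d) (Fin d) (R n)) l j : S)))
          Finset.univ).symm }
  refine ⟨(φ.mapMatrix (m := Fin d)).toMonoidHom.comp τ, ?_⟩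
  rw [injective_iff_map_eq_one]
  intro k hk
  by_contra hk1
  have : ∃ i j, ((k : GL (Fin d) F) : Matrix (Fin d) (Fin d) F) i j ≠ (1 : Matrix (Fin d) (Fin d) F) i j := by
    by_contra hcon
    push Not at hcon
    apply hk1
    apply Subtype.ext
    apply Units.ext
    ext i j
    exact hcon i j
  obtain ⟨i, j, hij⟩ := this
  have h1 : IsUnit (τ k i j - (1 : Matrix (Fin d) (Fin d) S) i j) := by
    apply hSu
    intro n
    rw [Pi.sub_apply, map_sub]
    have e1 : π n (τ k i j n) = ((k : GL (Fin d) F) : Matrix (Fin d) (Fin d) F) i j := by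
      rw [← hσ n k]; rfl
    have e2 : π n ((1 : Matrix (Fin d) (Fin d) S) i j n) = (1 : Matrix (Fin d) (Fin d) F) i j := by
      rw [Matrix.one_apply, Matrix.one_apply]
      split_ifs
      · exact map_one (π n)
      · exact map_zero (π n)
    rw [e1, e2]
    exact sub_ne_zero.2 hij
  have h2 := (h1.map φ).ne_zero
  apply h2
  have h3 := congrFun (congrFun hk i) j
  change φ (τ k i j) = (1 : Matrix (Fin d) (Fin d) ℂ) i j at h3
  rw [map_sub, h3, Matrix.one_apply, Matrix.one_apply]
  split_ifs <;> simp

theorem jordan_prime (d : ℕ) : ∃ J : ℕ, ∀ (F : Type) [Field F] [Fintype F] (p : ℕ)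
    [Fact p.Prime] [CharP F p] (K : Subgroup (GL (Fin d) F)), (Nat.card K).Coprime p →
    ∃ A : Subgroup K, A.index ≤ J ∧ ∀ a ∈ A, ∀ b ∈ A, a * b = b * a := by
  obtain ⟨J, hJ⟩ := jordan_matrix d
  refine ⟨J, ?_⟩
  intro F _ _ p _ _ K hK
  obtain ⟨ρ, hρ⟩ := lift_complex p K hK
  obtain ⟨A, h1, h2⟩ := hJ K ρ
  refine ⟨A, h1, fun a ha b hb => hρ ?_⟩
  rw [map_mul, map_mul]
  exact h2 a ha b hb


noncomputable def quotHom {K : Type*} [Group K] {k V : Type*} [Field k] [AddCommGroup V] [Module k V]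
    (ρ : K →* Module.End k V) (W : Submodule k V) (h : ∀ g, ∀ w ∈ W, ρ g w ∈ W) :
    K →* Module.End k (V ⧸ W) where
  toFun g := W.mapQ W (ρ g) (h g)
  map_one' := by ext; simp
  map_mul' a b := by ext; simp

lemma quotHom_apply {K : Type*} [Group K] {k V : Type*} [Field k] [AddCommGroup V] [Module k V]
    (ρ : K →* Module.End k V) (W : Submodule k V) (h : ∀ g, ∀ w ∈ W, ρ g w ∈ W) (g : K) (v : V) :
    quotHom ρ W h g (W.mkQ v) = W.mkQ (ρ g v) := rfl

lemma unip_trivial {E : Type*} [Group E] [Finite E] {F V : Type*} [Field F] [AddCommGroup V]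
    [Module F V] (p : ℕ) [hp : Fact p.Prime] [CharP F p] (hE : (Nat.card E).Coprime p)
    (ρ : E →* Module.End F V) (g : E) (hg : (ρ g - 1) * (ρ g - 1) = 0) : ρ g = 1 := by
  have h1 : ρ g ^ p = 1 := by
    have e : ρ g = (ρ g - 1) + 1 := by abel
    by_cases hV : Nontrivial V
    · have : CharP (Module.End F V) p := charP_of_injective_algebraMap (algebraMap F (Module.End F V)).injective p
      rw [e, add_pow_char_of_commute _ (Commute.one_right _), one_pow]
      have : (ρ g - 1) ^ p = 0 := by
        obtain ⟨m, hm⟩ := Nat.exists_eq_add_of_le hp.out.two_le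
        rw [hm, pow_add, pow_two, hg, zero_mul]
      rw [this, zero_add]
    · rw [not_nontrivial_iff_subsingleton] at hV
      ext; exact Subsingleton.elim _ _
  have h2 : g ^ p ∈ ρ.ker := by rw [MonoidHom.mem_ker, map_pow, h1]
  have h3 : g ^ Nat.card E ∈ ρ.ker := by rw [pow_card_eq_one']; exact one_mem _
  have h4 : g ∈ ρ.ker := by
    have hb := Nat.gcd_eq_gcd_ab (Nat.card E) p
    rw [hE] at hb
    have : g = (g ^ Nat.card E) ^ (Nat.gcdA (Nat.card E) p) * (g ^ p) ^ (Nat.gcdB (Nat.card E) p) := by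
      rw [← zpow_natCast, ← zpow_natCast, ← zpow_mul, ← zpow_mul, ← zpow_add, ← hb]; simp
    rw [this]
    exact mul_mem (zpow_mem h3 _) (zpow_mem h2 _)
  exact h4

lemma abelian_card {E : Type} [Group E] [Finite E] {F : Type} [Field F] [Fintype F] (p : ℕ)
    [Fact p.Prime] [CharP F p] (hE : (Nat.card E).Coprime p)
    (n : ℕ) : ∀ (V : Type) [AddCommGroup V] [Module F V] [FiniteDimensional F V],
    Module.finrank F V ≤ n → ∀ ρ : E →* Module.End F V,
    (∀ a b, ρ a * ρ b = ρ b * ρ a) →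
    ρ.ker.index ≤ Fintype.card F ^ (Module.finrank F V) := by
  induction n with
  | zero =>
    intro V _ _ _ hn ρ hab
    have : Subsingleton V := Module.finrank_zero_iff.1 (Nat.le_zero.1 hn)
    have : ρ.ker = ⊤ := by
      rw [eq_top_iff]; intro g _
      show ρ g = 1
      ext; exact Subsingleton.elim _ _
    rw [this]; simp only [Subgroup.index_top]
    exact Nat.one_le_pow _ _ Fintype.card_pos
  | succ n ih =>
    intro V _ _ _ hn ρ hab
    by_cases hW : ∃ W : Submodule F V, W ≠ ⊥ ∧ W ≠ ⊤ ∧ ∀ g, ∀ w ∈ W, ρ g w ∈ W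
    · obtain ⟨W, hbot, htop, hinv⟩ := hW
      have h1 : Module.finrank F W < Module.finrank F V := Submodule.finrank_lt htop
      have h2 : 0 < Module.finrank F W := by
        rw [Module.finrank_pos_iff]
        exact Submodule.nontrivial_iff_ne_bot.2 hbot
      have h3 := Submodule.finrank_quotient_add_finrank W
      have i1 := ih W (by omega) (restrictHom ρ W hinv) (by
        intro a b; rw [← map_mul, ← map_mul]
        ext x
        have := congrArg (fun f => f (x : V)) (hab a b)
        rw [restrictHom_apply, restrictHom_apply, map_mul, map_mul]; exact this)
      have i2 := ih (V ⧸ W) (by omega) (quotHom ρ W hinv) (by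
        intro a b; rw [← map_mul, ← map_mul]
        apply LinearMap.ext
        intro x
        obtain ⟨x, rfl⟩ := W.mkQ_surjective x
        rw [quotHom_apply, quotHom_apply, map_mul, map_mul, hab])
      have hle : (restrictHom ρ W hinv).ker ⊓ (quotHom ρ W hinv).ker ≤ ρ.ker := by
        rintro g ⟨hg1, hg2⟩
        have hg1 : restrictHom ρ W hinv g = 1 := hg1
        have hg2 : quotHom ρ W hinv g = 1 := hg2
        show ρ g = 1
        apply unip_trivial p hE ρ g
        ext x
        have a1 : (ρ g - 1) x ∈ W := by
          have := congrArg (fun f => f (W.mkQ x)) hg2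
          simp only [quotHom_apply, Module.End.one_apply] at this
          rw [← Submodule.ker_mkQ W, LinearMap.mem_ker, LinearMap.sub_apply, map_sub, this]
          simp
        have a2 := congrArg (fun f => ((f ⟨_, a1⟩ : W) : V)) hg1
        simp only [restrictHom_apply, Module.End.one_apply] at a2
        rw [Module.End.mul_apply, LinearMap.sub_apply, a2]
        simp
      have h4 : ρ.ker.index ≤ ((restrictHom ρ W hinv).ker ⊓ (quotHom ρ W hinv).ker).index :=
        Nat.le_of_dvd (Nat.pos_of_ne_zero Subgroup.index_ne_zero_of_finite) (Subgroup.index_dvd_of_le hle)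
      refine h4.trans (Subgroup.index_inf_le.trans ?_)
      rw [← h3, pow_add, mul_comm]
      exact Nat.mul_le_mul i2 i1
    · push Not at hW
      by_cases hV : Nontrivial V
      · obtain ⟨v, hv⟩ := exists_ne (0 : V)
        have hfV : Finite V := Module.finite_of_finite F
        have hcV : Nat.card V = Fintype.card F ^ Module.finrank F V := by
          rw [← Nat.card_eq_fintype_card]; exact Module.natCard_eq_pow_finrank
        rw [← hcV, Subgroup.index]
        refine Nat.card_le_card_of_injective (fun x : E ⧸ ρ.ker => ρ x.out v) ?_
        intro x y hxy
        have hxy : ρ x.out v = ρ y.out v := hxy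
        rw [← x.out_eq', ← y.out_eq']
        apply QuotientGroup.eq.2
        set g := x.out⁻¹ * y.out
        have hgv : ρ g v = v := by
          rw [map_mul, Module.End.mul_apply, ← hxy, ← Module.End.mul_apply, ← map_mul]; simp
        by_contra hg
        obtain ⟨e, w, hw, hew⟩ := hW (LinearMap.ker (ρ g - 1)) (by
            intro h0
            have : v ∈ LinearMap.ker (ρ g - 1) := by simp [hgv]
            rw [h0] at this; exact hv (by simpa using this)) (by
            intro h0
            apply hg
            rw [LinearMap.ker_eq_top, sub_eq_zero] at h0
            exact h0)
        apply hew
        rw [LinearMap.mem_ker, LinearMap.sub_apply, sub_eq_zero] at hw ⊢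
        rw [← Module.End.mul_apply, hab, Module.End.mul_apply, hw]; rfl
      · rw [not_nontrivial_iff_subsingleton] at hV
        have : ρ.ker = ⊤ := by
          rw [eq_top_iff]; intro g _
          show ρ g = 1
          ext; exact Subsingleton.elim _ _
        rw [this]; simp only [Subgroup.index_top]
        exact Nat.one_le_pow _ _ Fintype.card_pos

/-- Prime-to-p subgroups of `GL_d(F)` have order at most `J q ^ d`. -/
theorem prime_to_p_card (d : ℕ) : ∃ J : ℕ, 0 < J ∧ ∀ (F : Type) [Field F] [Fintype F] (p : ℕ)
    [Fact p.Prime] [CharP F p] (K : Subgroup (GL (Fin d) F)), (Nat.card K).Coprime p →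
    Nat.card K ≤ J * Fintype.card F ^ d := by
  obtain ⟨J, hJ⟩ := jordan_prime d
  refine ⟨J + 1, by omega, ?_⟩
  intro F _ _ p _ _ K hK
  obtain ⟨A, h1, h2⟩ := hJ F p K hK
  let e : Matrix (Fin d) (Fin d) F ≃ₐ[F] Module.End F (Fin d → F) := Matrix.toLinAlgEquiv'
  let ρ : A →* Module.End F (Fin d → F) :=
    (e : Matrix (Fin d) (Fin d) F ≃* Module.End F (Fin d → F)).toMonoidHom.comp
      ((Units.coeHom _).comp (K.subtype.comp A.subtype))
  have hρ : Function.Injective ρ := by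
    intro a b hab
    apply Subtype.ext; apply Subtype.ext; apply Units.ext
    exact e.injective hab
  have hA : (Nat.card A).Coprime p := Nat.Coprime.coprime_dvd_left (Subgroup.card_subgroup_dvd_card A) hK
  have h3 := abelian_card p hA d (Fin d → F) (by simp) ρ (by
    intro a b
    rw [← map_mul, ← map_mul]
    congr 1
    exact Subtype.ext (h2 a a.2 b b.2))
  rw [(MonoidHom.ker_eq_bot_iff ρ).2 hρ, Subgroup.index_bot] at h3
  simp only [Module.finrank_fintype_fun_eq_card, Fintype.card_fin] at h3
  rw [← Subgroup.card_mul_index A, mul_comm]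
  exact Nat.mul_le_mul (by omega) h3


def subgroupOfFin {G : Type*} [Group G] [Finite G] (M : Submonoid G) : Subgroup G :=
  { M with
    inv_mem' := by
      intro x hx
      have hx : x ∈ M := hx
      have : x⁻¹ = x ^ (orderOf x - 1) := by
        rw [inv_eq_iff_mul_eq_one, ← pow_succ', Nat.sub_add_cancel (orderOf_pos x), pow_orderOf_eq_one]
      show x⁻¹ ∈ M
      rw [this]
      exact pow_mem hx _ }

section
variable {d : ℕ} {F : Type} [Field F] [Fintype F]

/-- the Borel subgroup of upper triangular matrices -/
def BB (d : ℕ) (F : Type) [Field F] [Fintype F] : Subgroup (GL (Fin d) F) := subgroupOfFin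
  { carrier := {g | ∀ i j : Fin d, j < i → (g : Matrix (Fin d) (Fin d) F) i j = 0}
    one_mem' := by
      intro i j hij
      simp [Matrix.one_apply, hij.ne']
    mul_mem' := by
      intro a b ha hb i j hij
      rw [Units.val_mul, Matrix.mul_apply]
      refine Finset.sum_eq_zero fun k _ => ?_
      rcases lt_or_ge k i with h | h
      · rw [ha i k h, zero_mul]
      · rw [hb k j (hij.trans_le h), mul_zero] }

lemma mem_BB {g : GL (Fin d) F} : g ∈ BB d F ↔
    ∀ i j : Fin d, j < i → (g : Matrix (Fin d) (Fin d) F) i j = 0 := Iff.rfl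

/-- unipotent pattern subgroup attached to a partial order -/
def UP (r : Fin d → Fin d → Prop) (h2 : ∀ i j k, r i j → r j k → r i k)
    (h3 : ∀ i j, r i j → r j i → i = j) (F : Type) [Field F] [Fintype F] :
    Subgroup (GL (Fin d) F) := subgroupOfFin
  { carrier := {g | (∀ i j : Fin d, i ≠ j → ¬ r i j → (g : Matrix (Fin d) (Fin d) F) i j = 0) ∧
      ∀ i, (g : Matrix (Fin d) (Fin d) F) i i = 1}
    one_mem' := by
      refine ⟨fun i j hij _ => ?_, fun i => ?_⟩
      · simp [Matrix.one_apply, hij]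
      · simp
    mul_mem' := by
      rintro a b ⟨ha, ha'⟩ ⟨hb, hb'⟩
      refine ⟨fun i j hij hr => ?_, fun i => ?_⟩
      · rw [Units.val_mul, Matrix.mul_apply]
        refine Finset.sum_eq_zero fun k _ => ?_
        by_cases hki : k = i
        · subst hki; rw [hb k j hij hr, mul_zero]
        by_cases hkj : k = j
        · subst hkj; rw [ha i k hij hr, zero_mul]
        by_cases hik : r i k
        · have : ¬ r k j := fun h => hr (h2 _ _ _ hik h)
          rw [hb k j hkj this, mul_zero]
        · rw [ha i k (Ne.symm hki) hik, zero_mul]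
      · rw [Units.val_mul, Matrix.mul_apply, Finset.sum_eq_single i]
        · rw [ha', hb', one_mul]
        · intro k _ hki
          by_cases hik : r i k
          · have : ¬ r k i := fun h => hki (h3 _ _ h hik)
            rw [hb k i hki this, mul_zero]
          · rw [ha i k (Ne.symm hki) hik, zero_mul]
        · simp }

lemma mem_UP {r : Fin d → Fin d → Prop} {h2 : ∀ i j k, r i j → r j k → r i k}
    {h3 : ∀ i j, r i j → r j i → i = j} {g : GL (Fin d) F} : g ∈ UP r h2 h3 F ↔
    (∀ i j : Fin d, i ≠ j → ¬ r i j → (g : Matrix (Fin d) (Fin d) F) i j = 0) ∧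
      ∀ i, (g : Matrix (Fin d) (Fin d) F) i i = 1 := Iff.rfl

open Classical in
lemma card_UP (r : Fin d → Fin d → Prop) (h2 : ∀ i j k, r i j → r j k → r i k)
    (h3 : ∀ i j, r i j → r j i → i = j)
    (hdet : ∀ M : Matrix (Fin d) (Fin d) F, (∀ i j : Fin d, i ≠ j → ¬ r i j → M i j = 0) →
      (∀ i, M i i = 1) → M.det = 1) :
    Nat.card (UP r h2 h3 F) =
      Fintype.card F ^ (Finset.univ.filter fun x : Fin d × Fin d => x.1 ≠ x.2 ∧ r x.1 x.2).card := by
  have e : UP r h2 h3 F ≃ ({x : Fin d × Fin d // x.1 ≠ x.2 ∧ r x.1 x.2} → F) := by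
    refine Equiv.ofBijective (fun g x => ((g : GL (Fin d) F) : Matrix (Fin d) (Fin d) F) x.1.1 x.1.2) ⟨?_, ?_⟩
    · rintro ⟨g, hg⟩ ⟨g', hg'⟩ h
      rw [mem_UP] at hg hg'
      apply Subtype.ext; apply Units.ext
      ext i j
      by_cases hij : i = j
      · subst hij; exact (hg.2 i).trans (hg'.2 i).symm
      by_cases hr : r i j
      · exact congrFun h ⟨(i,j), hij, hr⟩
      · exact (hg.1 i j hij hr).trans (hg'.1 i j hij hr).symm
    · intro f
      let M : Matrix (Fin d) (Fin d) F := Matrix.of fun i j =>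
        if h : i ≠ j ∧ r i j then f ⟨(i,j), h⟩ else (1 : Matrix (Fin d) (Fin d) F) i j
      have hM1 : ∀ i j : Fin d, i ≠ j → ¬ r i j → M i j = 0 := by
        intro i j hij hr
        simp [M, hr, hij]
      have hM2 : ∀ i, M i i = 1 := by intro i; simp [M]
      have hu : IsUnit M := by
        rw [Matrix.isUnit_iff_isUnit_det, hdet M hM1 hM2]; exact isUnit_one
      refine ⟨⟨hu.unit, ?_⟩, ?_⟩
      · rw [mem_UP, IsUnit.unit_spec]; exact ⟨hM1, hM2⟩
      · funext x
        obtain ⟨⟨i, j⟩, hx⟩ := x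
        simp only [IsUnit.unit_spec]
        simp only [M, Matrix.of_apply]
        rw [dif_pos hx]
  rw [Nat.card_congr e, Nat.card_fun, Nat.card_eq_fintype_card, Nat.card_eq_fintype_card,
    Fintype.card_subtype]

/-- upper unitriangular matrices -/
def UU (d : ℕ) (F : Type) [Field F] [Fintype F] : Subgroup (GL (Fin d) F) :=
  UP (fun i j : Fin d => i ≤ j) (fun _ _ _ => le_trans) (fun _ _ => le_antisymm) F

lemma mem_UU {g : GL (Fin d) F} : g ∈ UU d F ↔ g ∈ BB d F ∧
    ∀ i, (g : Matrix (Fin d) (Fin d) F) i i = 1 := by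
  rw [UU, mem_UP, mem_BB]
  constructor
  · rintro ⟨h1, h2⟩
    exact ⟨fun i j hij => h1 i j hij.ne' (not_le.2 hij), h2⟩
  · rintro ⟨h1, h2⟩
    exact ⟨fun i j _ h => h1 i j (not_le.1 h), h2⟩

lemma card_UU : Nat.card (UU d F) = Fintype.card F ^ (∑ i : Fin d, (i : ℕ)) := by
  classical
  rw [UU, card_UP]
  · congr 1
    rw [Finset.card_filter, Fintype.sum_prod_type, Finset.sum_comm]
    refine Finset.sum_congr rfl fun j _ => ?_
    have h : (j : ℕ) = (Finset.univ.filter fun i : Fin d => i < j).card := by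
      rw [← Fin.card_Iio j]
      congr 1
      ext i
      simp
    rw [h, Finset.card_filter]
    refine Finset.sum_congr rfl fun i _ => ?_
    by_cases hij : i < j
    · rw [if_pos hij, if_pos ⟨hij.ne, hij.le⟩]
    · rw [if_neg hij, if_neg fun h => hij (lt_of_le_of_ne h.2 h.1)]
  · intro M h1 h2
    rw [Matrix.det_of_isUpperTriangular]
    · simp [h2]
    · intro i j hij
      exact h1 i j (ne_of_gt hij) (not_le.2 hij)

lemma UU_index (p : ℕ) [hp : Fact p.Prime] [CharP F p] : ¬ p ∣ (UU d F).index := by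
  have h1 := Subgroup.card_mul_index (UU d F)
  rw [card_UU, Matrix.card_GL_field] at h1
  have h2 : ∏ i : Fin d, (Fintype.card F ^ d - Fintype.card F ^ (i : ℕ)) =
      Fintype.card F ^ (∑ i : Fin d, (i : ℕ)) * ∏ i : Fin d, (Fintype.card F ^ (d - i) - 1) := by
    rw [← Finset.prod_pow_eq_pow_sum, ← Finset.prod_mul_distrib]
    refine Finset.prod_congr rfl fun i _ => ?_
    rw [Nat.mul_sub, ← pow_add, mul_one, Nat.add_sub_cancel' i.2.le]
  rw [h2] at h1
  have h3 := Nat.eq_of_mul_eq_mul_left (pow_pos Fintype.card_pos _) h1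
  rw [h3, hp.out.prime.dvd_finsetProd_iff]
  rintro ⟨i, -, hi⟩
  have hpq : p ∣ Fintype.card F := by
    obtain ⟨k, -, hk⟩ := FiniteField.card F p
    rw [hk]; exact dvd_pow_self p k.ne_zero
  have h4 : p ∣ Fintype.card F ^ (d - (i : ℕ)) := hpq.trans (dvd_pow_self _ (by omega))
  have h5 : 1 ≤ Fintype.card F ^ (d - (i : ℕ)) := Nat.one_le_pow _ _ Fintype.card_pos
  have h6 : p ∣ 1 := by
    have := Nat.dvd_sub h4 hi
    rwa [Nat.sub_sub_self h5] at this
  exact hp.out.one_lt.ne' (Nat.dvd_one.1 h6)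

lemma UU_isPGroup (p : ℕ) [Fact p.Prime] [CharP F p] : IsPGroup p (UU d F) := by
  obtain ⟨k, -, hk⟩ := FiniteField.card F p
  refine IsPGroup.of_card (n := k * (∑ i : Fin d, (i : ℕ))) ?_
  rw [card_UU, hk, pow_mul]

lemma conj_into_UU (p : ℕ) [hp : Fact p.Prime] [CharP F p] (P : Subgroup (GL (Fin d) F))
    (hP : IsPGroup p P) : ∃ x : GL (Fin d) F, ∀ g ∈ P, x * g * x⁻¹ ∈ UU d F := by
  have hn : ¬ p ∣ Nat.card (GL (Fin d) F ⧸ UU d F) := UU_index p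
  obtain ⟨y, hy⟩ := hP.nonempty_fixed_point_of_prime_not_dvd_card (GL (Fin d) F ⧸ UU d F) hn
  obtain ⟨x, rfl⟩ := QuotientGroup.mk_surjective y
  refine ⟨x⁻¹, fun g hg => ?_⟩
  have h1 := hy ⟨g, hg⟩
  have h2 : ((g * x : GL (Fin d) F) : GL (Fin d) F ⧸ UU d F) = (x : GL (Fin d) F ⧸ UU d F) := h1
  have h3 := QuotientGroup.eq.1 h2.symm
  rw [inv_inv, mul_assoc]; exact h3

/-- diagonal of an upper triangular matrix -/
lemma BB_diag_ne (b : BB d F) (i : Fin d) : ((b : GL (Fin d) F) : Matrix (Fin d) (Fin d) F) i i ≠ 0 := by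
  have h : IsUnit ((b : GL (Fin d) F) : Matrix (Fin d) (Fin d) F).det :=
    (Matrix.isUnit_iff_isUnit_det _).1 (b : GL (Fin d) F).isUnit
  rw [Matrix.det_of_isUpperTriangular (fun i j hij => b.2 i j hij)] at h
  exact (Finset.prod_ne_zero_iff.1 h.ne_zero) i (Finset.mem_univ _)

lemma BB_diag_mul {a b : GL (Fin d) F} (ha : a ∈ BB d F) (hb : b ∈ BB d F) (i : Fin d) :
    ((a * b : GL (Fin d) F) : Matrix (Fin d) (Fin d) F) i i =
    (a : Matrix (Fin d) (Fin d) F) i i * (b : Matrix (Fin d) (Fin d) F) i i := by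
  rw [Units.val_mul, Matrix.mul_apply, Finset.sum_eq_single i]
  · intro k _ hk
    rcases lt_or_gt_of_ne hk with h | h
    · rw [ha i k h, zero_mul]
    · rw [hb k i h, mul_zero]
  · simp

noncomputable def dg (d : ℕ) (F : Type) [Field F] [Fintype F] : BB d F →* (Fin d → Fˣ) where
  toFun b i := Units.mk0 _ (BB_diag_ne b i)
  map_one' := by ext i; simp
  map_mul' a b := by
    ext i
    exact BB_diag_mul a.2 b.2 i

lemma dg_apply (b : BB d F) (i : Fin d) :
    ((dg d F b i : Fˣ) : F) = ((b : GL (Fin d) F) : Matrix (Fin d) (Fin d) F) i i := rfl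

lemma dg_eq_one_iff (b : BB d F) : dg d F b = 1 ↔ (b : GL (Fin d) F) ∈ UU d F := by
  rw [mem_UU]
  constructor
  · intro h
    refine ⟨b.2, fun i => ?_⟩
    rw [← dg_apply, h]; rfl
  · rintro ⟨-, h⟩
    ext i
    rw [dg_apply, h]; rfl

end


lemma frattini_A {Γ : Type*} [Group Γ] [Finite Γ] (p : ℕ) [hp : Fact p.Prime] (N : Subgroup Γ)
    [N.Normal] (P : Sylow p N) (hcop : N.index.Coprime p) (C : ℕ)
    (hC : ∀ Y : Subgroup Γ, (Nat.card Y).Coprime p → Nat.card Y ≤ C) (E : Subgroup Γ)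
    (hEN : E ≤ N) (hE : E ≤ Subgroup.normalizer ((P : Subgroup N).map N.subtype : Set Γ)) :
    Nat.card E * N.index ≤ C * Nat.card P := by
  set Pm : Subgroup Γ := (P : Subgroup N).map N.subtype with hPm
  set M : Subgroup Γ := Subgroup.normalizer (Pm : Set Γ) with hM
  have hfr : M ⊔ N = ⊤ := Sylow.normalizer_sup_eq_top P
  have h1 : N.relIndex M = N.index := by
    rw [← Subgroup.relIndex_sup_right, hfr, Subgroup.relIndex_top_right]
  have h2 : Nat.card (N ⊓ M : Subgroup Γ) * N.index = Nat.card M := by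
    rw [← h1, ← Subgroup.inf_relIndex_right N M]
    rw [← Subgroup.relIndex_bot_left, ← Subgroup.relIndex_bot_left M]
    exact Subgroup.relIndex_mul_relIndex _ _ _ bot_le inf_le_right
  have h3 : Nat.card E ≤ Nat.card (N ⊓ M : Subgroup Γ) :=
    Subgroup.card_le_of_le (le_inf hEN hE)
  have hPM : Pm ≤ M := Subgroup.le_normalizer
  have hPmcard : Nat.card Pm = Nat.card P := by
    rw [hPm]
    exact Nat.card_congr ((P : Subgroup N).equivMapOfInjective N.subtype N.subtype_injective).symm.toEquiv
  let Q : Subgroup M := Pm.subgroupOf M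
  have hQn : Q.Normal := Subgroup.normal_in_normalizer
  have hQcard : Nat.card Q = Nat.card P := by
    rw [← hPmcard]
    exact Nat.card_congr (Subgroup.subgroupOfEquivOfLe hPM).toEquiv
  have hQidx : Q.index.Coprime p := by
    have e : Q.index * M.index = (P : Subgroup N).index * N.index := by
      rw [← Subgroup.index_map_subtype (P : Subgroup N)]
      exact Subgroup.relIndex_mul_index hPM
    have hc : ((P : Subgroup N).index * N.index).Coprime p := by
      refine Nat.Coprime.mul_left ?_ hcop
      exact ((Nat.Prime.coprime_iff_not_dvd hp.out).2 P.not_dvd_index).symm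
    exact Nat.Coprime.coprime_dvd_left ⟨M.index, e.symm⟩ hc
  have hQp : (Nat.card Q).Coprime Q.index := by
    obtain ⟨n, hn⟩ := IsPGroup.iff_card.1 P.isPGroup'
    rw [hQcard]
    rw [show Nat.card P = p ^ n from hn]
    exact Nat.Coprime.pow_left n hQidx.symm
  obtain ⟨Y, hY⟩ := Subgroup.exists_right_complement'_of_coprime hQp
  have hYc : Nat.card Y = Q.index := hY.symm.index_eq_card.symm
  have h4 := hC (Y.map M.subtype) (by
    rw [← Nat.card_congr (Y.equivMapOfInjective M.subtype M.subtype_injective).toEquiv, hYc]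
    exact hQidx)
  rw [← Nat.card_congr (Y.equivMapOfInjective M.subtype M.subtype_injective).toEquiv, hYc] at h4
  calc Nat.card E * N.index ≤ Nat.card M := by rw [← h2]; exact Nat.mul_le_mul_right _ h3
    _ = Q.index * Nat.card P := by rw [← hQcard, mul_comm]; exact (Subgroup.card_mul_index Q).symm
    _ ≤ _ := Nat.mul_le_mul_right _ h4

lemma frattini_B {G : Type*} [Group G] [Finite G] (p : ℕ) [Fact p.Prime] (K N B U : Subgroup G)
    (hNK : N ≤ K) (hnorm : (N.subgroupOf K).Normal) (hcop : (N.relIndex K).Coprime p)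
    (hUB : U ≤ B) (hUn : ∀ b ∈ B, ∀ u ∈ U, b * u * b⁻¹ ∈ U) (hUp : IsPGroup p U)
    (P : Sylow p (N.subgroupOf K)) (hPU : ∀ x ∈ P, ((x : K) : G) ∈ U) (C : ℕ)
    (hC : ∀ Y : Subgroup G, (Nat.card Y).Coprime p → Nat.card Y ≤ C) :
    Nat.card (N ⊓ B : Subgroup G) * N.relIndex K ≤ C * Nat.card (N ⊓ U : Subgroup G) := by
  let j : N.subgroupOf K →* G := K.subtype.comp (N.subgroupOf K).subtype
  have hj : Function.Injective j := K.subtype_injective.comp (N.subgroupOf K).subtype_injective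
  have hPeq : U.comap j = (P : Subgroup (N.subgroupOf K)) := by
    apply P.is_maximal'
    · exact hUp.comap_of_injective j hj
    · intro x hx; exact hPU x hx
  have hmemP : ∀ x, x ∈ (P : Subgroup (N.subgroupOf K)) ↔ j x ∈ U := by
    intro x; rw [← hPeq]; rfl
  have hcard : Nat.card P = Nat.card (N ⊓ U : Subgroup G) := by
    refine Nat.card_congr (Equiv.ofBijective (fun x => ⟨j x, ?_, ?_⟩) ⟨?_, ?_⟩)
    · exact Subgroup.mem_subgroupOf.1 x.1.2
    · exact (hmemP _).1 x.2
    · intro x y h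
      exact Subtype.ext (hj (congrArg (fun z : (N ⊓ U : Subgroup G) => (z : G)) h))
    · rintro ⟨g, hgN, hgU⟩
      exact ⟨⟨⟨⟨g, hNK hgN⟩, Subgroup.mem_subgroupOf.2 hgN⟩, (hmemP _).2 hgU⟩, rfl⟩
  rw [← hcard]
  have hE : Nat.card (N ⊓ B : Subgroup G) = Nat.card ((N ⊓ B).subgroupOf K) :=
    (Nat.card_congr (Subgroup.subgroupOfEquivOfLe (inf_le_left.trans hNK)).toEquiv).symm
  rw [hE]
  refine frattini_A p (N.subgroupOf K) P hcop C ?_ _ ?_ ?_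
  · intro Y hY
    have := hC (Y.map K.subtype)
    rw [← Nat.card_congr (Y.equivMapOfInjective K.subtype K.subtype_injective).toEquiv] at this
    exact this hY
  · exact Subgroup.comap_mono inf_le_left
  · intro x hx
    have hxN : (x : G) ∈ N := (Subgroup.mem_subgroupOf.1 hx).1
    have hxB : (x : G) ∈ B := (Subgroup.mem_subgroupOf.1 hx).2
    have mem_map : ∀ y : K, y ∈ (P : Subgroup (N.subgroupOf K)).map (N.subgroupOf K).subtype ↔
        (y : G) ∈ N ∧ (y : G) ∈ U := by
      intro y
      constructor
      · rintro ⟨z, hz, rfl⟩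
        exact ⟨z.2, (hmemP z).1 hz⟩
      · rintro ⟨h1, h2⟩
        exact ⟨⟨y, Subgroup.mem_subgroupOf.2 h1⟩, (hmemP _).2 h2, rfl⟩
    rw [Subgroup.mem_normalizer_iff]
    intro y
    simp only [SetLike.mem_coe, mem_map]
    constructor
    · rintro ⟨h1, h2⟩
      exact ⟨N.mul_mem (N.mul_mem hxN h1) (N.inv_mem hxN), hUn _ hxB _ h2⟩
    · rintro ⟨h1, h2⟩
      have e : (y : G) = (x : G)⁻¹ * ((x * y * x⁻¹ : K) : G) * ((x : G)⁻¹)⁻¹ := by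
        simp [mul_assoc]
      rw [e]
      exact ⟨N.mul_mem (N.mul_mem (N.inv_mem hxN) h1) (N.inv_mem (N.inv_mem hxN)),
        hUn _ (B.inv_mem hxB) _ h2⟩


open ComplexConjugate

section
variable {G : Type*} [Group G] [Fintype G]

lemma crit_abs (φ : G → ℂ) (b b' u : G) (z z' : ℂ) (hbu : b * u = u * b')
    (hb : ∀ g, φ (g * b) = z * φ g) (hb' : ∀ g, φ (g * b') = z' * φ g) (hz' : ‖z'‖ = 1)
    (hne : z ≠ z') : ∑ g, conj (φ (g * u)) * φ g = 0 := by
  have h1 : ∑ g, conj (φ (g * u)) * φ g = ∑ g, conj (φ (g * b * u)) * φ (g * b) :=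
    (Fintype.sum_equiv (Equiv.mulRight b) _ _ (fun g => rfl)).symm
  have h2 : ∑ g, conj (φ (g * b * u)) * φ (g * b) = conj z' * z * ∑ g, conj (φ (g * u)) * φ g := by
    rw [Finset.mul_sum]
    refine Finset.sum_congr rfl fun g _ => ?_
    rw [mul_assoc g b u, hbu, ← mul_assoc, hb', hb, map_mul]; ring
  rw [h2] at h1
  by_contra hS
  have h3 : conj z' * z = 1 := by
    have : (conj z' * z - 1) * ∑ g, conj (φ (g * u)) * φ g = 0 := by rw [sub_mul, ← h1]; ring
    rcases mul_eq_zero.1 this with h | h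
    · exact sub_eq_zero.1 h
    · exact absurd h hS
  apply hne
  have h4 : z' * conj z' = 1 := by
    rw [Complex.mul_conj, Complex.normSq_eq_norm_sq, hz']; simp
  calc z = (z' * conj z') * z := by rw [h4, one_mul]
    _ = z' * (conj z' * z) := by ring
    _ = z' := by rw [h3, mul_one]

lemma ip_shift (φ ψ : G → ℂ) (x : G) : ∑ g, conj (φ (g * x)) * ψ (g * x) = ∑ g, conj (φ g) * ψ g :=
  Fintype.sum_equiv (Equiv.mulRight x) _ _ (fun g => rfl)

lemma ip_self_ne {φ : G → ℂ} (h : φ ≠ 0) : ∑ g, conj (φ g) * φ g ≠ 0 := by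
  intro h0
  apply h
  have h' : ∑ g, Complex.normSq (φ g) = 0 := by
    have : ((∑ g, Complex.normSq (φ g) : ℝ) : ℂ) = 0 := by
      rw [← h0]; push_cast
      exact Finset.sum_congr rfl fun k _ => Complex.normSq_eq_conj_mul_self
    exact_mod_cast this
  funext g
  have := (Finset.sum_eq_zero_iff_of_nonneg (fun i _ => Complex.normSq_nonneg _)).1 h' g
      (Finset.mem_univ _)
  simpa using this

end

section
variable {d : ℕ} {F : Type} [Field F] [Fintype F]

noncomputable def tch (θ : Fin d → MulChar F ℂ) (g : GL (Fin d) F) : ℂ :=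
  ∏ i, θ i ((g : Matrix (Fin d) (Fin d) F) i i)

lemma tch_one (θ : Fin d → MulChar F ℂ) : tch θ 1 = 1 := by simp [tch]

lemma tch_mul (θ : Fin d → MulChar F ℂ) {a b : GL (Fin d) F} (ha : a ∈ BB d F) (hb : b ∈ BB d F) :
    tch θ (a * b) = tch θ a * tch θ b := by
  rw [tch, tch, tch, ← Finset.prod_mul_distrib]
  refine Finset.prod_congr rfl fun i _ => ?_
  rw [BB_diag_mul ha hb, map_mul]

def IsEig (θ : Fin d → MulChar F ℂ) (φ : GL (Fin d) F → ℂ) : Prop :=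
  ∀ b ∈ BB d F, ∀ g, φ (g * b) = tch θ b * φ g

lemma mulChar_norm (χ : MulChar F ℂ) (τ : Fˣ) : ‖χ (τ : F)‖ = 1 := by
  have h : (χ (τ : F)) ^ (Fintype.card F - 1) = 1 := by
    rw [← map_pow, FiniteField.pow_card_sub_one_eq_one _ τ.ne_zero, map_one]
  refine Complex.norm_eq_one_of_pow_eq_one h ?_
  have := Fintype.one_lt_card (α := F)
  omega

lemma crit (θ : Fin d → MulChar F ℂ) [Fintype (GL (Fin d) F)] (φ : GL (Fin d) F → ℂ) (hφ : IsEig θ φ)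
    (u : GL (Fin d) F) (i j : Fin d) (hne : θ i ≠ θ j)
    (h0 : (u : Matrix (Fin d) (Fin d) F) i j ≠ 0)
    (h1 : ∀ k, i < k → (u : Matrix (Fin d) (Fin d) F) k j = 0)
    (h2 : ∀ l, l < j → (u : Matrix (Fin d) (Fin d) F) i l = 0) :
    ∑ g, conj (φ (g * u)) * φ g = 0 := by
  classical
  have hτ : ∃ τ : Fˣ, θ i τ ≠ θ j τ := by
    by_contra hcon
    push Not at hcon
    exact hne (MulChar.ext hcon)
  obtain ⟨τ, hτ⟩ := hτ
  set A : Matrix (Fin d) (Fin d) F := (u : Matrix (Fin d) (Fin d) F) with hA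
  let M : Matrix (Fin d) (Fin d) F := Matrix.of fun k l =>
    (1 : Matrix (Fin d) (Fin d) F) k l + if l = i then ((τ : F) - 1) * A k j / A i j else 0
  let M' : Matrix (Fin d) (Fin d) F := Matrix.of fun k l =>
    (1 : Matrix (Fin d) (Fin d) F) k l + if k = j then ((τ : F) - 1) * A i l / A i j else 0
  have hMtri : ∀ k l, l < k → M k l = 0 := by
    intro k l hlk
    simp only [M, Matrix.of_apply, Matrix.one_apply, hlk.ne', if_false, zero_add]
    split_ifs with h
    · subst h; rw [h1 k hlk]; simp
    · rfl
  have hMtri' : ∀ k l, l < k → M' k l = 0 := by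
    intro k l hlk
    simp only [M', Matrix.of_apply, Matrix.one_apply, hlk.ne', if_false, zero_add]
    split_ifs with h
    · subst h; rw [h2 l hlk]; simp
    · rfl
  have hMd : ∀ k, M k k = if k = i then (τ : F) else 1 := by
    intro k
    simp only [M, Matrix.of_apply, Matrix.one_apply, if_true]
    split_ifs with h
    · subst h; field_simp; ring
    · simp
  have hMd' : ∀ k, M' k k = if k = j then (τ : F) else 1 := by
    intro k
    simp only [M', Matrix.of_apply, Matrix.one_apply, if_true]
    split_ifs with h
    · subst h; field_simp; ring
    · simp
  have hMu : IsUnit M := by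
    rw [Matrix.isUnit_iff_isUnit_det, Matrix.det_of_isUpperTriangular (fun k l h => hMtri k l h)]
    simp [hMd]
  have hMu' : IsUnit M' := by
    rw [Matrix.isUnit_iff_isUnit_det, Matrix.det_of_isUpperTriangular (fun k l h => hMtri' k l h)]
    simp [hMd']
  have hcomm : hMu.unit * u = u * hMu'.unit := by
    apply Units.ext
    rw [Units.val_mul, Units.val_mul, IsUnit.unit_spec, IsUnit.unit_spec, ← hA]
    ext k m
    simp only [M, M', Matrix.mul_apply, Matrix.of_apply, add_mul, mul_add, Finset.sum_add_distrib,
      ite_mul, mul_ite, zero_mul, mul_zero, Finset.sum_ite_eq', Finset.mem_univ, if_true,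
      Matrix.one_apply, Finset.sum_ite_eq, one_mul, mul_one]
    ring
  have t1 : tch θ hMu.unit = θ i τ := by
    rw [tch, IsUnit.unit_spec, Finset.prod_eq_single i]
    · rw [hMd, if_pos rfl]
    · intro k _ hk; rw [hMd, if_neg hk, map_one]
    · simp
  have t2 : tch θ hMu'.unit = θ j τ := by
    rw [tch, IsUnit.unit_spec, Finset.prod_eq_single j]
    · rw [hMd', if_pos rfl]
    · intro k _ hk; rw [hMd', if_neg hk, map_one]
    · simp
  refine crit_abs φ hMu.unit hMu'.unit u (θ i τ) (θ j τ) hcomm ?_ ?_ (mulChar_norm _ _) hτ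
  · intro g; rw [← t1]; exact hφ hMu.unit hMtri g
  · intro g; rw [← t2]; exact hφ hMu'.unit hMtri' g

end


open ComplexConjugate

section
variable {d : ℕ} {F : Type} [Field F] [Fintype F]

lemma exists_permGL (F : Type) [Field F] (σ : Equiv.Perm (Fin d)) : ∃ w : GL (Fin d) F, ∀ (g : GL (Fin d) F) (k l : Fin d),
    ((w⁻¹ * g * w : GL (Fin d) F) : Matrix (Fin d) (Fin d) F) k l =
      (g : Matrix (Fin d) (Fin d) F) (σ k) (σ l) := by
  let A : Matrix (Fin d) (Fin d) F := Matrix.of fun k l => if k = σ l then 1 else 0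
  let A' : Matrix (Fin d) (Fin d) F := Matrix.of fun k l => if σ k = l then 1 else 0
  have hAm : ∀ (M : Matrix (Fin d) (Fin d) F) k l, (M * A) k l = M k (σ l) := by
    intro M k l
    simp [A, Matrix.mul_apply]
  have hAm' : ∀ (M : Matrix (Fin d) (Fin d) F) k l, (A' * M) k l = M (σ k) l := by
    intro M k l
    simp [A', Matrix.mul_apply]
  have h1 : A' * A = 1 := by
    ext k l
    rw [hAm]
    simp [A', Matrix.one_apply]
  have h2 : A * A' = 1 := mul_eq_one_comm.1 h1
  refine ⟨⟨A, A', h2, h1⟩, fun g k l => ?_⟩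
  show (A' * (g : Matrix (Fin d) (Fin d) F) * A) k l = _
  rw [hAm, hAm']

noncomputable def xx (F : Type) [Field F] (i j : Fin d) (h : i ≠ j) (c : F) : GL (Fin d) F :=
  Matrix.GeneralLinearGroup.mkOfDetNeZero (Matrix.transvection i j c)
    (by rw [Matrix.det_transvection_of_ne i j h]; exact one_ne_zero)

lemma xx_apply {d : ℕ} {F : Type} [Field F] (i j : Fin d) (h : i ≠ j) (c : F) (k l : Fin d) :
    ((xx F i j h c : GL (Fin d) F) : Matrix (Fin d) (Fin d) F) k l =
      (1 : Matrix (Fin d) (Fin d) F) k l + if i = k ∧ j = l then c else 0 := by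
  show (Matrix.transvection i j c) k l = _
  rw [Matrix.transvection, Matrix.add_apply, Matrix.single_apply]

lemma xx_mem {i j : Fin d} (h : i < j) (c : F) : xx F i j h.ne c ∈ UU d F := by
  rw [mem_UU, mem_BB]
  refine ⟨fun k l hlk => ?_, fun k => ?_⟩
  · rw [xx_apply, if_neg, Matrix.one_apply_ne hlk.ne', add_zero]
    rintro ⟨rfl, rfl⟩; exact absurd h (not_lt.2 hlk.le)
  · rw [xx_apply, if_neg, Matrix.one_apply_eq, add_zero]
    rintro ⟨rfl, rfl⟩; exact absurd h (lt_irrefl _)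

lemma swap_step (θ : Fin d → MulChar F ℂ) [Fintype (GL (Fin d) F)] (φ : GL (Fin d) F → ℂ) (hφ : IsEig θ φ)
    (hφ0 : φ ≠ 0) (K : Subgroup (GL (Fin d) F)) (lam : GL (Fin d) F → ℂ)
    (hlam : ∀ k ∈ K, ∀ g, φ (k * g) = lam k * φ g)
    (i j : Fin d) (hij : (i : ℕ) + 1 = j) (hne : θ i ≠ θ j) :
    ∃ φ' : GL (Fin d) F → ℂ, IsEig (θ ∘ Equiv.swap i j) φ' ∧ φ' ≠ 0 ∧
      ∀ k ∈ K, ∀ g, φ' (k * g) = lam k * φ' g := by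
  classical
  have hlt : i < j := by rw [Fin.lt_def]; omega
  obtain ⟨w, hw⟩ := exists_permGL F (Equiv.swap i j)
  let x : F → GL (Fin d) F := fun c => xx F i j hlt.ne c
  have hxU : ∀ c, x c ∈ UU d F := fun c => xx_mem hlt c
  have hxB : ∀ c, x c ∈ BB d F := fun c => (mem_UU.1 (hxU c)).1
  have hx : ∀ c k l, (x c : Matrix (Fin d) (Fin d) F) k l =
      (1 : Matrix (Fin d) (Fin d) F) k l + if i = k ∧ j = l then c else 0 :=
    fun c k l => xx_apply i j hlt.ne c k l
  refine ⟨fun g => ∑ c, φ (g * x c * w), ?_, ?_, ?_⟩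
  · intro b hb g
    set β := (b : Matrix (Fin d) (Fin d) F) with hβ
    have hbii : β i i ≠ 0 := BB_diag_ne ⟨b, hb⟩ i
    have hbjj : β j j ≠ 0 := BB_diag_ne ⟨b, hb⟩ j
    let f : F → F := fun c => (β i j + c * β i i) / β j j
    have hf : Function.Bijective f := by
      refine (Finite.injective_iff_bijective).1 ?_
      intro c c' h
      simp only [f] at h
      field_simp at h
      have h5 := add_left_cancel h
      rw [mul_comm (β i i)] at h5
      exact mul_right_cancel₀ hbii h5
    have key : ∀ c, φ (g * b * x c * w) = tch (θ ∘ Equiv.swap i j) b * φ (g * x (f c) * w) := by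
      intro c
      let b'' := (x (f c))⁻¹ * b * x c
      have hb'' : b'' ∈ BB d F := mul_mem (mul_mem (inv_mem (hxB _)) hb) (hxB _)
      have hmul : x (f c) * b'' = b * x c := by simp [b'', mul_assoc]
      have hdiag : ∀ k, (b'' : Matrix (Fin d) (Fin d) F) k k = β k k := by
        intro k
        have e := congrArg (fun m : GL (Fin d) F => (m : Matrix (Fin d) (Fin d) F) k k) hmul
        simp only [BB_diag_mul (hxB _) hb'', BB_diag_mul hb (hxB _), (mem_UU.1 (hxU _)).2, one_mul,
          mul_one] at e
        exact e
      have hent : (b'' : Matrix (Fin d) (Fin d) F) i j = 0 := by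
        have e := congrArg (fun m : GL (Fin d) F => (m : Matrix (Fin d) (Fin d) F) i j) hmul
        simp only [Units.val_mul, Matrix.mul_apply, hx, add_mul, mul_add, Finset.sum_add_distrib,
          Matrix.one_apply, ite_mul, one_mul, zero_mul, mul_ite, mul_one, mul_zero,
          Finset.sum_ite_eq, Finset.sum_ite_eq', Finset.mem_univ, if_true, true_and, and_true,
          hdiag] at e
        rw [← hβ] at e
        have e2 : f c * β j j = β i j + c * β i i := by simp only [f]; field_simp
        rw [e2] at e
        linear_combination e
      have hconj : w⁻¹ * b'' * w ∈ BB d F := by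
        intro k l hlk
        rw [hw]
        by_cases h : k = j ∧ l = i
        · rw [h.1, h.2, Equiv.swap_apply_right, Equiv.swap_apply_left, hent]
        · apply hb''
          rw [Fin.lt_def] at hlk ⊢
          have hs : ∀ m : Fin d, (Equiv.swap i j m : ℕ) =
              if (m : ℕ) = i then (j : ℕ) else if (m : ℕ) = j then (i : ℕ) else m := by
            intro m
            rw [Equiv.swap_apply_def]
            simp only [Fin.ext_iff]
            split_ifs <;> rfl
          rw [hs, hs]
          have : ¬ ((k : ℕ) = j ∧ (l : ℕ) = i) := fun h' => h ⟨Fin.ext h'.1, Fin.ext h'.2⟩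
          split_ifs <;> omega
      have ht : tch θ (w⁻¹ * b'' * w) = tch (θ ∘ Equiv.swap i j) b := by
        rw [tch, tch]
        refine Fintype.prod_equiv (Equiv.swap i j) _ _ fun k => ?_
        rw [hw, hdiag, Function.comp_apply, Equiv.swap_apply_self]
      have e1 : g * b * x c * w = g * x (f c) * w * (w⁻¹ * b'' * w) := by
        simp only [b'']; group
      rw [e1, hφ _ hconj, ht]
    show ∑ c, φ (g * b * x c * w) = _ * ∑ c, _
    rw [Finset.mul_sum]
    refine Fintype.sum_bijective f hf _ _ key
  · intro h0
    have h1 : ∀ c, c ≠ 0 → ∑ g, conj (φ (g * w)) * φ (g * x c * w) = 0 := by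
      intro c hc
      have h2 := crit θ φ hφ (w⁻¹ * x c * w) j i hne.symm (by
        rw [hw, hx, Equiv.swap_apply_right, Equiv.swap_apply_left, if_pos ⟨rfl, rfl⟩,
          Matrix.one_apply_ne hlt.ne, zero_add]; exact hc) (by
        intro k hk
        rw [hw, hx, Equiv.swap_apply_left, Equiv.swap_apply_of_ne_of_ne (hlt.trans hk).ne' hk.ne',
          if_neg (fun h => (hlt.trans hk).ne h.1), Matrix.one_apply_ne hk.ne', add_zero]) (by
        intro l hl
        rw [hw, hx, Equiv.swap_apply_right, Equiv.swap_apply_of_ne_of_ne hl.ne (hl.trans hlt).ne,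
          if_neg (fun h => (hl.trans hlt).ne' h.2), Matrix.one_apply_ne hl.ne', add_zero])
      have h3 := congrArg conj h2
      rw [map_sum, map_zero] at h3
      rw [← h3]
      refine Fintype.sum_equiv (Equiv.mulRight w) _ _ fun g => ?_
      simp only [Equiv.coe_mulRight, map_mul, Complex.conj_conj]
      rw [mul_comm]
      congr 2
      group
    have h4 : ∑ g, conj (φ (g * w)) * ∑ c, φ (g * x c * w) = 0 := by
      refine Finset.sum_eq_zero fun g _ => ?_
      have := congrFun h0 g
      simp only [Pi.zero_apply] at this
      rw [this, mul_zero]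
    simp only [Finset.mul_sum] at h4
    rw [Finset.sum_comm, Finset.sum_eq_single 0] at h4
    · have hx0 : x 0 = 1 := by
        apply Units.ext; ext k l; rw [hx]; simp
      simp only [hx0, mul_one] at h4
      rw [ip_shift φ φ w] at h4
      exact ip_self_ne hφ0 h4
    · intro c _ hc; exact h1 c hc
    · simp
  · intro k hk g
    show ∑ c, _ = _ * ∑ c, _
    rw [Finset.mul_sum]
    refine Finset.sum_congr rfl fun c _ => ?_
    rw [← hlam k hk]
    simp only [mul_assoc]

/-- set of tuples of characters occurring -/
def Occurs (K : Subgroup (GL (Fin d) F)) (lam : GL (Fin d) F → ℂ) (θ : Fin d → MulChar F ℂ) : Prop :=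
  ∃ φ : GL (Fin d) F → ℂ, IsEig θ φ ∧ φ ≠ 0 ∧ ∀ k ∈ K, ∀ g, φ (k * g) = lam k * φ g

lemma occurs_perm (K : Subgroup (GL (Fin d) F)) (lam : GL (Fin d) F → ℂ) (θ : Fin d → MulChar F ℂ)
    (h : Occurs K lam θ) (σ : Equiv.Perm (Fin d)) : Occurs K lam (θ ∘ σ) := by
  classical
  have : Fintype (GL (Fin d) F) := Fintype.ofFinite _
  rcases Nat.eq_zero_or_pos d with rfl | hd
  · have : θ ∘ σ = θ := by funext i; exact i.elim0
    rwa [this]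
  obtain ⟨n, rfl⟩ : ∃ n, d = n + 1 := ⟨d - 1, by omega⟩
  have hmem : σ ∈ Submonoid.closure (Set.range fun i : Fin n => Equiv.swap i.castSucc i.succ) := by
    rw [Equiv.Perm.mclosure_swap_castSucc_succ]; trivial
  have : ∀ θ : Fin (n+1) → MulChar F ℂ, Occurs K lam θ → Occurs K lam (θ ∘ σ) := by
    clear h
    induction hmem using Submonoid.closure_induction with
    | mem s hs =>
      obtain ⟨i, rfl⟩ := hs
      rintro θ ⟨φ, h1, h2, h3⟩
      by_cases hne : θ i.castSucc = θ i.succ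
      · have : θ ∘ Equiv.swap i.castSucc i.succ = θ := by
          funext k
          rw [Function.comp_apply, Equiv.swap_apply_def]
          split_ifs with ha hb
          · rw [ha, hne]
          · rw [hb, hne]
          · rfl
        show Occurs K lam (θ ∘ Equiv.swap i.castSucc i.succ)
        rw [this]; exact ⟨φ, h1, h2, h3⟩
      · exact swap_step θ φ h1 h2 K lam h3 _ _ (by simp) hne
    | one => intro θ h; exact h
    | mul a b _ _ ha hb =>
      intro θ h
      have := hb _ (ha _ h)
      exact this
  exact this θ h

end


open ComplexConjugate

section
lemma card_le_index_of_orth {G : Type*} [Group G] [Fintype G] (K Y : Subgroup G) (lam φ : G → ℂ)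
    (h0 : φ ≠ 0) (hlam : ∀ k ∈ K, ∀ g, φ (k * g) = lam k * φ g)
    (horth : ∀ u ∈ Y, u ≠ 1 → ∑ g, conj (φ (g * u)) * φ g = 0) :
    Nat.card Y ≤ K.index := by
  classical
  have hli : LinearIndependent ℂ (fun y : Y => fun x : G ⧸ K => φ ((x.out)⁻¹ * (y : G))) := by
    rw [Fintype.linearIndependent_iff]
    intro c hc z
    have h1 : ∀ g : G, ∑ y : Y, c y * φ (g * (y : G)) = 0 := by
      intro g
      have h2 := congrFun hc (QuotientGroup.mk g⁻¹)
      simp only [Finset.sum_apply, Pi.smul_apply, smul_eq_mul, Pi.zero_apply] at h2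
      obtain ⟨k, hk⟩ := QuotientGroup.mk_out_eq_mul K g⁻¹
      have h3 : g = k * (Quotient.out (QuotientGroup.mk g⁻¹ : G ⧸ K))⁻¹ := by
        rw [hk]; group
      have h4 : ∀ y : Y, c y * φ (g * (y : G)) =
          lam k * (c y * φ ((Quotient.out (QuotientGroup.mk g⁻¹ : G ⧸ K))⁻¹ * (y : G))) := by
        intro y
        conv_lhs => rw [h3]
        rw [mul_assoc, hlam k k.2]; ring
      simp_rw [h4]
      rw [← Finset.mul_sum, h2, mul_zero]
    have h5 : ∑ g, conj (φ (g * (z : G))) * ∑ y : Y, c y * φ (g * (y : G)) = 0 :=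
      Finset.sum_eq_zero fun g _ => by rw [h1, mul_zero]
    simp only [Finset.mul_sum] at h5
    rw [Finset.sum_comm, Finset.sum_eq_single z] at h5
    · have h6 : ∑ g, conj (φ (g * (z : G))) * (c z * φ (g * (z : G))) =
          c z * ∑ g, conj (φ g) * φ g := by
        rw [← ip_shift φ φ (z : G), Finset.mul_sum]
        exact Finset.sum_congr rfl fun g _ => by ring
      rw [h6] at h5
      exact (mul_eq_zero.1 h5).resolve_right (ip_self_ne h0)
    · intro y _ hyz
      have h7 := horth ((y : G)⁻¹ * z) (mul_mem (inv_mem y.2) z.2) (by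
        intro h; apply hyz; apply Subtype.ext; exact (inv_mul_eq_one.1 h))
      have h8 : ∑ g, conj (φ (g * (z : G))) * (c y * φ (g * (y : G))) =
          c y * ∑ g, conj (φ (g * ((y : G)⁻¹ * z))) * φ g := by
        rw [Finset.mul_sum]
        refine Fintype.sum_equiv (Equiv.mulRight (y : G)) _ _ fun g => ?_
        simp only [Equiv.coe_mulRight]
        rw [show g * (y : G) * ((y : G)⁻¹ * z) = g * z by group]; ring
      rw [h8, h7, mul_zero]
    · simp
  have := hli.fintype_card_le_finrank
  rw [Module.finrank_fintype_fun_eq_card] at this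
  rw [Nat.card_eq_fintype_card, Subgroup.index, Nat.card_eq_fintype_card]
  exact this

open Classical in
lemma count_pairs {d : ℕ} (f : Fin d → ℕ) :
    d * ((Finset.univ.image f).card - 1) ≤
      2 * (Finset.univ.filter fun x : Fin d × Fin d => x.1 ≠ x.2 ∧ f x.2 < f x.1).card := by
  have h1 : (Finset.univ.filter fun x : Fin d × Fin d => x.1 ≠ x.2 ∧ f x.2 < f x.1).card =
      (Finset.univ.filter fun x : Fin d × Fin d => x.1 ≠ x.2 ∧ f x.1 < f x.2).card := by
    refine Finset.card_bij' (fun x _ => x.swap) (fun x _ => x.swap) ?_ ?_ ?_ ?_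
    · intro x hx; simp at hx ⊢; exact ⟨Ne.symm hx.1, hx.2⟩
    · intro x hx; simp at hx ⊢; exact ⟨Ne.symm hx.1, hx.2⟩
    · intro x hx; rfl
    · intro x hx; rfl
  have h2 : (Finset.univ.filter fun x : Fin d × Fin d => f x.2 ≠ f x.1) ⊆
      (Finset.univ.filter fun x : Fin d × Fin d => x.1 ≠ x.2 ∧ f x.2 < f x.1) ∪
      (Finset.univ.filter fun x : Fin d × Fin d => x.1 ≠ x.2 ∧ f x.1 < f x.2) := by
    intro x hx
    simp only [Finset.mem_filter, Finset.mem_univ, true_and, Finset.mem_union] at hx ⊢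
    have hne : x.1 ≠ x.2 := fun h => hx (by rw [h])
    rcases lt_or_gt_of_ne hx with h | h
    · exact Or.inl ⟨hne, h⟩
    · exact Or.inr ⟨hne, h⟩
  have h3 : (Finset.univ.filter fun x : Fin d × Fin d => f x.2 ≠ f x.1).card =
      ∑ i : Fin d, (Finset.univ.filter fun j : Fin d => f j ≠ f i).card := by
    rw [← Finset.univ_product_univ, Finset.card_filter, Finset.sum_product]
    simp only [Finset.card_filter]
  have h4 : ∀ i : Fin d, (Finset.univ.image f).card - 1 ≤
      (Finset.univ.filter fun j : Fin d => f j ≠ f i).card := by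
    intro i
    have : Finset.univ.image f ⊆ insert (f i)
        ((Finset.univ.filter fun j : Fin d => f j ≠ f i).image f) := by
      intro y hy
      obtain ⟨j, _, rfl⟩ := Finset.mem_image.1 hy
      by_cases h : f j = f i
      · rw [h]; exact Finset.mem_insert_self _ _
      · exact Finset.mem_insert_of_mem (Finset.mem_image.2 ⟨j, by simpa using h, rfl⟩)
    have h5 := (Finset.card_le_card this).trans (Finset.card_insert_le _ _)
    have h6 := Finset.card_image_le (s := Finset.univ.filter fun j : Fin d => f j ≠ f i) (f := f)
    omega
  have h7 := Finset.sum_le_sum fun i (_ : i ∈ (Finset.univ : Finset (Fin d))) => h4 i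
  rw [← h3] at h7
  simp only [Finset.sum_const, Finset.card_univ, Fintype.card_fin, smul_eq_mul] at h7
  have h8 := (Finset.card_le_card h2).trans (Finset.card_union_le _ _)
  omega

variable {d : ℕ} {F : Type} [Field F] [Fintype F]

open Classical in
lemma dim_bound (K : Subgroup (GL (Fin d) F)) (lam : GL (Fin d) F → ℂ) (θ : Fin d → MulChar F ℂ)
    (h : Occurs K lam θ) :
    Fintype.card F ^ (d * ((Finset.univ.image θ).card - 1)) ≤ K.index ^ 2 := by
  have : Fintype (GL (Fin d) F) := Fintype.ofFinite _
  obtain ⟨e, he⟩ := exists_injective_nat (Set.range θ)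
  let f0 : Fin d → ℕ := fun i => e ⟨θ i, i, rfl⟩
  have hf0 : ∀ i j, f0 i = f0 j ↔ θ i = θ j := by
    intro i j
    refine ⟨fun h => congrArg Subtype.val (he h), fun h => ?_⟩
    simp only [f0]; congr 1; exact Subtype.ext h
  let σ := Tuple.sort f0
  have hmono : Monotone (f0 ∘ σ) := Tuple.monotone_sort f0
  set f : Fin d → ℕ := f0 ∘ σ with hf
  obtain ⟨φ, hφ, hφ0, hK⟩ := occurs_perm K lam θ h σ
  have hcard : (Finset.univ.image θ).card = (Finset.univ.image f).card := by
    have h1 : Finset.univ.image f = Finset.univ.image f0 := by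
      ext y
      simp only [Finset.mem_image, Finset.mem_univ, true_and, hf, Function.comp]
      exact ⟨fun ⟨a, h⟩ => ⟨σ a, h⟩, fun ⟨a, h⟩ => ⟨σ.symm a, by simpa using h⟩⟩
    rw [h1]
    refine Finset.card_bij (fun y hy => e ⟨y, by simpa using hy⟩) ?_ ?_ ?_
    · intro y hy
      obtain ⟨i, _, rfl⟩ := Finset.mem_image.1 hy
      exact Finset.mem_image.2 ⟨i, Finset.mem_univ _, rfl⟩
    · intro y hy y' hy' h
      exact congrArg Subtype.val (he h)
    · intro y hy
      obtain ⟨i, _, rfl⟩ := Finset.mem_image.1 hy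
      exact ⟨θ i, Finset.mem_image_of_mem _ (Finset.mem_univ _), rfl⟩
  have hlt : ∀ i j, f j < f i → j < i := fun i j hh => by
    by_contra hc
    exact absurd (hmono (not_lt.1 hc)) (not_le.2 hh)
  let r : Fin d → Fin d → Prop := fun i j => f j < f i
  have h2 : ∀ i j k, r i j → r j k → r i k := fun i j k h1 h2 => lt_trans h2 h1
  have h3 : ∀ i j, r i j → r j i → i = j := fun i j h1 h2 => absurd h1 (not_lt.2 (le_of_lt h2))
  have hY := card_UP (F := F) r h2 h3 (by
    intro M hM hM1
    rw [Matrix.det_of_isLowerTriangular, Finset.prod_eq_one fun i _ => hM1 i]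
    intro i j hij
    have hij' : i < j := hij
    exact hM i j hij'.ne (fun h => absurd (hlt _ _ h) (not_lt.2 hij'.le)))
  have hle := card_le_index_of_orth K (UP r h2 h3 F) lam φ hφ0 hK (by
    intro u hu hu1
    rw [mem_UP] at hu
    obtain ⟨hu0, hud⟩ := hu
    have hz : ∀ i j, i ≠ j → (u : Matrix (Fin d) (Fin d) F) i j ≠ 0 → f j < f i := by
      intro i j hij hne
      by_contra hc
      exact hne (hu0 i j hij hc)
    have hex : ∃ i j, i ≠ j ∧ (u : Matrix (Fin d) (Fin d) F) i j ≠ 0 := by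
      by_contra hc
      push Not at hc
      apply hu1
      apply Units.ext
      ext i j
      by_cases hij : i = j
      · rw [hij, hud]; simp
      · rw [hc i j hij]; simp [hij]
    let S := Finset.univ.filter fun i : Fin d => ∃ j, i ≠ j ∧ (u : Matrix (Fin d) (Fin d) F) i j ≠ 0
    have hS : S.Nonempty := by
      obtain ⟨i, hi⟩ := hex
      exact ⟨i, by simpa [S] using hi⟩
    have hmax := Finset.max'_mem S hS
    set i := S.max' hS with hi
    let T := Finset.univ.filter fun j : Fin d => i ≠ j ∧ (u : Matrix (Fin d) (Fin d) F) i j ≠ 0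
    have hT : T.Nonempty := by
      obtain ⟨j, hj⟩ := (Finset.mem_filter.1 hmax).2
      exact ⟨j, by simpa [T] using hj⟩
    have hmin := Finset.min'_mem T hT
    set j := T.min' hT with hj
    obtain ⟨hij, hne⟩ := (Finset.mem_filter.1 hmin).2
    have hfij := hz i j hij hne
    refine crit (θ ∘ σ) φ hφ u i j ?_ hne ?_ ?_
    · intro hc
      exact hfij.ne' ((hf0 _ _).2 hc)
    · intro k hk
      by_contra hc
      have hkj : k ≠ j := (lt_trans (hlt _ _ hfij) hk).ne'
      have : k ∈ S := by simp only [S, Finset.mem_filter, Finset.mem_univ, true_and]; exact ⟨j, hkj, hc⟩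
      exact absurd (S.le_max' k this) (not_le.2 hk)
    · intro l hl
      by_contra hc
      have hil : i ≠ l := (lt_trans hl (hlt _ _ hfij)).ne'
      have : l ∈ T := by simp only [T, Finset.mem_filter, Finset.mem_univ, true_and]; exact ⟨hil, hc⟩
      exact absurd (T.min'_le l this) (not_le.2 hl))
  rw [hY] at hle
  rw [hcard]
  calc _ ≤ Fintype.card F ^ (2 * _) := Nat.pow_le_pow_right Fintype.card_pos (count_pairs f)
    _ = (Fintype.card F ^ _) ^ 2 := by rw [mul_comm, pow_mul]; congr!
    _ ≤ _ := Nat.pow_le_pow_left hle 2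

end


lemma common_eig {V ι : Type*} [AddCommGroup V] [Module ℂ V] [FiniteDimensional ℂ V]
    (f : ι → Module.End ℂ V) : ∀ (n : ℕ) (W : Submodule ℂ V), Module.finrank ℂ W = n → W ≠ ⊥ →
    (∀ i, ∀ v ∈ W, f i v ∈ W) → (∀ i j, ∀ v ∈ W, f i (f j v) = f j (f i v)) →
    ∃ v ∈ W, v ≠ 0 ∧ ∀ i, ∃ c : ℂ, f i v = c • v := by
  intro n
  induction n using Nat.strong_induction_on with
  | _ n ih =>
  intro W hn hW hinv hcomm
  by_cases hall : ∀ i, ∃ c : ℂ, ∀ v ∈ W, f i v = c • v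
  · obtain ⟨v, hv, hv0⟩ := Submodule.exists_mem_ne_zero_of_ne_bot hW
    exact ⟨v, hv, hv0, fun i => (hall i).imp fun c hc => hc v hv⟩
  push Not at hall
  obtain ⟨i, hi⟩ := hall
  have : Nontrivial W := Submodule.nontrivial_iff_ne_bot.2 hW
  let g : Module.End ℂ W := (f i).restrict (hinv i)
  obtain ⟨μ, hμ⟩ := Module.End.exists_eigenvalue g
  obtain ⟨w, hw⟩ := hμ.exists_hasEigenvector
  have hw1 : f i (w : V) = μ • (w : V) := congrArg Subtype.val hw.apply_eq_smul
  have hw0 : (w : V) ≠ 0 := fun h => hw.2 (Subtype.ext h)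
  let W' : Submodule ℂ V := W ⊓ Module.End.eigenspace (f i) μ
  have hle : W' ≤ W := inf_le_left
  have hne : W' ≠ W := by
    intro h
    obtain ⟨v, hv, hv'⟩ := hi μ
    rw [← h] at hv
    exact hv' (Module.End.mem_eigenspace_iff.1 hv.2)
  obtain ⟨v, hv, hv0, hvi⟩ := ih (Module.finrank ℂ W') (by
      rw [← hn]; exact Submodule.finrank_lt_finrank_of_lt (lt_of_le_of_ne hle hne)) W' rfl
    (by
      intro h
      have : (w : V) ∈ W' := ⟨w.2, Module.End.mem_eigenspace_iff.2 hw1⟩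
      rw [h] at this
      exact hw0 ((Submodule.mem_bot ℂ).1 this))
    (by
      rintro j v ⟨hv1, hv2⟩
      refine ⟨hinv j v hv1, ?_⟩
      rw [SetLike.mem_coe, Module.End.mem_eigenspace_iff] at hv2 ⊢
      rw [hcomm i j v hv1, hv2, map_smul])
    (fun j k v hv => hcomm j k v (hle hv))
  exact ⟨v, hle hv, hv0, hvi⟩

section
variable {d : ℕ} {F : Type} [Field F] [Fintype F]

lemma exists_occurs (K N : Subgroup (GL (Fin d) F)) (hNK : N ≤ K)
    (hcomm : ∀ a ∈ K, ∀ b ∈ K, a * b * a⁻¹ * b⁻¹ ∈ N) (θ : Fin d → MulChar F ℂ)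
    (hθ : ∀ b ∈ N, b ∈ BB d F → tch θ b = 1) : ∃ lam, Occurs K lam θ := by
  classical
  have : Fintype (GL (Fin d) F) := Fintype.ofFinite _
  let W : Submodule ℂ (GL (Fin d) F → ℂ) :=
    { carrier := {φ | IsEig θ φ ∧ ∀ n ∈ N, ∀ g, φ (n * g) = φ g}
      zero_mem' := ⟨fun b _ g => by simp, fun n _ g => rfl⟩
      add_mem' := by
        rintro a b ⟨ha, ha'⟩ ⟨hb, hb'⟩
        refine ⟨fun x hx g => ?_, fun n hn g => ?_⟩
        · rw [Pi.add_apply, Pi.add_apply, ha x hx, hb x hx, mul_add]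
        · rw [Pi.add_apply, Pi.add_apply, ha' n hn, hb' n hn]
      smul_mem' := by
        rintro c a ⟨ha, ha'⟩
        refine ⟨fun x hx g => ?_, fun n hn g => ?_⟩
        · rw [Pi.smul_apply, Pi.smul_apply, ha x hx, smul_eq_mul, smul_eq_mul]; ring
        · rw [Pi.smul_apply, Pi.smul_apply, ha' n hn] }
  let v : GL (Fin d) F → ℂ := fun g => ∑ n : N, ∑ b : BB d F,
    if (n : GL (Fin d) F) * g = b then tch θ b else 0
  have hvW : v ∈ W := by
    refine ⟨fun b0 hb0 g => ?_, fun n0 hn0 g => ?_⟩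
    · show ∑ n : N, ∑ b : BB d F, _ = _ * ∑ n : N, ∑ b : BB d F, _
      rw [Finset.mul_sum]
      refine Finset.sum_congr rfl fun n _ => ?_
      rw [Finset.mul_sum]
      refine (Fintype.sum_equiv (Equiv.mulRight (⟨b0, hb0⟩ : BB d F)) _ _ fun b => ?_).symm
      simp only [Equiv.coe_mulRight, Subgroup.coe_mul, ← mul_assoc, mul_left_inj]
      rw [tch_mul θ b.2 hb0]
      split_ifs
      · ring
      · ring
    · show ∑ n : N, ∑ b : BB d F, _ = ∑ n : N, ∑ b : BB d F, _
      refine Fintype.sum_equiv (Equiv.mulRight (⟨n0, hn0⟩ : N)) _ _ fun n => ?_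
      simp only [Equiv.coe_mulRight, Subgroup.coe_mul, ← mul_assoc]
      congr!
  have hv1 : v 1 ≠ 0 := by
    have : v 1 = ((∑ n : N, ∑ b : BB d F,
        if (n : GL (Fin d) F) = b then 1 else 0 : ℕ) : ℂ) := by
      push_cast
      refine Finset.sum_congr rfl fun n _ => Finset.sum_congr rfl fun b _ => ?_
      rw [mul_one]
      split_ifs with h
      · exact hθ b (h ▸ n.2) b.2
      · rfl
    rw [this, Nat.cast_ne_zero]
    intro h0
    have h1 := (Finset.sum_eq_zero_iff.1 ((Finset.sum_eq_zero_iff.1 h0) 1 (Finset.mem_univ _))) 1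
      (Finset.mem_univ _)
    simp at h1
  have hW : W ≠ ⊥ := by
    intro h
    rw [h, Submodule.mem_bot] at hvW
    exact hv1 (by rw [hvW]; rfl)
  let L : K → Module.End ℂ (GL (Fin d) F → ℂ) := fun k =>
    { toFun := fun φ g => φ (k * g)
      map_add' := fun _ _ => rfl
      map_smul' := fun _ _ => rfl }
  obtain ⟨φ, hφ, hφ0, hφi⟩ := common_eig L _ W rfl hW
    (by
      rintro k φ ⟨h1, h2⟩
      refine ⟨fun b hb g => ?_, fun n hn g => ?_⟩
      · show φ (k * (g * b)) = _ * φ (k * g)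
        rw [← mul_assoc, h1 b hb]
      · show φ (k * (n * g)) = φ (k * g)
        have h3 : (k : GL (Fin d) F) * (n * g) = (k * n * (k : GL (Fin d) F)⁻¹ * n⁻¹) * (n * (k * g)) := by group
        rw [h3, h2 _ (hcomm _ k.2 _ (hNK hn)), h2 _ hn])
    (by
      rintro k l φ ⟨h1, h2⟩
      funext g
      show φ (l * (k * g)) = φ (k * (l * g))
      have h3 : (l : GL (Fin d) F) * (k * g) = (l * k * (l : GL (Fin d) F)⁻¹ * (k : GL (Fin d) F)⁻¹) * (k * (l * g)) := by group
      rw [h3, h2 _ (hcomm _ l.2 _ k.2)])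
  choose c hc using hφi
  refine ⟨fun k => if h : k ∈ K then c ⟨k, h⟩ else 0, φ, hφ.1, hφ0, fun k hk g => ?_⟩
  simp only [dif_pos hk]
  exact congrFun (hc ⟨k, hk⟩) g

end


lemma count_tuples {M : Type*} [Fintype M] [DecidableEq M] (d k : ℕ) (hd : 0 < d)
    (X : Finset (Fin d → M)) (hX : ∀ θ ∈ X, (Finset.univ.image θ).card ≤ k) :
    X.card ≤ k ^ d * Fintype.card M ^ k := by
  classical
  have h : X ⊆
      (Finset.univ : Finset ((Fin d → Fin k) × (Fin k → M))).image fun x => x.2 ∘ x.1 := by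
    intro θ hθ
    have hθ' := hX θ hθ
    obtain ⟨e⟩ := Function.Embedding.nonempty_of_card_le
      (α := (Finset.univ.image θ : Finset M)) (β := Fin k) (by
        rw [Fintype.card_coe, Fintype.card_fin]; exact hθ')
    let g : Fin k → M := Function.extend e (fun y => (y : M)) fun _ => θ ⟨0, hd⟩
    have hg : ∀ y, g (e y) = (y : M) := fun y => e.injective.extend_apply _ _ _
    refine Finset.mem_image.2 ⟨(fun i => e ⟨θ i, Finset.mem_image_of_mem _ (Finset.mem_univ _)⟩, g),
      Finset.mem_univ _, ?_⟩
    funext i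
    exact hg _
  refine (Finset.card_le_card h).trans (Finset.card_image_le.trans ?_)
  simp

section
variable {d : ℕ} {F : Type} [Field F] [Fintype F]

lemma UU_normal (b : GL (Fin d) F) (hb : b ∈ BB d F) (u : GL (Fin d) F) (hu : u ∈ UU d F) :
    b * u * b⁻¹ ∈ UU d F := by
  have huB := (mem_UU.1 hu).1
  have h1 : dg d F ⟨u, huB⟩ = 1 := (dg_eq_one_iff _).2 hu
  have h2 : dg d F (⟨b, hb⟩ * ⟨u, huB⟩ * ⟨b, hb⟩⁻¹) = 1 := by
    rw [map_mul, map_mul, h1, mul_one, map_inv, mul_inv_cancel]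
  exact (dg_eq_one_iff _).1 h2

lemma card_D (N : Subgroup (GL (Fin d) F)) :
    Nat.card (N ⊓ BB d F : Subgroup (GL (Fin d) F)) =
      Nat.card ((N.subgroupOf (BB d F)).map (dg d F)) * Nat.card (N ⊓ UU d F : Subgroup (GL (Fin d) F)) := by
  let f : N.subgroupOf (BB d F) →* (Fin d → Fˣ) := (dg d F).comp (N.subgroupOf (BB d F)).subtype
  have h1 : Nat.card (N.subgroupOf (BB d F)) = Nat.card (N ⊓ BB d F : Subgroup (GL (Fin d) F)) := by
    refine Nat.card_congr ⟨fun x => ⟨x.1.1, x.2, x.1.2⟩, fun x => ⟨⟨x.1, x.2.2⟩, x.2.1⟩, ?_, ?_⟩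
    · intro x; rfl
    · intro x; rfl
  have h2 : Nat.card f.ker = Nat.card (N ⊓ UU d F : Subgroup (GL (Fin d) F)) := by
    refine Nat.card_congr ⟨fun x => ⟨x.1.1.1, x.1.2, (dg_eq_one_iff _).1 x.2⟩,
      fun x => ⟨⟨⟨x.1, (mem_UU.1 x.2.2).1⟩, x.2.1⟩, (dg_eq_one_iff _).2 x.2.2⟩, ?_, ?_⟩
    · intro x; rfl
    · intro x; rfl
  have h3 : f.range = (N.subgroupOf (BB d F)).map (dg d F) := by
    ext t
    constructor
    · rintro ⟨x, rfl⟩; exact ⟨x.1, x.2, rfl⟩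
    · rintro ⟨x, hx, rfl⟩; exact ⟨⟨x, hx⟩, rfl⟩
  rw [← h1, ← h2, ← h3, ← Subgroup.card_mul_index f.ker, Subgroup.index_ker, mul_comm]

open Classical in
lemma count_chars (D : Subgroup (Fin d → Fˣ)) [Fintype (MulChar F ℂ)] :
    D.index ≤ (Finset.univ.filter fun θ : Fin d → MulChar F ℂ =>
      ∀ t ∈ D, ∏ i, θ i (t i : F) = 1).card := by
  rw [Subgroup.index, ← CommGroup.card_monoidHom_of_hasEnoughRootsOfUnity ((Fin d → Fˣ) ⧸ D) ℂ]
  have : Fintype ((Fin d → Fˣ) ⧸ D →* ℂˣ) := Fintype.ofFinite _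
  rw [Nat.card_eq_fintype_card, ← Finset.card_univ]
  let Θ : ((Fin d → Fˣ) ⧸ D →* ℂˣ) → Fin d → MulChar F ℂ := fun χ i =>
    MulChar.ofUnitHom ((χ.comp (QuotientGroup.mk' D)).comp (MonoidHom.mulSingle (fun _ => Fˣ) i))
  have hΘ : ∀ χ i (x : Fˣ), Θ χ i (x : F) = (χ (QuotientGroup.mk' D (Pi.mulSingle i x)) : ℂ) := by
    intro χ i x
    simp only [Θ, MulChar.ofUnitHom_coe]; rfl
  refine Finset.card_le_card_of_injOn Θ ?_ ?_
  · intro χ _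
    simp only [Finset.coe_filter, Finset.mem_univ, true_and, Set.mem_ofPred_eq]
    intro t ht
    simp_rw [hΘ]
    rw [← Units.coe_prod, ← map_prod, ← map_prod, Finset.univ_prod_mulSingle]
    have : (QuotientGroup.mk' D) t = 1 := (QuotientGroup.eq_one_iff t).2 ht
    rw [this, map_one]; rfl
  · intro χ _ χ' _ h
    apply QuotientGroup.monoidHom_ext
    apply MonoidHom.pi_ext
    intro i x
    apply Units.ext
    have h1 := congrArg (fun θ : MulChar F ℂ => θ (x : F)) (congrFun h i)
    simp only [hΘ] at h1
    exact h1

end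

/-- core bound, with a Sylow subgroup of `N` in upper triangular position -/
lemma gl_core (d : ℕ) (hd : 0 < d) : ∃ C : ℕ, 0 < C ∧ ∀ (F : Type) [Field F] [Fintype F] (p : ℕ)
    [Fact p.Prime] [CharP F p] (K N : Subgroup (GL (Fin d) F)), N ≤ K →
    (∀ a ∈ K, ∀ b ∈ K, a * b * a⁻¹ * b⁻¹ ∈ N) → (N.relIndex K).Coprime p →
    ∀ P : Sylow p (N.subgroupOf K), (∀ x ∈ P, ((x : K) : GL (Fin d) F) ∈ UU d F) →
    N.relIndex K ^ d ≤ C * Fintype.card F ^ d * K.index ^ 2 := by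
  classical
  obtain ⟨J, hJ0, hJ⟩ := prime_to_p_card d
  refine ⟨(2 ^ d * J * d ^ d) ^ d, by positivity, ?_⟩
  intro F _ _ p _ _ K N hNK hcomm hcop P hP
  set q := Fintype.card F with hq
  have hq2 : 2 ≤ q := Fintype.one_lt_card
  set a := N.relIndex K with ha
  have hnorm : (N.subgroupOf K).Normal := by
    constructor
    intro n hn g
    rw [Subgroup.mem_subgroupOf] at hn ⊢
    have h1 := N.mul_mem (hcomm g g.2 n n.2) hn
    simpa using h1
  have hfr := frattini_B p K N (BB d F) (UU d F) hNK hnorm hcop (fun u hu => (mem_UU.1 hu).1)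
    UU_normal (UU_isPGroup p) P hP (J * q ^ d) (fun Y hY => hJ F p Y hY)
  rw [card_D] at hfr
  set D := (N.subgroupOf (BB d F)).map (dg d F) with hD
  have hpos : 0 < Nat.card (N ⊓ UU d F : Subgroup (GL (Fin d) F)) := Nat.card_pos
  have h1 : Nat.card D * a ≤ J * q ^ d := by
    refine Nat.le_of_mul_le_mul_right ?_ hpos
    calc _ = _ := by ring
      _ ≤ _ := hfr
  have hT : Nat.card D * D.index = (q - 1) ^ d := by
    rw [Subgroup.card_mul_index, Nat.card_fun, Nat.card_eq_fintype_card, Nat.card_eq_fintype_card,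
      Fintype.card_fin, Fintype.card_units]
  have h2 : a ≤ 2 ^ d * J * D.index := by
    have hD0 : 0 < Nat.card D := Nat.card_pos
    refine Nat.le_of_mul_le_mul_left ?_ hD0
    calc Nat.card D * a ≤ J * q ^ d := h1
      _ ≤ J * (2 * (q - 1)) ^ d := by gcongr; omega
      _ = 2 ^ d * J * (q - 1) ^ d := by rw [mul_pow]; ring
      _ = _ := by rw [← hT]; ring
  have : Fintype (MulChar F ℂ) := Fintype.ofFinite _
  let X := Finset.univ.filter fun θ : Fin d → MulChar F ℂ => ∀ t ∈ D, ∏ i, θ i (t i : F) = 1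
  have hX : D.index ≤ X.card := count_chars D
  have hXne : X.Nonempty := ⟨fun _ => 1, by
    simp only [X, Finset.mem_filter, Finset.mem_univ, true_and]
    intro t _
    exact Finset.prod_eq_one fun i _ => MulChar.one_apply_coe _⟩
  obtain ⟨θ, hθX, hθmax⟩ := Finset.exists_max_image X
    (fun θ => (Finset.univ.image θ).card) hXne
  set k := (Finset.univ.image θ).card with hk
  have hk1 : 1 ≤ k := Finset.card_pos.2 ⟨θ ⟨0, hd⟩, Finset.mem_image_of_mem _ (Finset.mem_univ _)⟩
  have hkd : k ≤ d := Finset.card_image_le.trans (by simp)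
  have hM : Fintype.card (MulChar F ℂ) ≤ q := by
    rw [← Nat.card_eq_fintype_card, MulChar.card_eq_card_units_of_hasEnoughRootsOfUnity,
      Nat.card_eq_fintype_card, Fintype.card_units]
    omega
  have hXc : X.card ≤ d ^ d * q ^ k := by
    calc X.card ≤ k ^ d * Fintype.card (MulChar F ℂ) ^ k := count_tuples d k hd X hθmax
      _ ≤ d ^ d * q ^ k := Nat.mul_le_mul (Nat.pow_le_pow_left hkd d) (Nat.pow_le_pow_left hM k)
  obtain ⟨lam, hocc⟩ := exists_occurs K N hNK hcomm θ (by
    intro b hbN hbB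
    have h3 := (Finset.mem_filter.1 hθX).2 (dg d F ⟨b, hbB⟩) ⟨⟨b, hbB⟩, hbN, rfl⟩
    exact h3)
  have hdim := dim_bound K lam θ hocc
  have hdim' : q ^ (d * (k - 1)) ≤ K.index ^ 2 := by
    convert hdim
  calc a ^ d ≤ (2 ^ d * J * (d ^ d * q ^ k)) ^ d := by
        gcongr
        exact h2.trans (by gcongr; exact hX.trans hXc)
    _ = (2 ^ d * J * d ^ d) ^ d * q ^ d * q ^ (d * (k - 1)) := by
        obtain ⟨m, hm⟩ : ∃ m, k = m + 1 := ⟨k - 1, by omega⟩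
        rw [hm, Nat.add_sub_cancel]
        ring
    _ ≤ _ := by gcongr

theorem gl_bound (d : ℕ) (hd : 0 < d) : ∃ C : ℕ, 0 < C ∧ ∀ (F : Type) [Field F] [Fintype F] (p : ℕ)
    [Fact p.Prime] [CharP F p] (K N : Subgroup (GL (Fin d) F)), N ≤ K →
    (∀ a ∈ K, ∀ b ∈ K, a * b * a⁻¹ * b⁻¹ ∈ N) → (N.relIndex K).Coprime p →
    N.relIndex K ^ d ≤ C * Fintype.card F ^ d * K.index ^ 2 := by
  obtain ⟨C, hC0, hC⟩ := gl_core d hd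
  refine ⟨C, hC0, ?_⟩
  intro F _ _ p _ _ K N hNK hcomm hcop
  obtain ⟨P⟩ : Nonempty (Sylow p (N.subgroupOf K)) := inferInstance
  let j : N.subgroupOf K →* GL (Fin d) F := K.subtype.comp (N.subgroupOf K).subtype
  obtain ⟨x, hx⟩ := conj_into_UU p ((P : Subgroup (N.subgroupOf K)).map j) (P.2.map j)
  let c : GL (Fin d) F ≃* GL (Fin d) F := MulAut.conj x
  have hcx : ∀ g, c g = x * g * x⁻¹ := fun g => rfl
  let K' := K.map c.toMonoidHom
  let N' := N.map c.toMonoidHom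
  have hN'K' : N' ≤ K' := Subgroup.map_mono hNK
  have hrel : N'.relIndex K' = N.relIndex K :=
    Subgroup.relIndex_map_map_of_injective N K c.injective
  have hind : K'.index = K.index := Subgroup.index_map_equiv K c
  have hcomm' : ∀ a ∈ K', ∀ b ∈ K', a * b * a⁻¹ * b⁻¹ ∈ N' := by
    rintro _ ⟨a, ha, rfl⟩ _ ⟨b, hb, rfl⟩
    exact ⟨_, hcomm a ha b hb, by simp⟩
  -- transport the Sylow subgroup
  let e : N.subgroupOf K →* N'.subgroupOf K' :=
    { toFun := fun y => ⟨⟨c ((y : K) : GL (Fin d) F), ⟨_, y.1.2, rfl⟩⟩, ⟨_, y.2, rfl⟩⟩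
      map_one' := by apply Subtype.ext; apply Subtype.ext; exact map_one c
      map_mul' := fun a b => by apply Subtype.ext; apply Subtype.ext; exact map_mul c _ _ }
  have he : Function.Bijective e := by
    constructor
    · intro a b h
      apply Subtype.ext; apply Subtype.ext
      exact c.injective (congrArg (fun z : N'.subgroupOf K' => ((z : K') : GL (Fin d) F)) h)
    · rintro ⟨⟨z, hz⟩, hz'⟩
      obtain ⟨n, hn, h⟩ := hz'
      exact ⟨⟨⟨n, hNK hn⟩, hn⟩, by apply Subtype.ext; apply Subtype.ext; exact h⟩
  let P' : Sylow p (N'.subgroupOf K') := P.mapSurjective he.2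
  have := hC F p K' N' hN'K' hcomm' (by rw [hrel]; exact hcop) P' (by
    intro y hy
    have hy' : y ∈ (P : Subgroup (N.subgroupOf K)).map e := hy
    obtain ⟨z, hz, rfl⟩ := hy'
    exact hx _ ⟨z, hz, rfl⟩)
  rwa [hrel, hind] at this


open Matrix.SpecialLinearGroup in
lemma diag2n_decomp {ι F : Type*} [Fintype ι] [DecidableEq ι] [Field F] {i j : ι} (hij : i ≠ j) (a : F)
    (ha : a ≠ 0) : diag2n hij a ha = transvection hij a * transvection hij.symm (- a⁻¹) *
      transvection hij a * transvection hij (-1) * transvection hij.symm 1 * transvection hij (-1) := by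
  apply Subtype.ext
  simp only [Matrix.SpecialLinearGroup.coe_mul, transvection_coe, diag2n_coe]
  simp only [mul_add, add_mul, Matrix.single_mul_single_same, one_mul, mul_one,
    Matrix.single_mul_single_of_ne _ _ _ _ hij, Matrix.single_mul_single_of_ne _ _ _ _ hij.symm,
    zero_mul, mul_zero, add_zero, zero_add]
  ext k l
  simp only [Matrix.add_apply, Matrix.single_apply, Matrix.diagonal_apply, Matrix.one_apply]
  have hji := hij.symm
  by_cases h1 : k = i
  · subst h1
    by_cases h2 : l = k
    · subst h2; simp [hij, hji]; field_simp; ring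
    · by_cases h3 : l = j
      · subst h3; simp [hij, hji]; field_simp; ring
      · simp [hij, hji, Ne.symm h2, Ne.symm h3]
  · by_cases h1' : k = j
    · subst h1'
      by_cases h2 : l = k
      · subst h2; simp [hij, hji]; try (field_simp; ring)
      · by_cases h3 : l = i
        · subst h3; simp [hij, hji]; try (field_simp; ring)
        · simp [hij, hji, Ne.symm h2, Ne.symm h3]
    · by_cases h2 : k = l
      · subst h2; simp [h1, h1', Ne.symm h1, Ne.symm h1']
      · simp [h1, h1', h2, Ne.symm h1, Ne.symm h1']

section
open Matrix.SpecialLinearGroup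
variable {d : ℕ} {F : Type} [Field F]

lemma sl_eq_top (hd : 2 ≤ d) (R : Subgroup (Matrix.SpecialLinearGroup (Fin d) F))
    (h : ∀ (i j : Fin d) (hij : i ≠ j) (a : F), transvection hij a ∈ R) : R = ⊤ := by
  have : Nontrivial (Fin d) := Fin.nontrivial_iff_two_le.2 hd
  rw [eq_top_iff]
  intro M _
  refine diagonal_transvection_induction' (fun M => M ∈ R) M ?_ h (fun _ _ => mul_mem)
  intro i j hij c hc
  rw [diag2n_decomp]
  exact mul_mem (mul_mem (mul_mem (mul_mem (mul_mem (h _ _ _ _) (h _ _ _ _)) (h _ _ _ _))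
    (h _ _ _ _)) (h _ _ _ _)) (h _ _ _ _)

lemma diag_conj {i j : Fin d} (hij : i ≠ j) (s : F) (hs : s ≠ 0) (c : F) :
    diag2n hij s hs * transvection hij c * (diag2n hij s hs)⁻¹ = transvection hij (s ^ 2 * c) := by
  rw [mul_inv_eq_iff_eq_mul]
  apply Subtype.ext
  simp only [Matrix.SpecialLinearGroup.coe_mul, transvection_coe, diag2n_coe, mul_add, add_mul,
    mul_one, one_mul]
  congr 1
  ext k l
  rw [Matrix.diagonal_mul, Matrix.mul_diagonal, Matrix.single_apply, Matrix.single_apply]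
  by_cases h : i = k ∧ j = l
  · obtain ⟨rfl, rfl⟩ := h
    simp [hij.symm]
    field_simp
  · simp [h]

lemma trans_mem_normal (hchar : (2 : F) ≠ 0) (R : Subgroup (Matrix.SpecialLinearGroup (Fin d) F)) [hR : R.Normal]
    {i j : Fin d} (hij : i ≠ j) (c : F) (hc : c ≠ 0) (h : transvection hij c ∈ R) (a : F) :
    transvection hij a ∈ R := by
  have h1 : ∀ s : F, transvection hij (s ^ 2 * c) ∈ R := by
    intro s
    by_cases hs : s = 0
    · subst hs; simp
    · rw [← diag_conj hij s hs]; exact hR.conj_mem _ h _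
  have h2 : a = ((a / c + 1) / 2) ^ 2 * c + -(((a / c - 1) / 2) ^ 2 * c) := by
    field_simp; ring
  rw [h2, transvection_add, ← transvection_inv]
  exact mul_mem (h1 _) (inv_mem (h1 _))

lemma sl_small_index (hd : 2 ≤ d) [Fintype F] (hchar : (2 : F) ≠ 0)
    (H : Subgroup (Matrix.SpecialLinearGroup (Fin d) F)) (hH : (H.index).factorial < Fintype.card F) :
    H = ⊤ := by
  have hcore : H.normalCore = ⊤ := by
    refine sl_eq_top hd _ fun i j hij a => ?_
    let f : F → Equiv.Perm (Matrix.SpecialLinearGroup (Fin d) F ⧸ H) := fun c =>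
      MulAction.toPermHom _ (Matrix.SpecialLinearGroup (Fin d) F ⧸ H) (transvection hij c)
    have hf : ¬ Function.Injective f := by
      intro hinj
      have h1 := Nat.card_le_card_of_injective f hinj
      rw [Nat.card_perm, Nat.card_eq_fintype_card] at h1
      exact absurd h1 (not_le.2 hH)
    rw [Function.Injective] at hf
    push Not at hf
    obtain ⟨b, c, hbc, hne⟩ := hf
    refine trans_mem_normal hchar H.normalCore hij (b - c) (sub_ne_zero.2 hne) ?_ a
    rw [Subgroup.normalCore_eq_ker, MonoidHom.mem_ker, sub_eq_add_neg, transvection_add,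
      ← transvection_inv, map_mul, map_inv, mul_inv_eq_one]
    exact hbc
  exact eq_top_iff.2 (hcore ▸ H.normalCore_le)

lemma trans_pow {i j : Fin d} (hij : i ≠ j) (c : F) (n : ℕ) :
    transvection hij c ^ n = transvection hij (n * c) := by
  induction n with
  | zero => simp
  | succ n ih => rw [pow_succ, ih, ← transvection_add]; push_cast; ring_nf

lemma small_contra (hd : 2 ≤ d) [Fintype F] (hchar : 3 < ringChar F)
    (H : Subgroup (Matrix.SpecialLinearGroup (Fin d) F)) (N : Subgroup H) (hN : N.Normal)
    (hcop : Nat.Coprime N.index (ringChar F)) (h1 : 1 < N.index)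
    (hH : (H.index).factorial < Fintype.card F) : False := by
  have h2 : (2 : F) ≠ 0 := by
    intro h
    have := (ringChar.spec F 2).1 (by exact_mod_cast h)
    exact absurd (Nat.le_of_dvd (by norm_num) this) (by omega)
  have hA : (N.index : F) ≠ 0 := by
    intro h
    have h3 := (ringChar.spec F _).1 h
    have h4 := Nat.eq_one_of_dvd_coprimes hcop h3 dvd_rfl
    omega
  have hHt := sl_small_index hd h2 H hH
  have hNt : N.map H.subtype = ⊤ := by
    refine sl_eq_top hd _ fun i j hij a => ?_
    have hm : transvection hij (a / N.index) ∈ H := hHt.ge (Subgroup.mem_top _)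
    refine ⟨⟨transvection hij (a / N.index), hm⟩ ^ N.index, N.pow_index_mem _, ?_⟩
    rw [map_pow]
    show transvection hij (a / N.index) ^ N.index = _
    rw [trans_pow, mul_div_cancel₀ _ hA]
  have : N = ⊤ := by
    rw [eq_top_iff]
    intro x _
    have hx : (x : Matrix.SpecialLinearGroup (Fin d) F) ∈ N.map H.subtype := by rw [hNt]; trivial
    obtain ⟨y, hy, hyx⟩ := hx
    rwa [← Subtype.ext hyx]
  rw [this, Subgroup.index_top] at h1
  omega

end


lemma sl_bound (d : ℕ) (hd : 0 < d) : ∃ C : ℕ, 0 < C ∧ ∀ (F : Type) [Field F] [Fintype F] (p : ℕ)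
    [Fact p.Prime] [CharP F p] (H : Subgroup (Matrix.SpecialLinearGroup (Fin d) F)) (N : Subgroup H),
    (∀ a b : H, a * b * a⁻¹ * b⁻¹ ∈ N) → Nat.Coprime N.index p →
    N.index ^ d ≤ C * H.index ^ 2 := by
  obtain ⟨C, hC0, hC⟩ := gl_bound d hd
  refine ⟨2 ^ d * d ^ d * C * d ^ 2, by positivity, ?_⟩
  intro F _ _ p hp _ H N hcomm hcop
  set q := Fintype.card F with hq
  have hq2 : 2 ≤ q := Fintype.one_lt_card
  let g : H →* GL (Fin d) F := Matrix.SpecialLinearGroup.toGL.comp H.subtype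
  have hg : Function.Injective g :=
    Matrix.SpecialLinearGroup.toGL_injective.comp H.subtype_injective
  let s : Fˣ →* GL (Fin d) F := Matrix.GeneralLinearGroup.scalar (Fin d)
  let f : H × Fˣ →* GL (Fin d) F := MonoidHom.noncommCoprod g s
    (fun h z => (Matrix.GeneralLinearGroup.scalar_commute z (g h)).symm)
  have hf : ∀ x, f x = g x.1 * s x.2 := fun x => rfl
  let K := f.range
  let N' := N.map g
  have hN'K : N' ≤ K := by
    rintro _ ⟨n, _, rfl⟩
    exact ⟨(n, 1), by rw [hf]; simp⟩
  have hcomm' : ∀ a ∈ K, ∀ b ∈ K, a * b * a⁻¹ * b⁻¹ ∈ N' := by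
    rintro _ ⟨x, rfl⟩ _ ⟨y, rfl⟩
    refine ⟨_, hcomm x.1 y.1, ?_⟩
    rw [← map_inv, ← map_inv, ← map_mul, ← map_mul, ← map_mul, hf]
    have : (x * y * x⁻¹ * y⁻¹).2 = 1 := by
      show x.2 * y.2 * x.2⁻¹ * y.2⁻¹ = 1
      rw [mul_comm x.2, mul_inv_cancel_right, mul_inv_cancel]
    rw [this, map_one, mul_one]
    rfl
  set c := Nat.card f.ker with hc
  have hc0 : 0 < c := Nat.card_pos
  have hcd : c ≤ d := by
    have : NeZero d := ⟨hd.ne'⟩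
    refine le_trans ?_ (card_rootsOfUnity F d)
    refine Nat.card_le_card_of_injective (fun x : f.ker => (⟨x.1.2, ?_⟩ : rootsOfUnity d F)) ?_
    · have hx : g x.1.1 * s x.1.2 = 1 := x.2
      have h1 := congrArg (fun m : GL (Fin d) F => (m : Matrix (Fin d) (Fin d) F).det) hx
      simp only [Units.val_mul, Matrix.det_mul] at h1
      have h2 : ((g x.1.1 : GL (Fin d) F) : Matrix (Fin d) (Fin d) F).det = 1 := x.1.1.1.2
      have h3 : ((s x.1.2 : GL (Fin d) F) : Matrix (Fin d) (Fin d) F).det = (x.1.2 : F) ^ d := by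
        simp [s]
      rw [h2, h3] at h1
      rw [mem_rootsOfUnity]
      apply Units.ext
      simpa using h1
    · rintro ⟨x, hx⟩ ⟨y, hy⟩ h
      have h1 : x.2 = y.2 := congrArg Subtype.val h
      have hx' : g x.1 * s x.2 = 1 := hx
      have hy' : g y.1 * s y.2 = 1 := hy
      rw [h1] at hx'
      have h2 : x.1 = y.1 := hg (mul_right_cancel (hx'.trans hy'.symm))
      exact Subtype.ext (Prod.ext h2 h1)
  have hq1 : Nat.card Fˣ = q - 1 := by classical rw [Nat.card_eq_fintype_card, Fintype.card_units]
  have hK : c * Nat.card K = Nat.card H * (q - 1) := by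
    rw [hc, ← Subgroup.index_ker, Subgroup.card_mul_index, Nat.card_prod, hq1]
  have hN' : Nat.card N' = Nat.card N := Nat.card_congr (N.equivMapOfInjective g hg).symm.toEquiv
  have hrelc : Nat.card N' * N'.relIndex K = Nat.card K := by
    rw [mul_comm]
    have := Subgroup.relIndex_mul_relIndex ⊥ N' K bot_le hN'K
    rw [Subgroup.relIndex_bot_left, Subgroup.relIndex_bot_left] at this
    rw [mul_comm]; exact this
  set a := N'.relIndex K with ha
  have hNH : Nat.card N * N.index = Nat.card H := N.card_mul_index
  have hNpos : 0 < Nat.card N := Nat.card_pos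
  have hca : c * a = N.index * (q - 1) := by
    refine Nat.eq_of_mul_eq_mul_left hNpos ?_
    calc Nat.card N * (c * a) = c * (Nat.card N' * a) := by rw [hN']; ring
      _ = _ := by rw [hrelc, hK, ← hNH]; ring
  have hcopa : a.Coprime p := by
    have h1 : (q - 1).Coprime p := by
      obtain ⟨k, -, hk⟩ := FiniteField.card F p
      have h2 : p ∣ q := by rw [hq, hk]; exact dvd_pow_self p k.ne_zero
      have h3 : (q - 1).Coprime q := by
        have := Nat.coprime_self_sub_left (m := 1) (n := q) (by omega)
        rw [this]; simp
      exact h3.coprime_dvd_right h2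
    exact (Nat.Coprime.mul_left hcop h1).coprime_dvd_left ⟨c, by rw [← hca]; ring⟩
  have hmain := hC F p K N' hN'K hcomm' hcopa
  -- the index of K
  have hGL : Nat.card (GL (Fin d) F) ≤ Nat.card (Matrix.SpecialLinearGroup (Fin d) F) * (q - 1) := by
    rw [← hq1, ← Nat.card_prod]
    let δ : GL (Fin d) F →* Fˣ := Matrix.GeneralLinearGroup.det
    rw [← Subgroup.card_mul_index δ.ker, Subgroup.index_ker, Nat.card_prod]
    refine Nat.mul_le_mul ?_ (Subgroup.card_le_card_group _)
    refine Nat.card_le_card_of_injective (fun x : δ.ker =>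
      (⟨(x : GL (Fin d) F), congrArg Units.val (MonoidHom.mem_ker.1 x.2)⟩ :
        Matrix.SpecialLinearGroup (Fin d) F)) ?_
    intro x y h
    exact Subtype.ext (Units.ext (congrArg Subtype.val h))
  have hKind : K.index ≤ d * H.index := by
    have hKpos : 0 < Nat.card K := Nat.card_pos
    refine Nat.le_of_mul_le_mul_left ?_ hKpos
    calc Nat.card K * K.index = Nat.card (GL (Fin d) F) := K.card_mul_index
      _ ≤ Nat.card (Matrix.SpecialLinearGroup (Fin d) F) * (q - 1) := hGL
      _ = (Nat.card H * (q - 1)) * H.index := by rw [← H.card_mul_index]; ring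
      _ = (c * Nat.card K) * H.index := by rw [hK]
      _ ≤ (d * Nat.card K) * H.index := by gcongr
      _ = _ := by ring
  have hpos : 0 < (q - 1) ^ d := by apply Nat.pow_pos; omega
  refine Nat.le_of_mul_le_mul_right ?_ hpos
  calc N.index ^ d * (q - 1) ^ d = c ^ d * a ^ d := by rw [← mul_pow, ← hca, mul_pow]
    _ ≤ d ^ d * (C * q ^ d * K.index ^ 2) := by gcongr
    _ ≤ d ^ d * (C * (2 * (q - 1)) ^ d * (d * H.index) ^ 2) := by gcongr; omega
    _ = _ := by rw [mul_pow, mul_pow]; ring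

theorem index_bound_SL (d : ℕ) (hd : 2 ≤ d) :
    ∀ ε > (0 : ℝ), ∃ Q : ℕ, ∀ (F : Type) [Field F] [Fintype F], Q < Fintype.card F →
      3 < ringChar F →
      ∀ (H : Subgroup (Matrix.SpecialLinearGroup (Fin d) F)) (N : Subgroup H),
        N.Normal →
        (∀ a b : H, a * b * a⁻¹ * b⁻¹ ∈ N) →  -- the quotient `H/N` is abelian
        Nat.Coprime N.index (ringChar F) →    -- `|H/N| = N.index` is coprime to `p`
        1 < N.index →
        ((d : ℝ) / 2 - ε) * Real.log N.index ≤ Real.log H.index := by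
  intro ε hε
  obtain ⟨C, hC0, hC⟩ := sl_bound d (by omega)
  -- threshold for the abelian quotient
  obtain ⟨M, hM⟩ := exists_nat_gt (Real.exp (Real.log C / (2 * ε)))
  refine ⟨(M ^ d).factorial, ?_⟩
  intro F _ _ hQ hchar H N hN hcomm hcop h1
  have hp : Fact (ringChar F).Prime := ⟨CharP.char_is_prime F (ringChar F)⟩
  have hCP : CharP F (ringChar F) := ringChar.charP F
  have hb := hC F (ringChar F) H N hcomm hcop
  have hHpos : 0 < H.index := Nat.pos_of_ne_zero H.index_ne_zero_of_finite
  have hA1 : (1 : ℝ) < N.index := by exact_mod_cast h1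
  have hA0 : 0 < Real.log N.index := Real.log_pos hA1
  rcases le_or_gt M N.index with hMA | hMA
  · have hlog : (d : ℝ) * Real.log N.index ≤ Real.log C + 2 * Real.log H.index := by
      have h2 : ((N.index : ℝ)) ^ d ≤ (C : ℝ) * (H.index : ℝ) ^ 2 := by exact_mod_cast hb
      have h3 := Real.log_le_log (by positivity) h2
      rw [Real.log_pow, Real.log_mul (by positivity) (by positivity), Real.log_pow] at h3
      exact_mod_cast h3
    have hlogA : Real.log C / (2 * ε) ≤ Real.log N.index := by
      rw [Real.le_log_iff_exp_le (by linarith)]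
      exact hM.le.trans (by exact_mod_cast hMA)
    rw [div_le_iff₀ (by positivity)] at hlogA
    nlinarith
  · have hbig : M ^ d ≤ H.index := by
      by_contra hlt
      push Not at hlt
      exact small_contra hd hchar H N hN hcop h1
        (lt_of_le_of_lt (Nat.factorial_le hlt.le) hQ)
    have h2 : ((N.index : ℝ)) ^ d ≤ (H.index : ℝ) := by
      have : N.index ^ d ≤ H.index := (Nat.pow_le_pow_left hMA.le d).trans hbig
      exact_mod_cast this
    have h3 := Real.log_le_log (by positivity) h2
    rw [Real.log_pow] at h3
    refine le_trans ?_ h3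
    apply mul_le_mul_of_nonneg_right _ hA0.le
    have : (0 : ℝ) ≤ d := Nat.cast_nonneg d
    linarith
end
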